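/- arXiv:2003.01361 — 6 statements merged into one kernel-verified Lean document; each statement's English description precedes it below -/
import Mathlib

section
/- Let T : [0,1] → [0,1] be a piecewise C² expanding map satisfying the large image property, and let μ be an ergodic T-invariant Borel probability measure which is absolutely continuous with respect to Lebesgue measure and whose density h satisfies c⁻¹ ≤ h ≤ c for some constant c ≥ 1. Then for every θ < 1/2 and every κ > 0, if the sequence (r_n) of nonnegative reals satisfies r_n ≥ κ/(n (log n)^θ) for all n ≥ 2, then μ(R_io(r_n)) = 1. -/
open MeasureTheory

/-- `T` is a piecewise `C²` expanding map of `[0,1]` with expansion constants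
`1 < lam ≤ Lam`: there is a finite partition `0 = a 0 < a 1 < … < a N = 1` of `[0,1]`
such that on each partition interval `T` agrees with a `C²` function whose derivative
has modulus between `lam` and `Lam`. -/
def IsPiecewiseC2ExpandingWith (T : ℝ → ℝ) (lam Lam : ℝ) : Prop :=
  1 < lam ∧ lam ≤ Lam ∧ Set.MapsTo T (Set.Icc 0 1) (Set.Icc 0 1) ∧
  ∃ (N : ℕ) (a : ℕ → ℝ), 0 < N ∧ a 0 = 0 ∧ a N = 1 ∧ (∀ i < N, a i < a (i + 1)) ∧
    ∀ i < N, ∃ g : ℝ → ℝ,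
      ContDiffOn ℝ 2 g (Set.Icc (a i) (a (i + 1))) ∧
      Set.EqOn T g (Set.Ico (a i) (a (i + 1))) ∧
      ∀ x ∈ Set.Icc (a i) (a (i + 1)),
        lam ≤ |derivWithin g (Set.Icc (a i) (a (i + 1))) x| ∧
        |derivWithin g (Set.Icc (a i) (a (i + 1))) x| ≤ Lam

/-- `T` is a piecewise `C²` expanding map of `[0,1]`. -/
def IsPiecewiseC2Expanding (T : ℝ → ℝ) : Prop :=
  ∃ lam Lam : ℝ, IsPiecewiseC2ExpandingWith T lam Lam

/-- `I` is a maximal interval of continuity of `T^n` in `[0,1]`. -/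
def MaximalIntervalOfContinuity (T : ℝ → ℝ) (n : ℕ) (I : Set ℝ) : Prop :=
  I.Nonempty ∧ I ⊆ Set.Icc 0 1 ∧ I.OrdConnected ∧ ContinuousOn (T^[n]) I ∧
  ∀ J : Set ℝ, J ⊆ Set.Icc 0 1 → J.OrdConnected → ContinuousOn (T^[n]) J → I ⊆ J → J = I

/-- The large image property: there is `c₀ ∈ (0,1]` such that for every `n`, the image
under `T^n` of every maximal interval of continuity of `T^n` has length at least `c₀`. -/
def LargeImageProperty (T : ℝ → ℝ) : Prop :=
  ∃ c₀ : ℝ, 0 < c₀ ∧ c₀ ≤ 1 ∧ ∀ (n : ℕ) (I : Set ℝ),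
    MaximalIntervalOfContinuity T n I → c₀ ≤ (volume (T^[n] '' I)).toReal

/-- The set of points returning infinitely often to the shrinking targets around
themselves: `x` such that `T^n(x) ∈ B(x, r_n)` for infinitely many `n`. -/
def Rio {X : Type*} [PseudoMetricSpace X] (T : X → X) (r : ℕ → ℝ) : Set X :=
  {x | ∃ᶠ n in Filter.atTop, T^[n] x ∈ Metric.ball x (r n)}

section Branches

open Set Filter Topology
open scoped ENNReal

/-- `P` is a finite family of disjoint intervals covering `(0, 1)` up to a null set, on each of which
`S` has derivative `S'` with modulus in `[lam, Lam]` and distortion controlled by `d`. -/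
structure ExpandingBranches {ι : Type} (S S' : ℝ → ℝ) (P : ι → Set ℝ) (lam Lam d : ℝ) : Prop where
  ordConnected : ∀ i, (P i).OrdConnected
  subset : ∀ i, P i ⊆ Ioo 0 1
  volume_pos : ∀ i, 0 < volume (P i)
  disjoint : Pairwise (Function.onFun Disjoint P)
  cover : volume (Ioo 0 1 \ ⋃ i, P i) = 0
  mapsTo : ∀ i, MapsTo S (P i) (Ioo 0 1)
  hasDeriv : ∀ i, ∀ x ∈ P i, HasDerivWithinAt S (S' x) (P i) x
  le_deriv : ∀ i, ∀ x ∈ P i, lam ≤ |S' x|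
  deriv_le : ∀ i, ∀ x ∈ P i, |S' x| ≤ Lam
  distortion : ∀ i, ∀ x ∈ P i, ∀ y ∈ P i, |S' x| ≤ Real.exp (d * |x - y|) * |S' y|
  one_lt : 1 < lam
  distortion_nonneg : 0 ≤ d

/-- `S` admits finitely many expanding branches. -/
def HasExpandingBranches (S : ℝ → ℝ) (lam Lam d : ℝ) : Prop :=
  ∃ (ι : Type) (_ : Fintype ι) (P : ι → Set ℝ) (S' : ℝ → ℝ), ExpandingBranches S S' P lam Lam d

namespace ExpandingBranches

variable {ι : Type} {S S' : ℝ → ℝ} {P : ι → Set ℝ} {lam Lam d : ℝ}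

lemma measurableSet (h : ExpandingBranches S S' P lam Lam d) (i : ι) : MeasurableSet (P i) :=
  (h.ordConnected i).measurableSet

lemma continuousOn (h : ExpandingBranches S S' P lam Lam d) (i : ι) : ContinuousOn S (P i) :=
  fun x hx => (h.hasDeriv i x hx).continuousWithinAt

lemma exists_slope (h : ExpandingBranches S S' P lam Lam d) {i : ι} {x y : ℝ} (hx : x ∈ P i)
    (hy : y ∈ P i) (hxy : x < y) : ∃ z ∈ P i, S y - S x = S' z * (y - x) := by
  have hsub : Icc x y ⊆ P i := (h.ordConnected i).out hx hy
  obtain ⟨z, hz, hz'⟩ := exists_hasDerivAt_eq_slope S S' hxy ((h.continuousOn i).mono hsub)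
    (fun z hz => (h.hasDeriv i z (hsub (Ioo_subset_Icc_self hz))).hasDerivAt
      (mem_of_superset (Icc_mem_nhds hz.1 hz.2) hsub))
  refine ⟨z, hsub (Ioo_subset_Icc_self hz), ?_⟩
  rw [hz', div_mul_cancel₀]
  linarith

lemma abs_slope (h : ExpandingBranches S S' P lam Lam d) {i : ι} {x y : ℝ} (hx : x ∈ P i)
    (hy : y ∈ P i) : lam * |x - y| ≤ |S x - S y| ∧ |S x - S y| ≤ Lam * |x - y| := by
  wlog hxy : x ≤ y generalizing x y
  · have := this hy hx (le_of_not_ge hxy)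
    rwa [abs_sub_comm y x, abs_sub_comm (S y)] at this
  rcases hxy.eq_or_lt with rfl | hxy
  · simp
  obtain ⟨z, hz, hz'⟩ := h.exists_slope hx hy hxy
  rw [abs_sub_comm x y, abs_sub_comm (S x), hz', abs_mul]
  exact ⟨mul_le_mul_of_nonneg_right (h.le_deriv i z hz) (abs_nonneg _),
    mul_le_mul_of_nonneg_right (h.deriv_le i z hz) (abs_nonneg _)⟩

lemma injOn (h : ExpandingBranches S S' P lam Lam d) (i : ι) : InjOn S (P i) := by
  intro x hx y hy hxy
  have := (h.abs_slope hx hy).1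
  rw [hxy, sub_self, abs_zero] at this
  have h1 : |x - y| ≤ 0 := by nlinarith [h.one_lt, abs_nonneg (x - y)]
  exact sub_eq_zero.1 (abs_eq_zero.1 (le_antisymm h1 (abs_nonneg _)))

lemma ordConnected_image (h : ExpandingBranches S S' P lam Lam d) {i : ι} {W : Set ℝ}
    (hW : W.OrdConnected) (hWP : W ⊆ P i) : (S '' W).OrdConnected :=
  (hW.isPreconnected.image S ((h.continuousOn i).mono hWP)).ordConnected

lemma ordConnected_inter_preimage (h : ExpandingBranches S S' P lam Lam d) (i : ι) {Q : Set ℝ}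
    (hQ : Q.OrdConnected) : (P i ∩ S ⁻¹' Q).OrdConnected := by
  refine ⟨fun x hx z hz y hy => ?_⟩
  have hsub : Icc x z ⊆ P i := (h.ordConnected i).out hx.1 hz.1
  have hxz : x ≤ z := hy.1.trans hy.2
  refine ⟨hsub hy, ?_⟩
  rcases ContinuousOn.strictMonoOn_of_injOn_Icc' hxz ((h.continuousOn i).mono hsub)
    ((h.injOn i).mono hsub) with hm | hm
  · exact hQ.out hx.2 hz.2 ⟨hm.monotoneOn ⟨le_rfl, hxz⟩ hy hy.1, hm.monotoneOn hy ⟨hxz, le_rfl⟩ hy.2⟩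
  · exact hQ.out hz.2 hx.2 ⟨hm.antitoneOn hy ⟨hxz, le_rfl⟩ hy.2, hm.antitoneOn ⟨le_rfl, hxz⟩ hy hy.1⟩

lemma volume_inter_preimage_null (h : ExpandingBranches S S' P lam Lam d) (hS : Measurable S) (i : ι)
    {N : Set ℝ} (hN : MeasurableSet N) (hN0 : volume N = 0) : volume (P i ∩ S ⁻¹' N) = 0 := by
  set s := P i ∩ S ⁻¹' N
  have hs : MeasurableSet s := (h.measurableSet i).inter (hS hN)
  have h1 := lintegral_image_eq_lintegral_abs_deriv_mul hs
    (fun x hx => (h.hasDeriv i x hx.1).mono inter_subset_left)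
    ((h.injOn i).mono inter_subset_left) (fun _ => 1)
  have h2 : volume (S '' s) = 0 := measure_mono_null (by rintro _ ⟨x, hx, rfl⟩; exact hx.2) hN0
  simp only [setLIntegral_one, h2, mul_one] at h1
  have h3 : ∫⁻ x in s, 1 ≤ ∫⁻ x in s, ENNReal.ofReal |S' x| := by
    refine setLIntegral_mono' hs fun x hx => ?_
    rw [ENNReal.one_le_ofReal]
    exact h.one_lt.le.trans (h.le_deriv i x hx.1)
  rw [← h1, setLIntegral_one] at h3
  exact le_antisymm h3 bot_le

/-- The branches of a composition. -/
lemma comp {κ : Type} [Fintype ι] [Fintype κ] {R R' : ℝ → ℝ} {Q : κ → Set ℝ} {lam₂ Lam₂ d₂ : ℝ}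
    (hR : ExpandingBranches R R' Q lam₂ Lam₂ d₂) (h : ExpandingBranches S S' P lam Lam d)
    (hS : Measurable S) :
    ExpandingBranches (R ∘ S) (fun x => R' (S x) * S' x)
      (fun p : {p : ι × κ // 0 < volume (P p.1 ∩ S ⁻¹' Q p.2)} => P p.1.1 ∩ S ⁻¹' Q p.1.2)
      (lam₂ * lam) (Lam₂ * Lam) (d₂ * Lam + d) where
  ordConnected p := h.ordConnected_inter_preimage _ (hR.ordConnected _)
  subset p := inter_subset_left.trans (h.subset _)
  volume_pos p := p.2
  disjoint := by
    rintro ⟨⟨i, j⟩, hp⟩ ⟨⟨i', j'⟩, hp'⟩ hne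
    simp only [Function.onFun]
    by_cases hi : i = i'
    · have hj : j ≠ j' := by
        rintro rfl
        exact hne (by simp [hi])
      exact ((hR.disjoint hj).preimage S).mono inter_subset_right inter_subset_right
    · exact (h.disjoint hi).mono inter_subset_left inter_subset_left
  cover := by
    have hN : MeasurableSet (Ioo (0 : ℝ) 1 \ ⋃ j, Q j) :=
      measurableSet_Ioo.diff (MeasurableSet.iUnion hR.measurableSet)
    refine measure_mono_null (t := (Ioo 0 1 \ ⋃ i, P i) ∪ ((⋃ i, P i ∩ S ⁻¹' (Ioo 0 1 \ ⋃ j, Q j)) ∪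
      ⋃ p : {p : ι × κ // ¬ 0 < volume (P p.1 ∩ S ⁻¹' Q p.2)}, P p.1.1 ∩ S ⁻¹' Q p.1.2)) ?_ ?_
    · rintro x ⟨hx, hx'⟩
      by_cases h1 : x ∈ ⋃ i, P i
      · right
        obtain ⟨i, hi⟩ := mem_iUnion.1 h1
        by_cases h2 : S x ∈ ⋃ j, Q j
        · right
          obtain ⟨j, hj⟩ := mem_iUnion.1 h2
          refine mem_iUnion.2 ⟨⟨(i, j), fun h3 => hx' ?_⟩, hi, hj⟩
          exact mem_iUnion.2 ⟨⟨(i, j), h3⟩, hi, hj⟩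
        · left
          exact mem_iUnion.2 ⟨i, hi, h.mapsTo i hi, h2⟩
      · exact Or.inl ⟨hx, h1⟩
    · refine measure_union_null h.cover (measure_union_null ?_ ?_)
      · exact measure_iUnion_null fun i => h.volume_inter_preimage_null hS i hN hR.cover
      · exact measure_iUnion_null fun p => le_antisymm (not_lt.1 p.2) bot_le
  mapsTo p x hx := hR.mapsTo _ hx.2
  hasDeriv p x hx := (hR.hasDeriv _ (S x) hx.2).comp x
    ((h.hasDeriv _ x hx.1).mono inter_subset_left) (fun y hy => hy.2)
  le_deriv p x hx := by
    rw [abs_mul]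
    exact mul_le_mul (hR.le_deriv _ _ hx.2) (h.le_deriv _ _ hx.1) (by linarith [h.one_lt])
      (abs_nonneg _)
  deriv_le p x hx := by
    rw [abs_mul]
    exact mul_le_mul (hR.deriv_le _ _ hx.2) (h.deriv_le _ _ hx.1) (abs_nonneg _)
      ((abs_nonneg _).trans (hR.deriv_le _ _ hx.2))
  distortion p x hx y hy := by
    have h1 := hR.distortion _ _ hx.2 _ hy.2
    have h2 := h.distortion _ _ hx.1 _ hy.1
    have h3 := (h.abs_slope hx.1 hy.1).2
    have h4 : Real.exp (d₂ * |S x - S y|) ≤ Real.exp (d₂ * Lam * |x - y|) := by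
      rw [Real.exp_le_exp, mul_assoc]
      exact mul_le_mul_of_nonneg_left h3 hR.distortion_nonneg
    rw [abs_mul, abs_mul, add_mul, Real.exp_add]
    calc |R' (S x)| * |S' x|
        ≤ (Real.exp (d₂ * Lam * |x - y|) * |R' (S y)|) * (Real.exp (d * |x - y|) * |S' y|) := by
          refine mul_le_mul (h1.trans ?_) h2 (abs_nonneg _) (by positivity)
          gcongr
      _ = _ := by ring
  one_lt := by nlinarith [h.one_lt, hR.one_lt]
  distortion_nonneg := by
    obtain ⟨p⟩ : Nonempty ι := by
      by_contra hne
      rw [not_nonempty_iff] at hne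
      have := h.cover
      simp at this
    have hpos := h.volume_pos p
    obtain ⟨x, hx⟩ := nonempty_of_measure_ne_zero hpos.ne'
    have : 0 ≤ Lam := (abs_nonneg _).trans (h.deriv_le p x hx)
    have := mul_nonneg hR.distortion_nonneg this
    linarith [h.distortion_nonneg]

end ExpandingBranches

lemma HasExpandingBranches.iterate {S : ℝ → ℝ} {lam Lam d : ℝ} (h : HasExpandingBranches S lam Lam d)
    (hS : Measurable S) (k : ℕ) :
    ∃ Lam' d', HasExpandingBranches S^[k + 1] (lam ^ (k + 1)) Lam' d' := by
  classical
  induction k with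
  | zero => exact ⟨Lam, d, by simpa using h⟩
  | succ k ih =>
    obtain ⟨Lam₂, d₂, ι₂, _, Q, R', hR⟩ := ih
    obtain ⟨ι, _, P, S', hP⟩ := h
    rw [Function.iterate_succ, pow_succ]
    exact ⟨_, _, _, Fintype.ofFinite _, _, _, hR.comp hP hS⟩

end Branches

section Densities

open Set Filter Topology
open scoped ENNReal

/-- `log f` is `a`-Lipschitz on `W`, in multiplicative form. -/
def LogLipschitzOn (a : ℝ) (W : Set ℝ) (f : ℝ → ℝ≥0∞) : Prop :=
  ∀ x ∈ W, ∀ y ∈ W, f x ≤ ENNReal.ofReal (Real.exp (a * |x - y|)) * f y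

lemma LogLipschitzOn.mono {a b : ℝ} {V W : Set ℝ} {f : ℝ → ℝ≥0∞} (h : LogLipschitzOn a W f)
    (hVW : V ⊆ W) (hab : a ≤ b) : LogLipschitzOn b V f := fun x hx y hy =>
  (h x (hVW hx) y (hVW hy)).trans (by gcongr)

lemma logLipschitzOn_one {a : ℝ} (ha : 0 ≤ a) (W : Set ℝ) : LogLipschitzOn a W (fun _ => 1) := by
  intro x _ y _
  rw [mul_one, ENNReal.one_le_ofReal, Real.one_le_exp_iff]
  positivity

lemma LogLipschitzOn.le_of_subset_Ioo {a : ℝ} {W : Set ℝ} {f : ℝ → ℝ≥0∞}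
    (h : LogLipschitzOn a W f) (ha : 0 ≤ a) (hW : W ⊆ Ioo 0 1) {x y : ℝ} (hx : x ∈ W)
    (hy : y ∈ W) : f x ≤ ENNReal.ofReal (Real.exp a) * f y := by
  refine (h x hx y hy).trans ?_
  have h1 := hW hx
  have h2 := hW hy
  have h3 : |x - y| ≤ 1 := by rw [abs_le]; constructor <;> linarith [h1.1, h1.2, h2.1, h2.2]
  gcongr
  nlinarith

/-- The contribution of the branch of `S` on `W` to the image under the transfer operator of the
density `f`. -/
noncomputable def pushDensity (S S' : ℝ → ℝ) (W : Set ℝ) (f : ℝ → ℝ≥0∞) (y : ℝ) : ℝ≥0∞ :=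
  f (Function.invFunOn S W y) * (ENNReal.ofReal |S' (Function.invFunOn S W y)|)⁻¹

lemma volume_mul_iSup_le {a : ℝ} {W : Set ℝ} {f : ℝ → ℝ≥0∞} (hWm : MeasurableSet W)
    (h : LogLipschitzOn a W f) (ha : 0 ≤ a) (hW : W ⊆ Ioo 0 1) :
    volume W * ⨆ x ∈ W, f x ≤ ENNReal.ofReal (Real.exp a) * ∫⁻ x in W, f x := by
  rw [mul_comm, ← setLIntegral_const, ← lintegral_const_mul' _ _ ENNReal.ofReal_ne_top]
  exact setLIntegral_mono' hWm fun y hy => iSup₂_le fun x hx => h.le_of_subset_Ioo ha hW hx hy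

lemma volume_mul_setLIntegral_le {a : ℝ} {A B W : Set ℝ} {f : ℝ → ℝ≥0∞} (hA : MeasurableSet A)
    (hB : MeasurableSet B) (h : LogLipschitzOn a W f) (ha : 0 ≤ a) (hW : W ⊆ Ioo 0 1)
    (hAW : A ⊆ W) (hBW : B ⊆ W) :
    volume B * ∫⁻ x in A, f x ≤ ENNReal.ofReal (Real.exp a) * volume A * ∫⁻ x in B, f x := by
  have hAfin : volume A ≠ ⊤ :=
    ((measure_mono (hAW.trans hW)).trans_lt (by simp)).ne
  rw [mul_comm (volume B), ← setLIntegral_const,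
    ← lintegral_const_mul' _ _ (ENNReal.mul_ne_top ENNReal.ofReal_ne_top hAfin)]
  refine setLIntegral_mono' hB fun y hy => ?_
  calc ∫⁻ x in A, f x ≤ ∫⁻ x in A, ENNReal.ofReal (Real.exp a) * f y :=
        setLIntegral_mono' hA fun x hx => h.le_of_subset_Ioo ha hW (hAW hx) (hBW hy)
    _ = _ := by rw [setLIntegral_const]; ring

namespace ExpandingBranches

variable {ι : Type} {S S' : ℝ → ℝ} {P : ι → Set ℝ} {lam Lam d : ℝ}

lemma pushDensity_apply (h : ExpandingBranches S S' P lam Lam d) {i : ι} {W : Set ℝ}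
    (hWP : W ⊆ P i) (f : ℝ → ℝ≥0∞) {x : ℝ} (hx : x ∈ W) :
    pushDensity S S' W f (S x) = f x * (ENNReal.ofReal |S' x|)⁻¹ := by
  have : Function.invFunOn S W (S x) = x := ((h.injOn i).mono hWP).leftInvOn_invFunOn hx
  simp [pushDensity, this]

lemma setLIntegral_pushDensity (h : ExpandingBranches S S' P lam Lam d) (hS : Measurable S) {i : ι}
    {W : Set ℝ} (hW : MeasurableSet W) (hWP : W ⊆ P i) (f : ℝ → ℝ≥0∞) {B : Set ℝ}
    (hB : MeasurableSet B) :
    ∫⁻ y in S '' W ∩ B, pushDensity S S' W f y = ∫⁻ x in W ∩ S ⁻¹' B, f x := by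
  have hs : MeasurableSet (W ∩ S ⁻¹' B) := hW.inter (hS hB)
  rw [← image_inter_preimage, lintegral_image_eq_lintegral_abs_deriv_mul hs
    (fun x hx => (h.hasDeriv i x (hWP hx.1)).mono (inter_subset_left.trans hWP))
    ((h.injOn i).mono (inter_subset_left.trans hWP))]
  refine setLIntegral_congr_fun hs fun x hx => ?_
  have h1 : 0 < |S' x| := (zero_lt_one.trans h.one_lt).trans_le (h.le_deriv i x (hWP hx.1))
  rw [h.pushDensity_apply hWP f hx.1, mul_comm (f x), ← mul_assoc,
    ENNReal.mul_inv_cancel (by simpa using h1) ENNReal.ofReal_ne_top, one_mul]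

lemma pushDensity_le (h : ExpandingBranches S S' P lam Lam d) {i : ι} {W : Set ℝ} (hWP : W ⊆ P i)
    (f : ℝ → ℝ≥0∞) {s : ℝ≥0∞} (hs : ∀ x ∈ W, f x ≤ s) :
    ⨆ y ∈ S '' W, pushDensity S S' W f y ≤ (ENNReal.ofReal lam)⁻¹ * s := by
  refine iSup₂_le ?_
  rintro _ ⟨x, hx, rfl⟩
  rw [h.pushDensity_apply hWP f hx, mul_comm]
  gcongr
  · exact h.le_deriv i x (hWP hx)
  · exact hs x hx

lemma logLipschitzOn_pushDensity (h : ExpandingBranches S S' P lam Lam d) {i : ι} {W : Set ℝ}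
    (hWP : W ⊆ P i) {f : ℝ → ℝ≥0∞} {a : ℝ} (ha : 0 ≤ a) (hf : LogLipschitzOn a W f) :
    LogLipschitzOn ((a + d) / lam) (S '' W) (pushDensity S S' W f) := by
  rintro _ ⟨x, hx, rfl⟩ _ ⟨y, hy, rfl⟩
  rw [h.pushDensity_apply hWP f hx, h.pushDensity_apply hWP f hy]
  have hl : 0 < lam := zero_lt_one.trans h.one_lt
  have hx' : 0 < |S' x| := hl.trans_le (h.le_deriv i x (hWP hx))
  have hy' : 0 < |S' y| := hl.trans_le (h.le_deriv i y (hWP hy))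
  have h1 : (ENNReal.ofReal |S' x|)⁻¹ ≤
      ENNReal.ofReal (Real.exp (d * |x - y|)) * (ENNReal.ofReal |S' y|)⁻¹ := by
    rw [← ENNReal.ofReal_inv_of_pos hx', ← ENNReal.ofReal_inv_of_pos hy',
      ← ENNReal.ofReal_mul (Real.exp_pos _).le]
    apply ENNReal.ofReal_le_ofReal
    have := h.distortion i y (hWP hy) x (hWP hx)
    rw [abs_sub_comm y x] at this
    rw [← div_eq_mul_inv, inv_eq_one_div, div_le_div_iff₀ hx' hy', one_mul]
    exact this
  have h2 : Real.exp (a * |x - y|) * Real.exp (d * |x - y|) ≤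
      Real.exp ((a + d) / lam * |S x - S y|) := by
    rw [← Real.exp_add, Real.exp_le_exp, ← add_mul, div_mul_eq_mul_div, le_div_iff₀ hl, mul_assoc,
      mul_comm |x - y|]
    exact mul_le_mul_of_nonneg_left (h.abs_slope (hWP hx) (hWP hy)).1
      (add_nonneg ha h.distortion_nonneg)
  calc f x * (ENNReal.ofReal |S' x|)⁻¹
      ≤ (ENNReal.ofReal (Real.exp (a * |x - y|)) * f y) *
        (ENNReal.ofReal (Real.exp (d * |x - y|)) * (ENNReal.ofReal |S' y|)⁻¹) :=
        mul_le_mul' (hf x hx y hy) h1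
    _ = ENNReal.ofReal (Real.exp (a * |x - y|) * Real.exp (d * |x - y|)) *
        (f y * (ENNReal.ofReal |S' y|)⁻¹) := by
        rw [ENNReal.ofReal_mul (Real.exp_pos _).le]; ring
    _ ≤ _ := by gcongr

lemma setLIntegral_eq_sum [Fintype ι] (h : ExpandingBranches S S' P lam Lam d) {W : Set ℝ}
    (hW : MeasurableSet W) (hW1 : W ⊆ Ioo 0 1) {E : Set ℝ} (hE : MeasurableSet E) (f : ℝ → ℝ≥0∞) :
    ∫⁻ x in W ∩ E, f x = ∑ i, ∫⁻ x in (W ∩ P i) ∩ E, f x := by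
  have h1 : (W ∩ E : Set ℝ) =ᵐ[volume] (⋃ i, (W ∩ P i) ∩ E : Set ℝ) := by
    refine (ae_eq_set (μ := volume)).2 ⟨measure_mono_null ?_ h.cover, ?_⟩
    · rintro x ⟨hx, hx'⟩
      refine ⟨hW1 hx.1, fun h2 => hx' ?_⟩
      obtain ⟨i, hi⟩ := mem_iUnion.1 h2
      exact mem_iUnion.2 ⟨i, ⟨hx.1, hi⟩, hx.2⟩
    · convert measure_empty (μ := (volume : Measure ℝ))
      rw [sdiff_eq_empty]
      exact iUnion_subset fun i x hx => ⟨hx.1.1, hx.2⟩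
  rw [setLIntegral_congr h1, lintegral_iUnion, tsum_fintype]
  · exact fun i => (hW.inter (h.measurableSet i)).inter hE
  · intro i j hij
    exact (h.disjoint hij).mono (fun x hx => hx.1.2) (fun x hx => hx.1.2)

open scoped Classical in
lemma card_boundary_le [Fintype ι] (h : ExpandingBranches S S' P lam Lam d) {W : Set ℝ}
    (hW : W.OrdConnected) :
    (Finset.univ.filter fun i => (W ∩ P i).Nonempty ∧ ¬ P i ⊆ W).card ≤ 2 := by
  have key : (Finset.univ.filter fun i => (W ∩ P i).Nonempty ∧ ¬ P i ⊆ W) ⊆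
      (Finset.univ.filter fun i => (W ∩ P i).Nonempty ∧ ∃ x ∈ P i, ∀ w ∈ W, x < w) ∪
      (Finset.univ.filter fun i => (W ∩ P i).Nonempty ∧ ∃ x ∈ P i, ∀ w ∈ W, w < x) := by
    intro i hi
    simp only [Finset.mem_filter, Finset.mem_univ, true_and, Finset.mem_union] at hi ⊢
    obtain ⟨hne, hsub⟩ := hi
    obtain ⟨x, hx, hxW⟩ := not_subset.1 hsub
    obtain ⟨y, hyW, hy⟩ := hne
    rcases lt_trichotomy x y with hxy | hxy | hxy
    · refine Or.inl ⟨⟨y, hyW, hy⟩, x, hx, fun w hw => ?_⟩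
      by_contra! hc
      exact hxW (hW.out hw hyW ⟨hc, hxy.le⟩)
    · exact absurd (hxy ▸ hyW) hxW
    · refine Or.inr ⟨⟨y, hyW, hy⟩, x, hx, fun w hw => ?_⟩
      by_contra! hc
      exact hxW (hW.out hyW hw ⟨hxy.le, hc⟩)
  refine (Finset.card_le_card key).trans ((Finset.card_union_le _ _).trans ?_)
  refine Nat.add_le_add (Finset.card_le_one.2 ?_) (Finset.card_le_one.2 ?_)
  · intro i hi j hj
    simp only [Finset.mem_filter, Finset.mem_univ, true_and] at hi hj
    obtain ⟨⟨y, hyW, hy⟩, x, hx, hxW⟩ := hi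
    obtain ⟨⟨y', hyW', hy'⟩, x', hx', hxW'⟩ := hj
    by_contra hne
    rcases le_total x x' with hxx | hxx
    · exact Set.disjoint_left.1 (h.disjoint hne)
        ((h.ordConnected i).out hx hy ⟨hxx, (hxW' y hyW).le⟩) hx'
    · exact Set.disjoint_left.1 (h.disjoint hne) hx
        ((h.ordConnected j).out hx' hy' ⟨hxx, (hxW y' hyW').le⟩)
  · intro i hi j hj
    simp only [Finset.mem_filter, Finset.mem_univ, true_and] at hi hj
    obtain ⟨⟨y, hyW, hy⟩, x, hx, hxW⟩ := hi
    obtain ⟨⟨y', hyW', hy'⟩, x', hx', hxW'⟩ := hj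
    by_contra hne
    rcases le_total x x' with hxx | hxx
    · exact Set.disjoint_left.1 (h.disjoint hne) hx
        ((h.ordConnected j).out hy' hx' ⟨(hxW y' hyW').le, hxx⟩)
    · exact Set.disjoint_left.1 (h.disjoint hne)
        ((h.ordConnected i).out hy hx ⟨(hxW' y hyW).le, hxx⟩) hx'

open scoped Classical in
/-- The number of branches meeting an interval `W`, in terms of the length of `W`. -/
lemma exists_card_le [Fintype ι] (h : ExpandingBranches S S' P lam Lam d) :
    ∃ K : ℝ≥0∞, K ≠ ⊤ ∧ ∀ W : Set ℝ, W.OrdConnected →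
      ((Finset.univ.filter fun i => (W ∩ P i).Nonempty).card : ℝ≥0∞) ≤ 2 + K * volume W := by
  set δ : ℝ≥0∞ := Finset.univ.inf fun i => volume (P i) with hδ
  have hδ0 : 0 < δ := (Finset.lt_inf_iff (by simp)).2 fun i _ => h.volume_pos i
  refine ⟨Fintype.card ι * δ⁻¹, ENNReal.mul_ne_top (by simp) (by simp [hδ0.ne']), fun W hW => ?_⟩
  by_cases hlt : volume W < δ
  · refine le_trans ?_ le_self_add
    have : (Finset.univ.filter fun i => (W ∩ P i).Nonempty) ⊆
        (Finset.univ.filter fun i => (W ∩ P i).Nonempty ∧ ¬ P i ⊆ W) := by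
      intro i hi
      simp only [Finset.mem_filter, Finset.mem_univ, true_and] at hi ⊢
      refine ⟨hi, fun hsub => ?_⟩
      exact absurd ((Finset.inf_le (Finset.mem_univ i)).trans (measure_mono hsub)) (not_le.2 hlt)
    exact_mod_cast (Finset.card_le_card this).trans (h.card_boundary_le hW)
  · push Not at hlt
    refine le_trans ?_ le_add_self
    have h1 : 1 ≤ δ⁻¹ * volume W ∨ δ = ⊤ := by
      by_cases ht : δ = ⊤
      · exact Or.inr ht
      · left
        rw [← ENNReal.inv_mul_cancel hδ0.ne' ht]
        gcongr
    rcases h1 with h1 | h1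
    · calc ((Finset.univ.filter fun i => (W ∩ P i).Nonempty).card : ℝ≥0∞)
          ≤ Fintype.card ι := by exact_mod_cast Finset.card_le_univ _
        _ ≤ Fintype.card ι * (δ⁻¹ * volume W) := le_mul_of_one_le_right' h1
        _ = _ := by ring
    · have : IsEmpty ι := by
        constructor
        intro i
        have h2 : δ ≤ volume (P i) := Finset.inf_le (Finset.mem_univ i)
        have h3 : volume (P i) ≤ volume (Ioo (0:ℝ) 1) := measure_mono (h.subset i)
        rw [h1] at h2
        simp at h3
        exact absurd (h2.trans h3) (by simp)
      simp

/-- An inequality between integrals of log-Lipschitz densities propagates along iterates, with an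
error term controlled by a Lasota-Yorke type bound. -/
lemma exists_iterate_bound [Fintype ι] (h : ExpandingBranches S S' P lam Lam d) (hS : Measurable S)
    (hlam : 2 < lam) :
    ∃ C : ℝ≥0∞, C ≠ ⊤ ∧ ∀ E E' : Set ℝ, MeasurableSet E → MeasurableSet E' → ∀ α γ η : ℝ≥0∞,
      (∀ (W : Set ℝ) (f : ℝ → ℝ≥0∞), W.OrdConnected → W ⊆ Ioo 0 1 → LogLipschitzOn d W f →
        α * ∫⁻ x in W ∩ E, f x ≤ γ * (∫⁻ x in W ∩ E', f x) + η * ⨆ x ∈ W, f x) →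
      ∀ (n : ℕ) (W : Set ℝ) (f : ℝ → ℝ≥0∞), W.OrdConnected → W ⊆ Ioo 0 1 → LogLipschitzOn d W f →
        α * ∫⁻ x in W ∩ S^[n] ⁻¹' E, f x ≤ γ * (∫⁻ x in W ∩ S^[n] ⁻¹' E', f x) +
          η * (ENNReal.ofReal (2 / lam) ^ n * (⨆ x ∈ W, f x) + C * ∫⁻ x in W, f x) := by
  classical
  obtain ⟨K₀, hK₀, hcard⟩ := h.exists_card_le
  have hl : 0 < lam := by linarith
  set q : ℝ≥0∞ := ENNReal.ofReal (2 / lam) with hq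
  have hq2 : 2 * (ENNReal.ofReal lam)⁻¹ = q := by
    rw [hq, ENNReal.ofReal_div_of_pos hl, div_eq_mul_inv]; simp
  have hq1 : q < 1 := by
    rw [hq, ENNReal.ofReal_lt_one, div_lt_one hl]; exact hlam
  set K : ℝ≥0∞ := (ENNReal.ofReal lam)⁻¹ * K₀ * ENNReal.ofReal (Real.exp d) with hK
  have hKt : K ≠ ⊤ := ENNReal.mul_ne_top
    (ENNReal.mul_ne_top (by simp [hl]) hK₀) ENNReal.ofReal_ne_top
  refine ⟨K * (1 - q)⁻¹, ENNReal.mul_ne_top hKt (by simp [tsub_eq_zero_iff_le, hq1]), ?_⟩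
  intro E E' hE hE' α γ η hbase n W f hW hW1 hf
  have hC : K * ∑ i ∈ Finset.range n, q ^ i ≤ K * (1 - q)⁻¹ := by
    rw [← ENNReal.tsum_geometric]
    gcongr
    exact ENNReal.sum_le_tsum _
  suffices hn : α * ∫⁻ x in W ∩ S^[n] ⁻¹' E, f x ≤ γ * (∫⁻ x in W ∩ S^[n] ⁻¹' E', f x) +
      η * (q ^ n * (⨆ x ∈ W, f x) + K * (∑ i ∈ Finset.range n, q ^ i) * ∫⁻ x in W, f x) from
    hn.trans (by gcongr)
  clear hC
  induction n generalizing W f with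
  | zero => simpa using hbase W f hW hW1 hf
  | succ n ih =>
    have hsum : ∑ i, ⨆ y ∈ S '' (W ∩ P i), pushDensity S S' (W ∩ P i) f y ≤
        q * (⨆ x ∈ W, f x) + K * ∫⁻ x in W, f x := by
      calc ∑ i, ⨆ y ∈ S '' (W ∩ P i), pushDensity S S' (W ∩ P i) f y
          ≤ ∑ i, if (W ∩ P i).Nonempty then (ENNReal.ofReal lam)⁻¹ * (⨆ x ∈ W, f x) else 0 := by
            refine Finset.sum_le_sum fun i _ => ?_
            split_ifs with hne
            · exact h.pushDensity_le inter_subset_right f fun x hx => le_iSup₂_of_le x hx.1 le_rfl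
            · rw [not_nonempty_iff_eq_empty.1 hne]; simp
        _ = (Finset.univ.filter fun i => (W ∩ P i).Nonempty).card *
            ((ENNReal.ofReal lam)⁻¹ * (⨆ x ∈ W, f x)) := by
            rw [← Finset.sum_filter, Finset.sum_const, nsmul_eq_mul]
        _ ≤ (2 + K₀ * volume W) * ((ENNReal.ofReal lam)⁻¹ * (⨆ x ∈ W, f x)) := by
            gcongr
            exact hcard W hW
        _ = q * (⨆ x ∈ W, f x) + (ENNReal.ofReal lam)⁻¹ * K₀ * (volume W * ⨆ x ∈ W, f x) := by
            rw [← hq2]; ring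
        _ ≤ q * (⨆ x ∈ W, f x) + (ENNReal.ofReal lam)⁻¹ * K₀ *
            (ENNReal.ofReal (Real.exp d) * ∫⁻ x in W, f x) := by
            refine add_le_add_right (mul_le_mul_right ?_ _) _
            exact volume_mul_iSup_le hW.measurableSet hf h.distortion_nonneg hW1
        _ = _ := by rw [hK]; ring
    have hWi : ∀ i, (W ∩ P i).OrdConnected := fun i => hW.inter (h.ordConnected i)
    have hstep : ∀ i, α * ∫⁻ x in (W ∩ P i) ∩ S^[n + 1] ⁻¹' E, f x ≤
        γ * (∫⁻ x in (W ∩ P i) ∩ S^[n + 1] ⁻¹' E', f x) +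
          η * (q ^ n * (⨆ y ∈ S '' (W ∩ P i), pushDensity S S' (W ∩ P i) f y) +
            K * (∑ i ∈ Finset.range n, q ^ i) * ∫⁻ x in W ∩ P i, f x) := by
      intro i
      have h1 := ih (S '' (W ∩ P i)) (pushDensity S S' (W ∩ P i) f)
        (h.ordConnected_image (hWi i) inter_subset_right)
        (by rintro _ ⟨x, hx, rfl⟩; exact h.mapsTo i hx.2)
        ((h.logLipschitzOn_pushDensity inter_subset_right h.distortion_nonneg
          (hf.mono inter_subset_left le_rfl)).mono le_rfl (by
            rw [div_le_iff₀ hl]; nlinarith [h.distortion_nonneg]))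
      have h2 := h.setLIntegral_pushDensity hS (hWi i).measurableSet inter_subset_right f
        MeasurableSet.univ
      rw [inter_univ, preimage_univ, inter_univ] at h2
      rw [h.setLIntegral_pushDensity hS (hWi i).measurableSet inter_subset_right f
          ((hS.iterate n) hE), h.setLIntegral_pushDensity hS (hWi i).measurableSet
          inter_subset_right f ((hS.iterate n) hE'), h2] at h1
      rw [Function.iterate_succ]
      exact h1
    have hWsum : ∫⁻ x in W, f x = ∑ i, ∫⁻ x in W ∩ P i, f x := by
      simpa using h.setLIntegral_eq_sum hW.measurableSet hW1 MeasurableSet.univ f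
    rw [h.setLIntegral_eq_sum hW.measurableSet hW1 ((hS.iterate _) hE),
      h.setLIntegral_eq_sum hW.measurableSet hW1 ((hS.iterate _) hE'), Finset.mul_sum]
    refine (Finset.sum_le_sum fun i _ => hstep i).trans ?_
    rw [Finset.sum_add_distrib, ← Finset.mul_sum, ← Finset.mul_sum, Finset.sum_add_distrib,
      ← Finset.mul_sum, ← Finset.mul_sum, ← hWsum]
    refine add_le_add le_rfl (mul_le_mul' le_rfl ?_)
    calc q ^ n * (∑ i, ⨆ y ∈ S '' (W ∩ P i), pushDensity S S' (W ∩ P i) f y) +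
          K * (∑ i ∈ Finset.range n, q ^ i) * ∫⁻ x in W, f x
        ≤ q ^ n * (q * (⨆ x ∈ W, f x) + K * ∫⁻ x in W, f x) +
          K * (∑ i ∈ Finset.range n, q ^ i) * ∫⁻ x in W, f x := by gcongr
      _ = q ^ (n + 1) * (⨆ x ∈ W, f x) +
          K * (∑ i ∈ Finset.range (n + 1), q ^ i) * ∫⁻ x in W, f x := by
        rw [Finset.sum_range_succ]; ring

end ExpandingBranches

end Densities

section Returns

open Set Filter Topology
open scoped ENNReal

/-- Some interval of `(0, 1)` is, for each member of a finite family of intervals, either contained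
in it or disjoint from it. -/
lemma exists_Ico_subset_or_disjoint {κ : Type} [Finite κ] {J : κ → Set ℝ}
    (hJ : ∀ i, (J i).OrdConnected) :
    ∃ u v : ℝ, 0 < u ∧ u < v ∧ v < 1 ∧ ∀ i, Ico u v ⊆ J i ∨ Disjoint (Ico u v) (J i) := by
  have h0 : volume (⋃ i, frontier (J i)) = 0 :=
    measure_iUnion_null fun i => (hJ i).convex.addHaar_frontier volume
  obtain ⟨x, hx, hxf⟩ : ∃ x ∈ Ioo (0 : ℝ) 1, x ∉ ⋃ i, frontier (J i) := by
    by_contra! hcon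
    have := measure_mono_null (μ := volume) (show Ioo (0 : ℝ) 1 ⊆ _ from hcon) h0
    simp at this
  have h1 : ∀ᶠ s in (𝓝 x).smallSets, ∀ i, s ⊆ J i ∨ Disjoint s (J i) := by
    refine eventually_all.2 fun i => ?_
    have hxi : x ∈ interior (J i) ∪ interior (J i)ᶜ := by
      rw [← compl_frontier_eq_union_interior]
      exact fun hx' => hxf (mem_iUnion.2 ⟨i, hx'⟩)
    rcases hxi with hxi | hxi
    · filter_upwards [eventually_smallSets_subset.2 (mem_interior_iff_mem_nhds.1 hxi)] with s hs
      exact Or.inl hs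
    · filter_upwards [eventually_smallSets_subset.2 (mem_interior_iff_mem_nhds.1 hxi)] with s hs
      exact Or.inr (disjoint_left.2 fun y hy => hs hy)
  have h2 := h1.and (eventually_smallSets_subset.2 (Ioo_mem_nhds hx.1 hx.2))
  obtain ⟨t, ht, h3⟩ := eventually_smallSets.1 h2
  obtain ⟨ε, hε, hεt⟩ := Metric.mem_nhds_iff.1 ht
  have hsub : Ico x (x + ε / 2) ⊆ t := fun y hy => hεt (by
    rw [Metric.mem_ball, Real.dist_eq, abs_lt]
    constructor <;> linarith [hy.1, hy.2])
  have hsub' : Icc x (x + ε / 2) ⊆ t := fun y hy => hεt (by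
    rw [Metric.mem_ball, Real.dist_eq, abs_lt]
    constructor <;> linarith [hy.1, hy.2])
  exact ⟨x, x + ε / 2, hx.1, by linarith,
    ((h3 _ hsub').2 (right_mem_Icc.2 (by linarith))).2, (h3 _ hsub).1⟩

lemma HasExpandingBranches.exists_volume_inter_preimage_le {S : ℝ → ℝ} {lam Lam d : ℝ}
    (h : HasExpandingBranches S lam Lam d) (hS : Measurable S) (hlam : 2 < lam) :
    ∃ C : ℝ≥0∞, C ≠ ⊤ ∧ ∀ (B : Set ℝ), MeasurableSet B → ∀ (n : ℕ) (W : Set ℝ),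
      W.OrdConnected → W ⊆ Ioo 0 1 →
      volume (W ∩ S^[n] ⁻¹' B) ≤
        volume B * (ENNReal.ofReal (2 / lam) ^ n + C * volume W) := by
  obtain ⟨ι, _, P, S', h⟩ := h
  obtain ⟨C, hC, hbd⟩ := h.exists_iterate_bound hS hlam
  refine ⟨C, hC, fun B hB n W hW hW1 => ?_⟩
  have := hbd B ∅ hB MeasurableSet.empty 1 0 (volume B) (fun W f _ _ _ => ?_) n W (fun _ => 1) hW hW1
    (logLipschitzOn_one h.distortion_nonneg W)
  · simp only [preimage_empty, zero_mul, one_mul, zero_add, setLIntegral_const] at this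
    refine this.trans ?_
    gcongr
    calc ENNReal.ofReal (2 / lam) ^ n * ⨆ x ∈ W, (1 : ℝ≥0∞)
        ≤ ENNReal.ofReal (2 / lam) ^ n * 1 := by gcongr; exact iSup₂_le fun _ _ => le_rfl
      _ = _ := mul_one _
  · rw [one_mul, zero_mul, zero_add]
    calc ∫⁻ x in W ∩ B, f x ≤ ∫⁻ _ in W ∩ B, ⨆ x ∈ W, f x := by
          refine setLIntegral_mono' ?_ fun x hx => le_iSup₂_of_le x hx.1 le_rfl
          exact (OrdConnected.measurableSet ‹_›).inter hB
      _ = (⨆ x ∈ W, f x) * volume (W ∩ B) := setLIntegral_const _ _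
      _ ≤ volume B * ⨆ x ∈ W, f x := by
          rw [mul_comm]; gcongr; exact inter_subset_right

namespace ExpandingBranches

variable {ι : Type} {S S' : ℝ → ℝ} {P : ι → Set ℝ} {lam Lam d : ℝ}

lemma mul_setLIntegral_preimage_le [Fintype ι] (h : ExpandingBranches S S' P lam Lam d)
    (hS : Measurable S) {a : ℝ} (ha : 0 ≤ a) {A B : Set ℝ} (hA : MeasurableSet A)
    (hB : MeasurableSet B) (hBA : B ⊆ A)
    (hAP : ∀ i, A ⊆ S '' P i ∨ Disjoint A (S '' P i)) {W : Set ℝ} {f : ℝ → ℝ≥0∞}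
    (hW : W.OrdConnected) (hW1 : W ⊆ Ioo 0 1) (hf : LogLipschitzOn a W f) :
    volume B * ∫⁻ x in W ∩ S ⁻¹' A, f x ≤
      ENNReal.ofReal (Real.exp ((a + d) / lam)) * volume A * (∫⁻ x in W ∩ S ⁻¹' B, f x) +
        2 * (ENNReal.ofReal lam)⁻¹ * volume A * volume B * ⨆ x ∈ W, f x := by
  classical
  have hl : 0 < lam := zero_lt_one.trans h.one_lt
  have hexp : 0 ≤ (a + d) / lam := div_nonneg (add_nonneg ha h.distortion_nonneg) hl.le
  have hWi : ∀ i, (W ∩ P i).OrdConnected := fun i => hW.inter (h.ordConnected i)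
  set X := (ENNReal.ofReal lam)⁻¹ * volume A * volume B * ⨆ x ∈ W, f x with hX
  have key : ∀ i, volume B * ∫⁻ x in (W ∩ P i) ∩ S ⁻¹' A, f x ≤
      ENNReal.ofReal (Real.exp ((a + d) / lam)) * volume A * (∫⁻ x in (W ∩ P i) ∩ S ⁻¹' B, f x) +
        if (W ∩ P i).Nonempty ∧ ¬ P i ⊆ W then X else 0 := by
    intro i
    rw [← h.setLIntegral_pushDensity hS (hWi i).measurableSet inter_subset_right f hA,
      ← h.setLIntegral_pushDensity hS (hWi i).measurableSet inter_subset_right f hB]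
    split_ifs with hi
    · refine le_trans ?_ le_add_self
      calc volume B * ∫⁻ y in S '' (W ∩ P i) ∩ A, pushDensity S S' (W ∩ P i) f y
          ≤ volume B * ∫⁻ _ in S '' (W ∩ P i) ∩ A, (ENNReal.ofReal lam)⁻¹ * ⨆ x ∈ W, f x := by
            gcongr volume B * ?_
            refine setLIntegral_mono' ((h.ordConnected_image (hWi i)
              inter_subset_right).measurableSet.inter hA) fun y hy => ?_
            exact (le_iSup₂_of_le y hy.1 le_rfl).trans
              (h.pushDensity_le inter_subset_right f fun x hx => le_iSup₂_of_le x hx.1 le_rfl)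
        _ = volume B * ((ENNReal.ofReal lam)⁻¹ * (⨆ x ∈ W, f x) *
              volume (S '' (W ∩ P i) ∩ A)) := by rw [setLIntegral_const]
        _ ≤ volume B * ((ENNReal.ofReal lam)⁻¹ * (⨆ x ∈ W, f x) * volume A) := by
            gcongr; exact inter_subset_right
        _ = X := by rw [hX]; ring
    · rw [add_zero]
      by_cases hne : (W ∩ P i).Nonempty
      · have hsub : P i ⊆ W := by by_contra hcon; exact hi ⟨hne, hcon⟩
        rw [inter_eq_self_of_subset_right hsub]
        rcases hAP i with hA1 | hA1
        · rw [inter_eq_self_of_subset_right hA1, inter_eq_self_of_subset_right (hBA.trans hA1)]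
          refine volume_mul_setLIntegral_le hA hB (h.logLipschitzOn_pushDensity subset_rfl ha
            (hf.mono hsub le_rfl)) hexp ?_ hA1 (hBA.trans hA1)
          rintro _ ⟨x, hx, rfl⟩
          exact h.mapsTo i hx
        · rw [inter_comm, hA1.inter_eq]
          simp
      · rw [not_nonempty_iff_eq_empty.1 hne]; simp
  rw [h.setLIntegral_eq_sum hW.measurableSet hW1 (hS hA),
    h.setLIntegral_eq_sum hW.measurableSet hW1 (hS hB), Finset.mul_sum, Finset.mul_sum]
  refine (Finset.sum_le_sum fun i _ => key i).trans ?_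
  rw [Finset.sum_add_distrib]
  refine add_le_add le_rfl ?_
  rw [← Finset.sum_filter, Finset.sum_const, nsmul_eq_mul]
  calc _ ≤ ((2 : ℕ) : ℝ≥0∞) * X := by
        gcongr
        exact h.card_boundary_le hW
    _ = _ := by rw [hX]; push_cast; ring

end ExpandingBranches

lemma HasExpandingBranches.exists_mul_volume_preimage_le {S : ℝ → ℝ} {lam Lam d : ℝ}
    (h : HasExpandingBranches S lam Lam d) (hS : Measurable S) (hlam : 2 < lam) :
    ∃ C : ℝ≥0∞, C ≠ ⊤ ∧ ∀ j : ℕ, ∃ (γ : ℝ≥0∞) (u v : ℝ), γ ≠ ⊤ ∧ 0 < u ∧ u < v ∧ v < 1 ∧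
      ∀ B : Set ℝ, MeasurableSet B → B ⊆ Ico u v → ∀ (n : ℕ) (W : Set ℝ),
        W.OrdConnected → W ⊆ Ioo 0 1 →
        volume B * volume (W ∩ S^[n + (j + 1)] ⁻¹' Ico u v) ≤
          γ * volume (Ico u v) * volume (W ∩ S^[n + (j + 1)] ⁻¹' B) +
          2 * (ENNReal.ofReal (lam ^ (j + 1)))⁻¹ * volume (Ico u v) * volume B *
            (ENNReal.ofReal (2 / lam) ^ n + C * volume W) := by
  obtain ⟨ι, _, P, S', h'⟩ := id h
  obtain ⟨C, hC, hbd⟩ := h'.exists_iterate_bound hS hlam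
  refine ⟨C, hC, fun j => ?_⟩
  obtain ⟨Lam', d', κ, _, Q, R', hR⟩ := h.iterate hS j
  obtain ⟨u, v, hu, huv, hv, hQ⟩ := exists_Ico_subset_or_disjoint
    (fun i => hR.ordConnected_image (hR.ordConnected i) subset_rfl)
  refine ⟨ENNReal.ofReal (Real.exp ((d + d') / lam ^ (j + 1))), u, v, ENNReal.ofReal_ne_top, hu, huv, hv,
    fun B hB hBA n W hW hW1 => ?_⟩
  have hSj := hS.iterate (j + 1)
  have := hbd (S^[j + 1] ⁻¹' Ico u v) (S^[j + 1] ⁻¹' B) (hSj measurableSet_Ico) (hSj hB) (volume B)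
    _ _ (fun W f hW hW1 hf => hR.mul_setLIntegral_preimage_le hSj h'.distortion_nonneg
      measurableSet_Ico hB hBA hQ hW hW1 hf) n W (fun _ => 1) hW hW1
    (logLipschitzOn_one h'.distortion_nonneg W)
  simp only [← preimage_comp, ← Function.iterate_add, setLIntegral_const, one_mul] at this
  rw [add_comm n]
  refine this.trans ?_
  gcongr
  calc ENNReal.ofReal (2 / lam) ^ n * ⨆ x ∈ W, (1 : ℝ≥0∞)
      ≤ ENNReal.ofReal (2 / lam) ^ n * 1 := by gcongr; exact iSup₂_le fun _ _ => le_rfl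
    _ = _ := mul_one _

end Returns

section SecondMoment

open Set Filter Topology

/-- The Chung–Erdős inequality. -/
lemma sq_sum_measureReal_le {α : Type*} [MeasurableSpace α] {ν : Measure α} [IsFiniteMeasure ν]
    (s : Finset ℕ) {G : ℕ → Set α} (hG : ∀ n, MeasurableSet (G n)) :
    (∑ n ∈ s, ν.real (G n)) ^ 2 ≤
      ν.real (⋃ n ∈ s, G n) * ∑ n ∈ s, ∑ m ∈ s, ν.real (G n ∩ G m) := by
  set U := ⋃ n ∈ s, G n with hU
  have hUm : MeasurableSet U := Finset.measurableSet_biUnion s fun n _ => hG n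
  have hind : ∀ V : Set α, MeasurableSet V → Integrable (V.indicator (1 : α → ℝ)) ν :=
    fun V hV => (integrable_const (1 : ℝ)).indicator hV
  have hpoint : ∀ (t : ℝ) (x : α), (∑ n ∈ s, (G n).indicator (1 : α → ℝ) x - t * U.indicator 1 x) ^ 2
      = (∑ n ∈ s, ∑ m ∈ s, (G n ∩ G m).indicator (1 : α → ℝ) x) -
        2 * t * (∑ n ∈ s, (G n).indicator (1 : α → ℝ) x) + t * t * U.indicator 1 x := by
    intro t x
    have h1 : ∑ n ∈ s, ∑ m ∈ s, (G n ∩ G m).indicator (1 : α → ℝ) x =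
        (∑ n ∈ s, (G n).indicator (1 : α → ℝ) x) ^ 2 := by
      rw [sq, Finset.sum_mul_sum]
      simp [inter_indicator_one]
    have h2 : (∑ n ∈ s, (G n).indicator (1 : α → ℝ) x) * U.indicator 1 x =
        ∑ n ∈ s, (G n).indicator (1 : α → ℝ) x := by
      by_cases hx : x ∈ U
      · simp [hx]
      · have : ∀ n ∈ s, (G n).indicator (1 : α → ℝ) x = 0 := fun n hn =>
          indicator_of_notMem (fun hxn => hx (mem_biUnion hn hxn)) _
        simp [Finset.sum_eq_zero this]
    have h3 : U.indicator (1 : α → ℝ) x * U.indicator 1 x = U.indicator 1 x := by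
      by_cases hx : x ∈ U <;> simp [hx]
    rw [h1]
    linear_combination (-2 * t) * h2 + t ^ 2 * h3
  have hquad : ∀ t : ℝ, 0 ≤ ν.real U * (t * t) + (-2 * ∑ n ∈ s, ν.real (G n)) * t +
      ∑ n ∈ s, ∑ m ∈ s, ν.real (G n ∩ G m) := by
    intro t
    have h0 : 0 ≤ ∫ x, (∑ n ∈ s, (G n).indicator (1 : α → ℝ) x - t * U.indicator 1 x) ^ 2 ∂ν :=
      integral_nonneg fun x => sq_nonneg _
    have i1 : Integrable (fun x => ∑ n ∈ s, ∑ m ∈ s, (G n ∩ G m).indicator (1 : α → ℝ) x) ν :=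
      integrable_finsetSum _ fun n _ => integrable_finsetSum _ fun m _ => hind _ ((hG n).inter (hG m))
    have i2 : Integrable (fun x => ∑ n ∈ s, (G n).indicator (1 : α → ℝ) x) ν :=
      integrable_finsetSum _ fun n _ => hind _ (hG n)
    simp_rw [hpoint] at h0
    have i3 : Integrable (fun x => (∑ n ∈ s, ∑ m ∈ s, (G n ∩ G m).indicator (1 : α → ℝ) x) -
        2 * t * ∑ n ∈ s, (G n).indicator (1 : α → ℝ) x) ν := i1.sub (i2.const_mul _)
    rw [integral_add i3 ((hind U hUm).const_mul _),
      integral_sub i1 (i2.const_mul _), integral_const_mul, integral_const_mul,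
      integral_finsetSum _ (fun n _ => hind _ (hG n)),
      integral_finsetSum _ (fun n _ => integrable_finsetSum _ fun m _ =>
        hind _ ((hG n).inter (hG m)))] at h0
    simp_rw [integral_finsetSum s (fun m _ => hind _ ((hG _).inter (hG m)))] at h0
    simp_rw [integral_indicator_one (hG _), integral_indicator_one hUm,
      integral_indicator_one ((hG _).inter (hG _))] at h0
    linarith
  have := discrim_le_zero hquad
  rw [discrim] at this
  nlinarith

lemma sum_range_dist_le {b : ℕ → ℝ} (hb : ∀ n, 0 ≤ b n) {i t : ℕ} (hi : i < t) :
    ∑ j ∈ Finset.range t, b ((i - j) + (j - i)) ≤ 2 * ∑ n ∈ Finset.range t, b n := by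
  have hsplit : ∀ j, b ((i - j) + (j - i)) ≤ (if i ≤ j then b (j - i) else 0) +
      (if j ≤ i then b (i - j) else 0) := by
    intro j
    rcases le_total i j with hij | hij
    · rw [if_pos hij, Nat.sub_eq_zero_of_le hij, zero_add]
      have : 0 ≤ if j ≤ i then b 0 else 0 := by split_ifs <;> simp [hb]
      exact le_add_of_nonneg_right this
    · rw [if_pos hij, Nat.sub_eq_zero_of_le hij, add_zero]
      have : 0 ≤ if i ≤ j then b 0 else 0 := by split_ifs <;> simp [hb]
      exact le_add_of_nonneg_left this
  refine (Finset.sum_le_sum fun j _ => hsplit j).trans ?_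
  rw [Finset.sum_add_distrib, two_mul, ← Finset.sum_filter, ← Finset.sum_filter]
  refine add_le_add ?_ ?_
  · rw [← Finset.sum_image (f := b) (g := fun j => j - i)
      (fun x hx y hy hxy => by simp at hx hy hxy; omega)]
    refine Finset.sum_le_sum_of_subset_of_nonneg (fun n hn => ?_) fun n _ _ => hb n
    simp at hn ⊢
    omega
  · rw [← Finset.sum_image (f := b) (g := fun j => i - j)
      (fun x hx y hy hxy => by simp at hx hy hxy; omega)]
    refine Finset.sum_le_sum_of_subset_of_nonneg (fun n hn => ?_) fun n _ _ => hb n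
    simp at hn ⊢
    omega

/-- A quantitative form of Poincaré recurrence. -/
lemma MeasureTheory.MeasurePreserving.mul_sq_measureReal_le {α : Type*} [MeasurableSpace α]
    {ν : Measure α} [IsProbabilityMeasure ν] {S : α → α} (hS : MeasurePreserving S ν ν) {A : Set α}
    (hA : MeasurableSet A) (t : ℕ) :
    t * ν.real A ^ 2 ≤ 2 * ∑ n ∈ Finset.range t, ν.real (A ∩ S^[n] ⁻¹' A) := by
  rcases Nat.eq_zero_or_pos t with rfl | ht
  · simp
  set b : ℕ → ℝ := fun n => ν.real (A ∩ S^[n] ⁻¹' A) with hb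
  have hinter : ∀ i j, ν.real (S^[i] ⁻¹' A ∩ S^[j] ⁻¹' A) = b ((i - j) + (j - i)) := by
    intro i j
    wlog hij : i ≤ j generalizing i j
    · rw [inter_comm, this j i (le_of_not_ge hij), add_comm]
    obtain ⟨k, rfl⟩ := Nat.exists_eq_add_of_le hij
    have : S^[i] ⁻¹' A ∩ S^[i + k] ⁻¹' A = S^[i] ⁻¹' (A ∩ S^[k] ⁻¹' A) := by
      rw [add_comm i k, Function.iterate_add, preimage_inter, preimage_comp]
    rw [this, (hS.iterate i).measureReal_preimage
      (hA.inter ((hS.measurable.iterate k) hA)).nullMeasurableSet]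
    simp [hb]
  have h1 := sq_sum_measureReal_le (ν := ν) (Finset.range t)
    (G := fun i => S^[i] ⁻¹' A) (fun i => (hS.measurable.iterate i) hA)
  simp_rw [hinter, (hS.iterate _).measureReal_preimage hA.nullMeasurableSet] at h1
  rw [Finset.sum_const, Finset.card_range, nsmul_eq_mul] at h1
  have hb0 : ∀ n, 0 ≤ b n := fun n => measureReal_nonneg
  have h2 : ∑ i ∈ Finset.range t, ∑ j ∈ Finset.range t, b ((i - j) + (j - i)) ≤
      t * (2 * ∑ n ∈ Finset.range t, b n) := by
    refine (Finset.sum_le_sum fun i hi => sum_range_dist_le hb0 (Finset.mem_range.1 hi)).trans ?_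
    simp
  have h3 : (t * ν.real A) ^ 2 ≤ t * (2 * ∑ n ∈ Finset.range t, b n) := by
    refine (h1.trans (mul_le_of_le_one_left ?_ measureReal_le_one)).trans h2
    exact Finset.sum_nonneg fun i _ => Finset.sum_nonneg fun j _ => hb0 _
  have ht' : (0 : ℝ) < t := by exact_mod_cast ht
  nlinarith

end SecondMoment

section CloseReturns

open Set Filter Topology

lemma HasExpandingBranches.exists_measureReal_inter_preimage_le {S : ℝ → ℝ} {lam Lam d : ℝ}
    (h : HasExpandingBranches S lam Lam d) (hS : Measurable S) (hlam : 2 < lam) :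
    ∃ C : ℝ, 0 ≤ C ∧ ∀ (B : Set ℝ), MeasurableSet B → volume B ≠ ⊤ → ∀ (n : ℕ) (W : Set ℝ),
      W.OrdConnected → W ⊆ Ioo 0 1 →
      volume.real (W ∩ S^[n] ⁻¹' B) ≤ volume.real B * ((2 / lam) ^ n + C * volume.real W) := by
  obtain ⟨C, hC, hbd⟩ := h.exists_volume_inter_preimage_le hS hlam
  refine ⟨C.toReal, ENNReal.toReal_nonneg, fun B hB hBt n W hW hW1 => ?_⟩
  have hWt : volume W ≠ ⊤ := measure_ne_top_of_subset hW1 (by simp)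
  have h1 := ENNReal.toReal_mono (ENNReal.mul_ne_top hBt (ENNReal.add_ne_top.2
    ⟨ENNReal.pow_ne_top ENNReal.ofReal_ne_top, ENNReal.mul_ne_top hC hWt⟩)) (hbd B hB n W hW hW1)
  rwa [ENNReal.toReal_mul, ENNReal.toReal_add (ENNReal.pow_ne_top ENNReal.ofReal_ne_top)
    (ENNReal.mul_ne_top hC hWt), ENNReal.toReal_pow, ENNReal.toReal_mul,
    ENNReal.toReal_ofReal (by positivity)] at h1

lemma HasExpandingBranches.exists_mul_measureReal_preimage_le {S : ℝ → ℝ} {lam Lam d : ℝ}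
    (h : HasExpandingBranches S lam Lam d) (hS : Measurable S) (hlam : 2 < lam) :
    ∃ C : ℝ, 0 ≤ C ∧ ∀ j : ℕ, ∃ γ u v : ℝ, 0 < γ ∧ 0 < u ∧ u < v ∧ v < 1 ∧
      ∀ B : Set ℝ, MeasurableSet B → B ⊆ Ico u v → ∀ (n : ℕ) (W : Set ℝ),
        W.OrdConnected → W ⊆ Ioo 0 1 →
        volume.real B * volume.real (W ∩ S^[n + (j + 1)] ⁻¹' Ico u v) ≤
          γ * (v - u) * volume.real (W ∩ S^[n + (j + 1)] ⁻¹' B) +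
          2 * (lam ^ (j + 1))⁻¹ * (v - u) * volume.real B *
            ((2 / lam) ^ n + C * volume.real W) := by
  obtain ⟨C, hC, hbd⟩ := h.exists_mul_volume_preimage_le hS hlam
  refine ⟨C.toReal, ENNReal.toReal_nonneg, fun j => ?_⟩
  obtain ⟨γ, u, v, hγ, hu, huv, hv, hbd⟩ := hbd j
  refine ⟨γ.toReal + 1, u, v, by positivity, hu, huv, hv, fun B hB hBA n W hW hW1 => ?_⟩
  have hWt : volume W ≠ ⊤ := measure_ne_top_of_subset hW1 (by simp)
  have hWt' : ∀ E, volume (W ∩ E) ≠ ⊤ := fun E => measure_ne_top_of_subset inter_subset_left hWt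
  have hBt : volume B ≠ ⊤ := measure_ne_top_of_subset hBA (by simp)
  have hlt : (ENNReal.ofReal (lam ^ (j + 1)))⁻¹ ≠ ⊤ := by
    simp only [ne_eq, ENNReal.inv_eq_top, ENNReal.ofReal_eq_zero, not_le]
    positivity
  have e1 : γ * volume (Ico u v) * volume (W ∩ S^[n + (j + 1)] ⁻¹' B) ≠ ⊤ :=
    ENNReal.mul_ne_top (ENNReal.mul_ne_top hγ (by simp)) (hWt' _)
  have e2 : ENNReal.ofReal (2 / lam) ^ n + C * volume W ≠ ⊤ := ENNReal.add_ne_top.2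
    ⟨ENNReal.pow_ne_top ENNReal.ofReal_ne_top, ENNReal.mul_ne_top hC hWt⟩
  have e3 : 2 * (ENNReal.ofReal (lam ^ (j + 1)))⁻¹ * volume (Ico u v) * volume B *
            (ENNReal.ofReal (2 / lam) ^ n + C * volume W) ≠ ⊤ :=
    ENNReal.mul_ne_top (ENNReal.mul_ne_top (ENNReal.mul_ne_top
      (ENNReal.mul_ne_top (by simp) hlt) (by simp)) hBt) e2
  have h1 := ENNReal.toReal_mono (ENNReal.add_ne_top.2 ⟨e1, e3⟩) (hbd B hB hBA n W hW hW1)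
  rw [ENNReal.toReal_add e1 e3] at h1
  simp only [ENNReal.toReal_mul] at h1
  rw [ENNReal.toReal_add (ENNReal.pow_ne_top ENNReal.ofReal_ne_top) (ENNReal.mul_ne_top hC hWt),
    ENNReal.toReal_pow, ENNReal.toReal_mul, ENNReal.toReal_ofReal (by positivity),
    ENNReal.toReal_inv, ENNReal.toReal_ofReal (by positivity), Real.volume_Ico,
    ENNReal.toReal_ofReal (by linarith), ENNReal.toReal_ofNat] at h1
  refine h1.trans (add_le_add ?_ le_rfl)
  have : 0 ≤ v - u := by linarith
  gcongr
  · linarith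
  · rfl

/-- The points of `(0, 1)` returning `σ`-close to themselves at time `n`. -/
def closeReturns (S : ℝ → ℝ) (n : ℕ) (σ : ℝ) : Set ℝ :=
  {x | x ∈ Ioo 0 1 ∧ S^[n] x ∈ Ioo 0 1 ∧ |S^[n] x - x| < σ}

lemma measurableSet_closeReturns {S : ℝ → ℝ} (hS : Measurable S) (n : ℕ) (σ : ℝ) :
    MeasurableSet (closeReturns S n σ) := by
  have hSn := hS.iterate n
  exact measurableSet_Ioo.inter ((hSn measurableSet_Ioo).inter
    (measurableSet_lt (hSn.sub measurable_id).abs measurable_const))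

lemma Ico_subset_iUnion_Ico_mul {u v δ : ℝ} {K : ℕ} (hδ : 0 < δ) (hv : v ≤ u + K * δ) :
    Ico u v ⊆ ⋃ i ∈ Finset.range K, Ico (u + i * δ) (u + (i + 1) * δ) := by
  intro x hx
  have h0 : 0 ≤ (x - u) / δ := div_nonneg (by linarith [hx.1]) hδ.le
  simp only [mem_iUnion, Finset.mem_range]
  refine ⟨⌊(x - u) / δ⌋₊, (Nat.floor_lt h0).2 ?_, ?_, ?_⟩
  · rw [div_lt_iff₀ hδ]; linarith [hx.2]
  · have := (le_div_iff₀ hδ).1 (Nat.floor_le h0); linarith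
  · have := (div_lt_iff₀ hδ).1 (Nat.lt_floor_add_one ((x - u) / δ)); linarith

lemma pairwise_disjoint_Ico_mul (u : ℝ) {δ : ℝ} (hδ : 0 < δ) :
    Pairwise (Function.onFun Disjoint fun i : ℕ => Ico (u + i * δ) (u + (i + 1) * δ)) := by
  have hm : Monotone fun i : ℕ => u + i * δ := fun i j hij => by
    have : (i : ℝ) ≤ j := by exact_mod_cast hij
    dsimp only
    gcongr
  simpa using hm.pairwise_disjoint_on_Ico_succ

lemma measureReal_closeReturns_inter_le {S : ℝ → ℝ} {q C : ℝ} (hq : 0 ≤ q) (hC : 0 ≤ C)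
    (hS : Measurable S)
    (hU : ∀ (B : Set ℝ), MeasurableSet B → volume B ≠ ⊤ → ∀ (n : ℕ) (W : Set ℝ),
      W.OrdConnected → W ⊆ Ioo 0 1 →
      volume.real (W ∩ S^[n] ⁻¹' B) ≤ volume.real B * (q ^ n + C * volume.real W))
    {n m : ℕ} (hnm : n ≤ m) {σ σ' : ℝ} (hσ' : 0 < σ') (hσσ' : σ' ≤ σ) (hσ1 : σ' ≤ 1)
    (hqn : q ^ n ≤ σ') :
    volume.real (closeReturns S n σ ∩ closeReturns S m σ') ≤
      4 * (2 + C) * σ' * (q ^ (m - n) + 4 * C * σ) := by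
  set K := ⌈1 / σ'⌉₊ with hK
  have hK1 : 1 / σ' ≤ K := Nat.le_ceil _
  have hK0 : (0 : ℝ) < K := (by positivity : (0 : ℝ) < 1 / σ').trans_le hK1
  have hK2 : (K : ℝ) * σ' ≤ 2 := by
    have h1 : (K : ℝ) < 1 / σ' + 1 := Nat.ceil_lt_add_one (by positivity)
    calc (K : ℝ) * σ' ≤ (1 / σ' + 1) * σ' := by gcongr
      _ = 1 + σ' := by field_simp
      _ ≤ 2 := by linarith
  set δ : ℝ := 1 / K with hδ
  have hδ0 : 0 < δ := by positivity
  have hδσ : δ ≤ σ' := by rw [hδ, div_le_iff₀ hK0]; rwa [div_le_iff₀ hσ', mul_comm] at hK1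
  have hKδ : K * δ = 1 := by rw [hδ]; field_simp
  set V : ℕ → Set ℝ := fun i => Ico (0 + i * δ) (0 + (i + 1) * δ) ∩ Ioo 0 1 with hV
  set E : ℕ → Set ℝ := fun i => (Ioo 0 1 ∩ Metric.ball (i * δ) (2 * σ)) ∩
    S^[m - n] ⁻¹' Metric.ball (i * δ) (2 * σ') with hE
  have hcover : closeReturns S n σ ∩ closeReturns S m σ' ⊆
      ⋃ i ∈ Finset.range K, V i ∩ S^[n] ⁻¹' E i := by
    rintro x ⟨⟨hx, hxn, hn⟩, ⟨-, -, hm⟩⟩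
    have h1 := Ico_subset_iUnion_Ico_mul (u := 0) (v := 1) (K := K) hδ0 (by linarith)
      (Ioo_subset_Ico_self hx)
    simp only [mem_iUnion] at h1 ⊢
    obtain ⟨i, hi, hxi⟩ := h1
    have h2 : S^[m - n] (S^[n] x) = S^[m] x := by
      rw [← Function.iterate_add_apply, Nat.sub_add_cancel hnm]
    have h3 : |x - i * δ| < σ' := by
      rw [abs_lt]; constructor <;> linarith [hxi.1, hxi.2]
    refine ⟨i, hi, ⟨hxi, hx⟩, ⟨hxn, ?_⟩, ?_⟩
    · rw [Metric.mem_ball, Real.dist_eq]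
      linarith [abs_sub_le (S^[n] x) x (i * δ)]
    · rw [mem_preimage, h2, Metric.mem_ball, Real.dist_eq]
      linarith [abs_sub_le (S^[m] x) x (i * δ)]
  have hball : ∀ (y s : ℝ), 0 ≤ s → volume.real (Metric.ball y s) = 2 * s := fun y s hs => by
    rw [Measure.real, Real.volume_ball, ENNReal.toReal_ofReal (by linarith)]
  have hVr : ∀ i, volume.real (V i) ≤ δ := fun i => by
    refine (measureReal_mono inter_subset_left (by simp)).trans ?_
    rw [Real.volume_real_Ico_of_le (by linarith)]
    linarith
  have hWr : ∀ i : ℕ, volume.real (Ioo 0 1 ∩ Metric.ball (i * δ) (2 * σ)) ≤ 4 * σ := fun i => by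
    refine (measureReal_mono inter_subset_right measure_ball_lt_top.ne).trans ?_
    rw [hball _ _ (by linarith)]; linarith
  have hEm : ∀ i, MeasurableSet (E i) := fun i =>
    (measurableSet_Ioo.inter measurableSet_ball).inter ((hS.iterate _) measurableSet_ball)
  have hEr : ∀ i, volume.real (E i) ≤ 4 * σ' * (q ^ (m - n) + C * (4 * σ)) := fun i => by
    refine (hU _ measurableSet_ball measure_ball_lt_top.ne (m - n) _
      (ordConnected_Ioo.inter (convex_ball _ _).ordConnected) inter_subset_left).trans ?_
    rw [hball _ _ (by linarith)]
    have := hWr i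
    calc 2 * (2 * σ') * (q ^ (m - n) + C * volume.real (Ioo 0 1 ∩ Metric.ball (i * δ) (2 * σ)))
        ≤ 2 * (2 * σ') * (q ^ (m - n) + C * (4 * σ)) := by gcongr
      _ = _ := by ring
  have hEt : ∀ i, volume (E i) ≠ ⊤ := fun i => measure_ne_top_of_subset
    (inter_subset_left.trans inter_subset_left) (by simp : volume (Ioo (0 : ℝ) 1) ≠ ⊤)
  have hσ : 0 ≤ σ := by linarith
  calc volume.real (closeReturns S n σ ∩ closeReturns S m σ')
      ≤ volume.real (⋃ i ∈ Finset.range K, V i ∩ S^[n] ⁻¹' E i) :=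
        measureReal_mono hcover (measure_ne_top_of_subset (s := Ioo 0 1)
          (iUnion₂_subset fun i _ => inter_subset_left.trans inter_subset_right)
          (by simp : volume (Ioo (0 : ℝ) 1) ≠ ⊤))
    _ ≤ ∑ i ∈ Finset.range K, volume.real (V i ∩ S^[n] ⁻¹' E i) :=
        measureReal_biUnion_finset_le _ _
    _ ≤ ∑ i ∈ Finset.range K, 4 * σ' * (q ^ (m - n) + C * (4 * σ)) * (q ^ n + C * δ) := by
        refine Finset.sum_le_sum fun i _ => (hU _ (hEm i) (hEt i) n _
          (ordConnected_Ico.inter ordConnected_Ioo) inter_subset_right).trans ?_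
        have h1 := hVr i
        have h2 := hEr i
        gcongr
    _ = 4 * σ' * (q ^ (m - n) + C * (4 * σ)) * (K * q ^ n + C * (K * δ)) := by
        rw [Finset.sum_const, Finset.card_range, nsmul_eq_mul]; ring
    _ ≤ 4 * σ' * (q ^ (m - n) + C * (4 * σ)) * (2 + C) := by
        rw [hKδ, mul_one]
        gcongr
        exact (mul_le_mul_of_nonneg_left hqn hK0.le).trans hK2
    _ = _ := by ring

lemma measureReal_inter_preimage_Ico_le {S : ℝ → ℝ} {q C γ ω u v : ℝ}
    (hγ : 0 < γ) (hω : 0 ≤ ω) (hu : 0 < u) (huv : u < v) (hv : v < 1) (hS : Measurable S) {n j : ℕ}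
    (hR : ∀ B : Set ℝ, MeasurableSet B → B ⊆ Ico u v → ∀ W : Set ℝ,
        W.OrdConnected → W ⊆ Ioo 0 1 →
        volume.real B * volume.real (W ∩ S^[n] ⁻¹' Ico u v) ≤
          γ * (v - u) * volume.real (W ∩ S^[n] ⁻¹' B) +
          ω * (v - u) * volume.real B * (q ^ j + C * volume.real W))
    {σ : ℝ} (hσ0 : 0 < σ) (hσ : σ ≤ v - u) (hq : 2 * q ^ j ≤ σ) :
    volume.real (Ico u v ∩ S^[n] ⁻¹' Ico u v) ≤
      γ * (2 * (v - u) / σ) * volume.real (closeReturns S n σ) + ω * (1 + C) * (v - u) ^ 2 := by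
  set ℓ := v - u with hℓ
  have hℓ0 : 0 < ℓ := by rw [hℓ]; linarith
  set K := ⌈ℓ / σ⌉₊ with hK
  have hK1 : ℓ / σ ≤ K := Nat.le_ceil _
  have hK0 : (0 : ℝ) < K := (by positivity : (0 : ℝ) < ℓ / σ).trans_le hK1
  have hK2 : (K : ℝ) ≤ 2 * ℓ / σ := by
    have h1 : (K : ℝ) < ℓ / σ + 1 := Nat.ceil_lt_add_one (by positivity)
    have h2 : 1 ≤ ℓ / σ := by rwa [one_le_div hσ0]
    rw [mul_div_assoc]; linarith
  set δ : ℝ := ℓ / K with hδ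
  have hδ0 : 0 < δ := by positivity
  have hδσ : δ ≤ σ := by rw [hδ, div_le_iff₀ hK0]; rwa [div_le_iff₀ hσ0, mul_comm] at hK1
  have hKδ : K * δ = ℓ := by rw [hδ]; field_simp
  set V : ℕ → Set ℝ := fun i => Ico (u + i * δ) (u + (i + 1) * δ) with hV
  have hVr : ∀ i, volume.real (V i) = δ := fun i => by
    rw [Real.volume_real_Ico_of_le (by linarith)]; ring
  have hVA : ∀ i ∈ Finset.range K, V i ⊆ Ico u v := by
    intro i hi
    have h1 : (i : ℝ) + 1 ≤ K := by exact_mod_cast Finset.mem_range.1 hi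
    have h2 : ((i : ℝ) + 1) * δ ≤ ℓ := by rw [← hKδ]; gcongr
    exact Ico_subset_Ico (by nlinarith [(Nat.cast_nonneg i : (0 : ℝ) ≤ i)]) (by linarith)
  have hA : Ico u v ⊆ Ioo 0 1 := fun x hx => ⟨hu.trans_le hx.1, hx.2.trans hv⟩
  have hstep : ∀ i ∈ Finset.range K, volume.real (V i ∩ S^[n] ⁻¹' Ico u v) ≤
      γ * K * volume.real (V i ∩ S^[n] ⁻¹' V i) + ω * ℓ * (q ^ j + C * δ) := by
    intro i hi
    have := hR (V i) measurableSet_Ico (hVA i hi) (V i) ordConnected_Ico ((hVA i hi).trans hA)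
    rw [hVr] at this
    refine le_of_mul_le_mul_left (this.trans_eq ?_) hδ0
    rw [← hKδ]; ring
  have hsum : ∑ i ∈ Finset.range K, volume.real (V i ∩ S^[n] ⁻¹' V i) ≤
      volume.real (closeReturns S n σ) := by
    rw [← measureReal_biUnion_finset
      (fun i _ j _ hij => (pairwise_disjoint_Ico_mul u hδ0 hij).mono inter_subset_left
        inter_subset_left)
      (fun i _ => measurableSet_Ico.inter ((hS.iterate n) measurableSet_Ico))
      (fun i _ => measure_ne_top_of_subset inter_subset_left (by simp))]
    refine measureReal_mono (iUnion₂_subset fun i hi x hx => ?_)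
      (measure_ne_top_of_subset (s := Ioo 0 1) (fun x hx => hx.1) (by simp : volume (Ioo (0 : ℝ) 1) ≠ ⊤))
    refine ⟨hA (hVA i hi hx.1), hA (hVA i hi hx.2), ?_⟩
    rw [abs_lt]
    constructor <;> linarith [hx.1.1, hx.1.2, hx.2.1, hx.2.2]
  calc volume.real (Ico u v ∩ S^[n] ⁻¹' Ico u v)
      ≤ volume.real (⋃ i ∈ Finset.range K, V i ∩ S^[n] ⁻¹' Ico u v) := by
        refine measureReal_mono (fun x hx => ?_) (measure_ne_top_of_subset (s := Ico u v)
          (iUnion₂_subset fun i hi => inter_subset_left.trans (hVA i hi))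
          (by simp : volume (Ico u v) ≠ ⊤))
        have := Ico_subset_iUnion_Ico_mul (K := K) hδ0 (by linarith) hx.1
        simp only [mem_iUnion] at this ⊢
        obtain ⟨i, hi, hxi⟩ := this
        exact ⟨i, hi, hxi, hx.2⟩
    _ ≤ ∑ i ∈ Finset.range K, volume.real (V i ∩ S^[n] ⁻¹' Ico u v) :=
        measureReal_biUnion_finset_le _ _
    _ ≤ ∑ i ∈ Finset.range K, (γ * K * volume.real (V i ∩ S^[n] ⁻¹' V i) +
          ω * ℓ * (q ^ j + C * δ)) := Finset.sum_le_sum hstep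
    _ = γ * K * ∑ i ∈ Finset.range K, volume.real (V i ∩ S^[n] ⁻¹' V i) +
          ω * ℓ * (K * q ^ j + C * (K * δ)) := by
        rw [Finset.sum_add_distrib, ← Finset.mul_sum, Finset.sum_const, Finset.card_range,
          nsmul_eq_mul]
        ring
    _ ≤ γ * (2 * ℓ / σ) * volume.real (closeReturns S n σ) + ω * ℓ * (ℓ + C * ℓ) := by
        rw [hKδ]
        have h3 : (K : ℝ) * q ^ j ≤ ℓ := by
          calc (K : ℝ) * q ^ j ≤ K * (σ / 2) := by gcongr; linarith
            _ ≤ 2 * ℓ / σ * (σ / 2) := by gcongr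
            _ = ℓ := by field_simp
        gcongr
    _ = _ := by ring

end CloseReturns

section Windows

open Set Filter Topology

lemma mul_sum_inv_le_sum_div {a : ℕ → ℝ} {δ : ℝ}
    (ha : ∀ t : ℕ, t * δ ≤ ∑ n ∈ Finset.range t, a n) (M : ℕ) :
    δ * ∑ n ∈ Finset.range M, ((n : ℝ) + 1)⁻¹ ≤ ∑ n ∈ Finset.range M, a n * ((n : ℝ) + 1)⁻¹ := by
  suffices h : ∑ n ∈ Finset.range M, (a n - δ) * ((M : ℝ) + 1)⁻¹ ≤
      ∑ n ∈ Finset.range M, (a n - δ) * ((n : ℝ) + 1)⁻¹ by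
    have h1 : 0 ≤ ∑ n ∈ Finset.range M, (a n - δ) * ((M : ℝ) + 1)⁻¹ := by
      rw [← Finset.sum_mul, Finset.sum_sub_distrib, Finset.sum_const, Finset.card_range,
        nsmul_eq_mul]
      exact mul_nonneg (sub_nonneg.2 (ha M)) (by positivity)
    have h2 := h1.trans h
    simp_rw [sub_mul, Finset.sum_sub_distrib, ← Finset.mul_sum] at h2
    linarith
  induction M with
  | zero => simp
  | succ M ih =>
    have h1 : 0 ≤ ∑ n ∈ Finset.range (M + 1), (a n - δ) := by
      rw [Finset.sum_sub_distrib, Finset.sum_const, Finset.card_range, nsmul_eq_mul]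
      exact sub_nonneg.2 (ha (M + 1))
    rw [← Finset.sum_mul] at ih ⊢
    calc (∑ n ∈ Finset.range (M + 1), (a n - δ)) * (((M + 1 : ℕ) : ℝ) + 1)⁻¹
        ≤ (∑ n ∈ Finset.range (M + 1), (a n - δ)) * ((M : ℝ) + 1)⁻¹ := by
          gcongr
          exact_mod_cast Nat.le_succ M
      _ = (∑ n ∈ Finset.range M, (a n - δ)) * ((M : ℝ) + 1)⁻¹ + (a M - δ) * ((M : ℝ) + 1)⁻¹ := by
          rw [Finset.sum_range_succ, add_mul]
      _ ≤ _ := by rw [Finset.sum_range_succ]; linarith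

lemma sum_filter_pow_sub_le {q : ℝ} (hq : 0 ≤ q) (hq1 : q < 1) (s : Finset ℕ) (m : ℕ) :
    ∑ n ∈ s with n ≤ m, q ^ (m - n) ≤ (1 - q)⁻¹ := by
  rw [← Finset.sum_image (f := fun i => q ^ i) (g := fun n => m - n)
    (fun x hx y hy hxy => by simp at hx hy hxy; omega), ← tsum_geometric_of_lt_one hq hq1]
  exact (summable_geometric_of_lt_one hq hq1).sum_le_tsum _ fun i _ => pow_nonneg hq i

lemma sum_sum_le_of_pow_sub {q X Y : ℝ} (hq : 0 ≤ q) (hq1 : q < 1) (hX : 0 ≤ X) (hY : 0 ≤ Y)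
    {s : Finset ℕ} {σ : ℕ → ℝ} (hσ : ∀ n ∈ s, 0 ≤ σ n) {g : ℕ → ℕ → ℝ} (hg : ∀ n m, g n m = g m n)
    (hle : ∀ n ∈ s, ∀ m ∈ s, n ≤ m → g n m ≤ X * σ m * (q ^ (m - n) + Y * σ n)) :
    ∑ n ∈ s, ∑ m ∈ s, g n m ≤ 2 * X * (∑ n ∈ s, σ n) * ((1 - q)⁻¹ + Y * ∑ n ∈ s, σ n) := by
  set F : ℕ → ℕ → ℝ := fun n m => if n ≤ m then X * σ m * (q ^ (m - n) + Y * σ n) else 0 with hF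
  have hF0 : ∀ n ∈ s, ∀ m ∈ s, 0 ≤ F n m := by
    intro n hn m hm
    have h1 := hσ n hn
    have h2 := hσ m hm
    simp only [hF]
    split_ifs <;> positivity
  have hgF : ∀ n ∈ s, ∀ m ∈ s, g n m ≤ F n m + F m n := by
    intro n hn m hm
    rcases le_total n m with h | h
    · have h1 : F n m = X * σ m * (q ^ (m - n) + Y * σ n) := if_pos h
      linarith [hle n hn m hm h, hF0 m hm n hn]
    · have h1 : F m n = X * σ n * (q ^ (n - m) + Y * σ m) := if_pos h
      linarith [hle m hm n hn h, hF0 n hn m hm, hg n m]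
  have hFsum : ∑ m ∈ s, ∑ n ∈ s, F n m ≤
      X * (∑ n ∈ s, σ n) * ((1 - q)⁻¹ + Y * ∑ n ∈ s, σ n) := by
    rw [Finset.mul_sum s, Finset.sum_mul]
    refine Finset.sum_le_sum fun m hm => ?_
    have h2 := hσ m hm
    rw [← Finset.sum_filter, ← Finset.mul_sum, Finset.sum_add_distrib, ← Finset.mul_sum]
    gcongr
    · exact sum_filter_pow_sub_le hq hq1 s m
    · exact fun i hi _ => hσ i hi
    · exact Finset.filter_subset _ _
  calc ∑ n ∈ s, ∑ m ∈ s, g n m ≤ ∑ n ∈ s, ∑ m ∈ s, (F n m + F m n) :=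
        Finset.sum_le_sum fun n hn => Finset.sum_le_sum fun m hm => hgF n hn m hm
    _ = 2 * ∑ m ∈ s, ∑ n ∈ s, F n m := by
        simp_rw [Finset.sum_add_distrib]
        rw [Finset.sum_comm, two_mul]
    _ ≤ 2 * (X * (∑ n ∈ s, σ n) * ((1 - q)⁻¹ + Y * ∑ n ∈ s, σ n)) := by gcongr
    _ = _ := by ring

lemma eventually_mul_le_exp {a : ℝ} (ha : 0 < a) (b : ℝ) :
    ∀ᶠ N : ℕ in atTop, b * N ≤ Real.exp (a * N) := by
  filter_upwards [eventually_ge_atTop ⌈2 * b / a ^ 2⌉₊] with N hN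
  have h1 : 2 * b / a ^ 2 ≤ N := (Nat.le_ceil _).trans (by exact_mod_cast hN)
  rw [div_le_iff₀ (by positivity)] at h1
  have h2 := Real.quadratic_le_exp_of_nonneg (by positivity : 0 ≤ a * N)
  have h3 : 0 ≤ a * (N : ℝ) := by positivity
  nlinarith [(Nat.cast_nonneg N : (0 : ℝ) ≤ N)]

lemma eventually_one_add_log_le {a : ℝ} (ha : 0 < a) :
    ∀ᶠ N : ℕ in atTop, 1 + Real.log N ≤ a * N := by
  have h1 := (Real.isLittleO_log_id_atTop.bound (half_pos ha)).natCast_atTop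
  filter_upwards [h1, eventually_ge_atTop ⌈2 / a⌉₊] with N h1 hN
  have h2 : 2 / a ≤ N := (Nat.le_ceil _).trans (by exact_mod_cast hN)
  rw [div_le_iff₀ ha] at h2
  rw [Real.norm_eq_abs, id, Real.norm_eq_abs, abs_of_nonneg (Nat.cast_nonneg N : (0 : ℝ) ≤ N)] at h1
  linarith [le_abs_self (Real.log N)]

lemma coe_harmonic (n : ℕ) : (harmonic n : ℝ) = ∑ i ∈ Finset.range n, ((i : ℝ) + 1)⁻¹ := by
  simp [harmonic]

end Windows

section WindowMeasure

open Set Filter Topology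

lemma HasExpandingBranches.exists_eventually_sum_measureReal_inter_le {S : ℝ → ℝ} {lam Lam d : ℝ}
    (h : HasExpandingBranches S lam Lam d) (hS : Measurable S) (hlam : 2 < lam) {τ : ℝ} (hτ : 0 < τ)
    (hτq : Real.exp (-(2 * τ)) = 2 / lam) :
    ∃ X : ℝ, 0 < X ∧ ∀ᶠ N : ℕ in atTop,
      ∑ n ∈ Finset.Ico N ⌊Real.exp (τ * N)⌋₊, ∑ m ∈ Finset.Ico N ⌊Real.exp (τ * N)⌋₊,
        volume.real (closeReturns S n (((n : ℝ) + 1) * √N)⁻¹ ∩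
          closeReturns S m (((m : ℝ) + 1) * √N)⁻¹) ≤ X * N := by
  obtain ⟨C, hC, hU⟩ := h.exists_measureReal_inter_preimage_le hS hlam
  set q : ℝ := 2 / lam with hq
  have hq0 : 0 < q := by rw [← hτq]; positivity
  have hq1 : q < 1 := by rw [hq, div_lt_one (by linarith)]; exact hlam
  have h1q : 0 < 1 - q := by linarith
  refine ⟨2 * (4 * (2 + C)) * (1 + τ) * ((1 - q)⁻¹ + 4 * C * (1 + τ)), by positivity, ?_⟩
  filter_upwards [eventually_mul_le_exp hτ 1, eventually_ge_atTop 1] with N hN hN1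
  set M := ⌊Real.exp (τ * N)⌋₊ with hM
  have hN1' : (1 : ℝ) ≤ N := by exact_mod_cast hN1
  have hN0 : (0 : ℝ) < N := by linarith
  have hs1 : 1 ≤ √(N : ℝ) := Real.one_le_sqrt.2 hN1'
  have hs0 : 0 < √(N : ℝ) := by linarith
  have hsN : √(N : ℝ) * √(N : ℝ) = N := Real.mul_self_sqrt hN0.le
  have hsX : √(N : ℝ) ≤ Real.exp (τ * N) := by nlinarith
  set σ : ℕ → ℝ := fun n => (((n : ℝ) + 1) * √N)⁻¹ with hσ
  have hσ0 : ∀ n, 0 < σ n := fun n => by simp only [hσ]; positivity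
  have hMle : ∀ m ∈ Finset.Ico N M, (m : ℝ) + 1 ≤ Real.exp (τ * N) := by
    intro m hm
    have h1 : (m : ℝ) + 1 ≤ M := by exact_mod_cast (Finset.mem_Ico.1 hm).2
    exact h1.trans (Nat.floor_le (Real.exp_pos _).le)
  have hqN : ∀ n ∈ Finset.Ico N M, ∀ m ∈ Finset.Ico N M, q ^ n ≤ σ m := by
    intro n hn m hm
    have h1 : q ^ n ≤ q ^ N := pow_le_pow_of_le_one hq0.le hq1.le (Finset.mem_Ico.1 hn).1
    have h2 : q ^ N = (Real.exp (τ * N) * Real.exp (τ * N))⁻¹ := by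
      rw [← hτq, ← Real.exp_nat_mul, ← Real.exp_add, ← Real.exp_neg]; congr 1; ring
    rw [h2] at h1
    refine h1.trans ?_
    have h3 := hMle m hm
    simp only [hσ]
    gcongr
  have hs : ∑ n ∈ Finset.Ico N M, σ n ≤ (1 + τ) * √N := by
    have hM1 : ∑ n ∈ Finset.range M, ((n : ℝ) + 1)⁻¹ ≤ 1 + τ * N := by
      rw [← coe_harmonic]
      refine (harmonic_le_one_add_log M).trans ?_
      gcongr
      rcases Nat.eq_zero_or_pos M with h0 | h0
      · rw [h0]; simp; positivity
      · rw [Real.log_le_iff_le_exp (by exact_mod_cast h0)]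
        exact Nat.floor_le (Real.exp_pos _).le
    calc ∑ n ∈ Finset.Ico N M, σ n ≤ ∑ n ∈ Finset.range M, σ n := by
          refine Finset.sum_le_sum_of_subset_of_nonneg ?_ fun n _ _ => (hσ0 n).le
          intro n hn
          exact Finset.mem_range.2 (Finset.mem_Ico.1 hn).2
      _ = (∑ n ∈ Finset.range M, ((n : ℝ) + 1)⁻¹) * (√(N : ℝ))⁻¹ := by
          rw [Finset.sum_mul]; exact Finset.sum_congr rfl fun n _ => by simp only [hσ, mul_inv]
      _ ≤ ((1 + τ) * N) * (√(N : ℝ))⁻¹ := by gcongr; linarith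
      _ = _ := by nth_rewrite 1 [← hsN]; field_simp
  have hmain := sum_sum_le_of_pow_sub (s := Finset.Ico N M) (σ := σ) hq0.le hq1
    (X := 4 * (2 + C)) (Y := 4 * C) (by positivity) (by positivity) (fun n _ => (hσ0 n).le)
    (g := fun n m => volume.real (closeReturns S n (σ n) ∩ closeReturns S m (σ m)))
    (fun n m => by simp only [inter_comm])
    (fun n hn m hm hnm => measureReal_closeReturns_inter_le hq0.le hC hS hU hnm (hσ0 m)
      (by simp only [hσ]; gcongr)
      (by
        simp only [hσ]
        refine inv_le_one_of_one_le₀ ?_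
        nlinarith [(Nat.cast_nonneg m : (0 : ℝ) ≤ m)])
      (hqN n hn m hm))
  have hsum0 : 0 ≤ ∑ n ∈ Finset.Ico N M, σ n := Finset.sum_nonneg fun n _ => (hσ0 n).le
  calc _ ≤ _ := hmain
    _ ≤ 2 * (4 * (2 + C)) * ((1 + τ) * √N) * ((1 - q)⁻¹ + 4 * C * ((1 + τ) * √N)) := by gcongr
    _ ≤ 2 * (4 * (2 + C)) * ((1 + τ) * √N) * ((1 - q)⁻¹ * √N + 4 * C * ((1 + τ) * √N)) := by
        gcongr
        exact le_mul_of_one_le_right (by positivity) hs1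
    _ = 2 * (4 * (2 + C)) * (1 + τ) * ((1 - q)⁻¹ + 4 * C * (1 + τ)) * (√(N : ℝ) * √(N : ℝ)) := by
        ring
    _ = _ := by rw [hsN]

lemma HasExpandingBranches.exists_eventually_le_sum_measureReal {S : ℝ → ℝ} {lam Lam d : ℝ}
    (h : HasExpandingBranches S lam Lam d) (hS : Measurable S) (hlam : 2 < lam) {τ : ℝ} (hτ : 0 < τ)
    (hτq : Real.exp (-(2 * τ)) = 2 / lam) {β : ℝ} (hβ : 0 < β)
    (hrec : ∀ A : Set ℝ, MeasurableSet A → A ⊆ Ioo 0 1 → ∀ t : ℕ,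
      t * (β * volume.real A ^ 2) ≤ ∑ n ∈ Finset.range t, volume.real (A ∩ S^[n] ⁻¹' A)) :
    ∃ Y : ℝ, 0 < Y ∧ ∀ᶠ N : ℕ in atTop,
      Y * √N ≤ ∑ n ∈ Finset.Ico N ⌊Real.exp (τ * N)⌋₊,
        volume.real (closeReturns S n (((n : ℝ) + 1) * √N)⁻¹) := by
  obtain ⟨C, hC, hR⟩ := h.exists_mul_measureReal_preimage_le hS hlam
  set q : ℝ := 2 / lam with hq
  have hq0 : 0 < q := by rw [← hτq]; positivity
  have hq1 : q < 1 := by rw [hq, div_lt_one (by linarith)]; exact hlam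
  obtain ⟨j, hj⟩ : ∃ j : ℕ, 2 * (lam ^ (j + 1))⁻¹ * (1 + C) ≤ β / 2 := by
    obtain ⟨j, hj⟩ := pow_unbounded_of_one_lt (2 * (1 + C) / (β / 2)) (by linarith : 1 < lam)
    refine ⟨j, ?_⟩
    have h1 : lam ^ j ≤ lam ^ (j + 1) := pow_le_pow_right₀ (by linarith) (Nat.le_succ j)
    have h2 := (div_le_iff₀ (by positivity)).1 (hj.le.trans h1)
    have h3 : 0 < lam ^ (j + 1) := by positivity
    rw [mul_assoc, mul_comm (lam ^ (j + 1))⁻¹, ← mul_assoc, ← div_eq_mul_inv, div_le_iff₀ h3]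
    linarith
  obtain ⟨γ, u, v, hγ, hu, huv, hv, hR⟩ := hR j
  set ℓ := v - u with hℓ
  have hℓ0 : 0 < ℓ := by rw [hℓ]; linarith
  set A := Ico u v with hA
  have hA1 : A ⊆ Ioo 0 1 := fun x hx => ⟨hu.trans_le hx.1, hx.2.trans hv⟩
  have hAr : volume.real A = ℓ := Real.volume_real_Ico_of_le huv.le
  set b : ℕ → ℝ := fun n => volume.real (A ∩ S^[n] ⁻¹' A) with hb
  have hbℓ : ∀ n, b n ≤ ℓ := fun n =>
    (measureReal_mono inter_subset_left (by simp [hA])).trans_eq hAr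
  set δ : ℝ := β / 2 * ℓ ^ 2 with hδ
  have hδ0 : 0 < δ := by positivity
  have hsumb : ∀ t : ℕ, t * δ ≤ ∑ n ∈ Finset.range t, (b n - δ) := by
    intro t
    have h1 := hrec A measurableSet_Ico hA1 t
    rw [hAr] at h1
    rw [Finset.sum_sub_distrib, Finset.sum_const, Finset.card_range, nsmul_eq_mul]
    have h2 : (t : ℝ) * (β * ℓ ^ 2) = t * δ + t * δ := by rw [hδ]; ring
    linarith
  set Q : ℝ := (q ^ (j + 1))⁻¹ with hQ
  have hQ1 : 1 ≤ Q := one_le_inv_iff₀.2 ⟨by positivity, pow_le_one₀ hq0.le hq1.le⟩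
  refine ⟨δ * τ / (4 * γ * ℓ), by positivity, ?_⟩
  filter_upwards [eventually_mul_le_exp hτ (2 * Q), eventually_ge_atTop (j + 1),
    eventually_one_add_log_le (by positivity : 0 < δ * τ / (2 * ℓ)),
    eventually_ge_atTop ⌈ℓ⁻¹⌉₊] with N hN hNj hlog hNℓ
  set M := ⌊Real.exp (τ * N)⌋₊ with hM
  have hN1' : (1 : ℝ) ≤ N := by exact_mod_cast (Nat.le_add_left 1 j).trans hNj
  have hN0 : (0 : ℝ) < N := by linarith
  have hs1 : 1 ≤ √(N : ℝ) := Real.one_le_sqrt.2 hN1'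
  have hs0 : 0 < √(N : ℝ) := by linarith
  have hsN : √(N : ℝ) * √(N : ℝ) = N := Real.mul_self_sqrt hN0.le
  have hNM : N ≤ M := Nat.le_floor (by nlinarith)
  set σ : ℕ → ℝ := fun n => (((n : ℝ) + 1) * √N)⁻¹ with hσ
  have hσ0 : ∀ n, 0 < σ n := fun n => by simp only [hσ]; positivity
  have hterm : ∀ n ∈ Finset.Ico N M, (b n - δ) * ((n : ℝ) + 1)⁻¹ ≤
      2 * γ * ℓ * √N * volume.real (closeReturns S n (σ n)) := by
    intro n hn
    obtain ⟨hNn, hnM⟩ := Finset.mem_Ico.1 hn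
    have hnj : n - (j + 1) + (j + 1) = n := Nat.sub_add_cancel (hNj.trans hNn)
    have hn1 : (n : ℝ) + 1 ≤ Real.exp (τ * N) := by
      have h1 : (n : ℝ) + 1 ≤ M := by exact_mod_cast hnM
      exact h1.trans (Nat.floor_le (Real.exp_pos _).le)
    have hNn' : (N : ℝ) ≤ n := by exact_mod_cast hNn
    have hqσ : 2 * q ^ (n - (j + 1)) ≤ σ n := by
      have h1 : q ^ (n - (j + 1)) = q ^ n * Q := by
        rw [hQ, eq_mul_inv_iff_mul_eq₀ (by positivity), ← pow_add, hnj]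
      have h2 : q ^ n ≤ q ^ N := pow_le_pow_of_le_one hq0.le hq1.le hNn
      have h3 : q ^ N = (Real.exp (τ * N) * Real.exp (τ * N))⁻¹ := by
        rw [← hτq, ← Real.exp_nat_mul, ← Real.exp_add, ← Real.exp_neg]; congr 1; ring
      have h4 : 2 * Q * √N ≤ Real.exp (τ * N) := by nlinarith
      rw [h1]
      calc 2 * (q ^ n * Q) ≤ 2 * ((Real.exp (τ * N) * Real.exp (τ * N))⁻¹ * Q) := by
            rw [← h3]; gcongr
        _ = (2 * Q) * (Real.exp (τ * N))⁻¹ * (Real.exp (τ * N))⁻¹ := by rw [mul_inv]; ring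
        _ ≤ (√N)⁻¹ * ((n : ℝ) + 1)⁻¹ := by
            gcongr
            rw [← div_eq_mul_inv, div_le_iff₀ (Real.exp_pos _), inv_mul_eq_div, le_div_iff₀ hs0]
            exact h4
        _ = σ n := by simp only [hσ]; rw [mul_inv, mul_comm]
    have hσℓ : σ n ≤ ℓ := by
      have h1 : ℓ⁻¹ ≤ N := (Nat.le_ceil _).trans (by exact_mod_cast hNℓ)
      simp only [hσ]
      rw [inv_le_comm₀ (by positivity) hℓ0]
      nlinarith
    have hfm := measureReal_inter_preimage_Ico_le (j := n - (j + 1)) (n := n) (q := q) (C := C)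
      (ω := 2 * (lam ^ (j + 1))⁻¹) hγ (by positivity) hu huv hv hS
      (fun B hB hBA W hW hW1 => by
        have := hR B hB hBA (n - (j + 1)) W hW hW1
        rwa [hnj] at this) (hσ0 n) hσℓ hqσ
    have h1 : b n - δ ≤ γ * (2 * ℓ / σ n) * volume.real (closeReturns S n (σ n)) := by
      have h2 : 2 * (lam ^ (j + 1))⁻¹ * (1 + C) * ℓ ^ 2 ≤ δ := by rw [hδ]; gcongr
      linarith
    calc (b n - δ) * ((n : ℝ) + 1)⁻¹
        ≤ γ * (2 * ℓ / σ n) * volume.real (closeReturns S n (σ n)) * ((n : ℝ) + 1)⁻¹ := by gcongr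
      _ = _ := by simp only [hσ]; field_simp
  have hsum : δ * (τ * N) / 2 ≤ ∑ n ∈ Finset.Ico N M, (b n - δ) * ((n : ℝ) + 1)⁻¹ := by
    have h1 := mul_sum_inv_le_sum_div hsumb M
    have h2 : τ * N ≤ ∑ n ∈ Finset.range M, ((n : ℝ) + 1)⁻¹ := by
      rw [← coe_harmonic]
      refine le_trans ?_ (log_add_one_le_harmonic M)
      rw [Real.le_log_iff_exp_le (by positivity)]
      push_cast
      exact (Nat.lt_floor_add_one _).le
    have h3 : ∑ n ∈ Finset.range N, (b n - δ) * ((n : ℝ) + 1)⁻¹ ≤ ℓ * (1 + Real.log N) := by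
      calc ∑ n ∈ Finset.range N, (b n - δ) * ((n : ℝ) + 1)⁻¹
          ≤ ∑ n ∈ Finset.range N, ℓ * ((n : ℝ) + 1)⁻¹ := by
            gcongr with n hn
            linarith [hbℓ n]
        _ = ℓ * harmonic N := by rw [coe_harmonic, Finset.mul_sum]
        _ ≤ _ := by gcongr; exact harmonic_le_one_add_log N
    have h4 := Finset.sum_range_add_sum_Ico (fun n => (b n - δ) * ((n : ℝ) + 1)⁻¹) hNM
    have h5 : δ * (τ * N) ≤ δ * ∑ n ∈ Finset.range M, ((n : ℝ) + 1)⁻¹ := by gcongr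
    have h6 : ℓ * (1 + Real.log N) ≤ δ * (τ * N) / 2 := by
      calc ℓ * (1 + Real.log N) ≤ ℓ * (δ * τ / (2 * ℓ) * N) := by gcongr
        _ = _ := by field_simp
    linarith
  have hfin := hsum.trans (Finset.sum_le_sum hterm)
  rw [← Finset.mul_sum] at hfin
  have hpos : 0 < 2 * γ * ℓ * √N := by positivity
  refine le_of_mul_le_mul_left (le_trans (le_of_eq ?_) hfin) hpos
  calc 2 * γ * ℓ * √N * (δ * τ / (4 * γ * ℓ) * √N) = δ * τ / 2 * (√N * √N) := by
        field_simp
        norm_num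
    _ = δ * (τ * N) / 2 := by rw [hsN]; ring

end WindowMeasure

section PositiveMeasure

open Set Filter Topology

lemma le_measure_setOf_frequently {α : Type*} [MeasurableSpace α] {ν : Measure α}
    [IsFiniteMeasure ν] {U : ℕ → Set α} (hU : ∀ N, MeasurableSet (U N)) {ε : ENNReal}
    (hε : ∀ᶠ N in atTop, ε ≤ ν (U N)) : ε ≤ ν {x | ∃ᶠ N in atTop, x ∈ U N} := by
  have heq : {x | ∃ᶠ N in atTop, x ∈ U N} = ⋂ K, ⋃ N, ⋃ (_ : K ≤ N), U N := by
    ext x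
    simp [frequently_atTop]
  have hanti : Antitone fun K : ℕ => ⋃ N, ⋃ (_ : K ≤ N), U N := fun K L hKL =>
    iUnion_mono fun N => iUnion_mono' fun h => ⟨hKL.trans h, le_rfl⟩
  rw [heq, hanti.measure_iInter
    (fun K => (MeasurableSet.iUnion fun N => MeasurableSet.iUnion fun _ => hU N).nullMeasurableSet)
    ⟨0, measure_ne_top _ _⟩]
  refine le_iInf fun K => ?_
  obtain ⟨N, hN, hKN⟩ := (hε.and (eventually_ge_atTop K)).exists
  exact hN.trans (measure_mono (subset_iUnion₂_of_subset N hKN subset_rfl))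

lemma HasExpandingBranches.exists_measure_pos {S : ℝ → ℝ} {lam Lam d : ℝ}
    (h : HasExpandingBranches S lam Lam d) (hlam : 2 < lam) {ν : Measure ℝ} [IsProbabilityMeasure ν]
    (hS : MeasurePreserving S ν ν) {c : ℝ} (hc : 1 ≤ c)
    (hν : ∀ A : Set ℝ, MeasurableSet A → A ⊆ Ioo 0 1 →
      volume.real A ≤ c * ν.real A ∧ ν.real A ≤ c * volume.real A) :
    ∃ τ : ℝ, 0 < τ ∧ 0 < ν {x | ∃ᶠ N : ℕ in atTop, x ∈ ⋃ n ∈ Finset.Ico N ⌊Real.exp (τ * N)⌋₊,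
      closeReturns S n (((n : ℝ) + 1) * √N)⁻¹} := by
  have hc0 : 0 < c := by linarith
  have hSm := hS.measurable
  set τ : ℝ := Real.log (lam / 2) / 2 with hτd
  have hτ : 0 < τ := half_pos (Real.log_pos (by linarith))
  have hτq : Real.exp (-(2 * τ)) = 2 / lam := by
    rw [hτd, mul_div_cancel₀ _ two_ne_zero, ← Real.log_inv, Real.exp_log (by positivity), inv_div]
  have hrec : ∀ A : Set ℝ, MeasurableSet A → A ⊆ Ioo 0 1 → ∀ t : ℕ,
      t * ((2 * c ^ 3)⁻¹ * volume.real A ^ 2) ≤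
        ∑ n ∈ Finset.range t, volume.real (A ∩ S^[n] ⁻¹' A) := by
    intro A hA hA1 t
    have h1 := hS.mul_sq_measureReal_le hA t
    have h2 : ∑ n ∈ Finset.range t, ν.real (A ∩ S^[n] ⁻¹' A) ≤
        c * ∑ n ∈ Finset.range t, volume.real (A ∩ S^[n] ⁻¹' A) := by
      rw [Finset.mul_sum]
      exact Finset.sum_le_sum fun n _ => (hν _ (hA.inter ((hSm.iterate n) hA))
        (inter_subset_left.trans hA1)).2
    have h3 : volume.real A ^ 2 ≤ c ^ 2 * ν.real A ^ 2 := by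
      rw [← mul_pow]; gcongr; exact (hν A hA hA1).1
    have h4 : (t : ℝ) * volume.real A ^ 2 ≤
        2 * c ^ 3 * ∑ n ∈ Finset.range t, volume.real (A ∩ S^[n] ⁻¹' A) := by
      calc (t : ℝ) * volume.real A ^ 2 ≤ t * (c ^ 2 * ν.real A ^ 2) := by gcongr
        _ = c ^ 2 * (t * ν.real A ^ 2) := by ring
        _ ≤ c ^ 2 * (2 * (c * ∑ n ∈ Finset.range t, volume.real (A ∩ S^[n] ⁻¹' A))) :=
            mul_le_mul_of_nonneg_left (h1.trans (by linarith)) (by positivity)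
        _ = _ := by ring
    rw [← mul_assoc, mul_comm (t : ℝ), mul_assoc, inv_mul_le_iff₀ (by positivity)]
    exact h4
  obtain ⟨X, hX, hXN⟩ := h.exists_eventually_sum_measureReal_inter_le hSm hlam hτ hτq
  obtain ⟨Y, hY, hYN⟩ := h.exists_eventually_le_sum_measureReal hSm hlam hτ hτq
    (by positivity : 0 < (2 * c ^ 3)⁻¹) hrec
  refine ⟨τ, hτ, ?_⟩
  have hε : 0 < Y ^ 2 / X / c := by positivity
  refine (ENNReal.ofReal_pos.2 hε).trans_le (le_measure_setOf_frequently (fun N =>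
    Finset.measurableSet_biUnion _ fun n _ => measurableSet_closeReturns hSm n _) ?_)
  filter_upwards [hXN, hYN, eventually_ge_atTop 1] with N hXN hYN hN1
  set s := Finset.Ico N ⌊Real.exp (τ * N)⌋₊ with hs
  set G : ℕ → Set ℝ := fun n => closeReturns S n (((n : ℝ) + 1) * √N)⁻¹ with hG
  have hN0 : (0 : ℝ) < N := by exact_mod_cast hN1
  have hGm : ∀ n, MeasurableSet (G n) := fun n => measurableSet_closeReturns hSm n _
  have hG1 : ∀ n, G n ⊆ Ioo 0 1 := fun n x hx => hx.1
  have hCE := sq_sum_measureReal_le (ν := volume.restrict (Ioo (0 : ℝ) 1)) s hGm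
  have hrestr : ∀ V : Set ℝ, MeasurableSet V → V ⊆ Ioo 0 1 →
      (volume.restrict (Ioo (0 : ℝ) 1)).real V = volume.real V := fun V hV hV1 => by
    rw [measureReal_restrict_apply hV, inter_eq_self_of_subset_left hV1]
  have hUm : MeasurableSet (⋃ n ∈ s, G n) := Finset.measurableSet_biUnion _ fun n _ => hGm n
  have hU1 : ⋃ n ∈ s, G n ⊆ Ioo 0 1 := iUnion₂_subset fun n _ => hG1 n
  simp_rw [hrestr _ hUm hU1, fun n => hrestr _ (hGm n) (hG1 n), fun n m =>
    hrestr _ ((hGm n).inter (hGm m)) (inter_subset_left.trans (hG1 n))] at hCE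
  have h1 : (Y * √N) ^ 2 ≤ volume.real (⋃ n ∈ s, G n) * (X * N) :=
    (pow_le_pow_left₀ (by positivity) hYN 2).trans (hCE.trans (by gcongr))
  rw [mul_pow, Real.sq_sqrt hN0.le, ← mul_assoc] at h1
  have h2 : Y ^ 2 ≤ volume.real (⋃ n ∈ s, G n) * X := le_of_mul_le_mul_right h1 hN0
  have h3 : Y ^ 2 / X / c ≤ ν.real (⋃ n ∈ s, G n) := by
    rw [div_le_iff₀ hc0, div_le_iff₀ hX]
    refine h2.trans ?_
    gcongr
    rw [mul_comm]
    exact (hν _ hUm hU1).1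
  exact (ENNReal.ofReal_le_ofReal h3).trans_eq (ofReal_measureReal (measure_ne_top _ _))

/-- The points returning to themselves infinitely often at speed
`O(1 / (n * √(log n)))`. -/
def fastReturns (T : ℝ → ℝ) : Set ℝ :=
  {x | ∃ L : ℕ, ∃ᶠ n : ℕ in atTop, |T^[n] x - x| < L * (((n : ℝ) + 1) * √(Real.log (n + 2)))⁻¹}

lemma setOf_frequently_closeReturns_subset_fastReturns {T : ℝ → ℝ} {k : ℕ} (hk : 0 < k) {τ : ℝ}
    (hτ : 0 < τ) :
    {x | ∃ᶠ N : ℕ in atTop, x ∈ ⋃ n ∈ Finset.Ico N ⌊Real.exp (τ * N)⌋₊,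
      closeReturns T^[k] n (((n : ℝ) + 1) * √N)⁻¹} ⊆ fastReturns T := by
  intro x hx
  have hk1 : (1 : ℝ) ≤ k := by exact_mod_cast hk
  have hlog2k : 0 ≤ Real.log (2 * k) := Real.log_nonneg (by linarith)
  refine ⟨⌈k * √(Real.log (2 * k) + τ)⌉₊, frequently_atTop.2 fun t₀ => ?_⟩
  obtain ⟨N, hN, hxN⟩ := frequently_atTop.1 hx (t₀ + 1)
  simp only [mem_iUnion, Finset.mem_Ico] at hxN
  obtain ⟨n, ⟨hNn, hnM⟩, -, -, hn⟩ := hxN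
  rw [← Function.iterate_mul] at hn
  refine ⟨k * n, by nlinarith, hn.trans_le ?_⟩
  have hN1 : (1 : ℝ) ≤ N := by exact_mod_cast (Nat.le_add_left 1 t₀).trans hN
  have hn0 : (0 : ℝ) ≤ n := Nat.cast_nonneg n
  have hne : (n : ℝ) + 1 ≤ Real.exp (τ * N) := by
    have h1 : (n : ℝ) + 1 ≤ ⌊Real.exp (τ * N)⌋₊ := by exact_mod_cast hnM
    exact h1.trans (Nat.floor_le (Real.exp_pos _).le)
  have hlog : Real.log ((k * n : ℕ) + 2) ≤ (Real.log (2 * k) + τ) * N := by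
    have h1 : (((k * n : ℕ) : ℝ) + 2) ≤ 2 * k * Real.exp (τ * N) := by
      push_cast
      calc (k : ℝ) * n + 2 ≤ 2 * k * (n + 1) := by nlinarith
        _ ≤ _ := by gcongr
    have h2 := Real.log_le_log (by positivity) h1
    rw [Real.log_mul (by positivity) (by positivity), Real.log_exp] at h2
    nlinarith
  have hlogpos : 0 < Real.log ((k * n : ℕ) + 2) :=
    Real.log_pos (by have : (0 : ℝ) ≤ (k * n : ℕ) := Nat.cast_nonneg _; linarith)
  have hmain : (((k * n : ℕ) : ℝ) + 1) * √(Real.log ((k * n : ℕ) + 2)) ≤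
      k * √(Real.log (2 * k) + τ) * ((n + 1) * √N) := by
    calc (((k * n : ℕ) : ℝ) + 1) * √(Real.log ((k * n : ℕ) + 2))
        ≤ (k * (n + 1)) * √((Real.log (2 * k) + τ) * N) := by
          gcongr
          push_cast
          linarith
      _ = _ := by rw [Real.sqrt_mul (by positivity)]; ring
  have hceil := Nat.le_ceil (k * √(Real.log (2 * k) + τ))
  have hsq : 0 < √(Real.log ((k * n : ℕ) + 2)) := Real.sqrt_pos.2 hlogpos
  rw [← div_eq_mul_inv, le_div_iff₀ (by positivity), inv_mul_le_iff₀ (by positivity),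
    mul_comm _ (⌈_⌉₊ : ℝ)]
  exact hmain.trans (mul_le_mul_of_nonneg_right hceil (by positivity))

lemma measurableSet_fastReturns {T : ℝ → ℝ} (hT : Measurable T) :
    MeasurableSet (fastReturns T) := by
  have heq : fastReturns T = ⋃ L : ℕ, ⋂ t : ℕ, ⋃ n : ℕ, ⋃ (_ : t ≤ n),
      {x | |T^[n] x - x| < L * (((n : ℝ) + 1) * √(Real.log (n + 2)))⁻¹} := by
    ext x
    simp [fastReturns, frequently_atTop]
  rw [heq]
  exact MeasurableSet.iUnion fun L => MeasurableSet.iInter fun t => MeasurableSet.iUnion fun n =>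
    MeasurableSet.iUnion fun _ =>
      measurableSet_lt ((hT.iterate n).sub measurable_id).abs measurable_const

end PositiveMeasure

section PiecewiseExpanding

open Set Filter Topology

lemma ContDiffOn.exists_abs_derivWithin_le_exp_mul {g : ℝ → ℝ} {u v lam : ℝ} (huv : u < v)
    (hg : ContDiffOn ℝ 2 g (Icc u v)) (hlam : 1 < lam)
    (hg' : ∀ x ∈ Icc u v, lam ≤ |derivWithin g (Icc u v) x|) :
    ∃ d, 0 ≤ d ∧ ∀ x ∈ Icc u v, ∀ y ∈ Icc u v, |derivWithin g (Icc u v) x| ≤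
      Real.exp (d * |x - y|) * |derivWithin g (Icc u v) y| := by
  have hG : ContDiffOn ℝ 1 (derivWithin g (Icc u v)) (Icc u v) :=
    hg.derivWithin (uniqueDiffOn_Icc huv) (by norm_num)
  obtain ⟨d, hd⟩ := isCompact_Icc.exists_bound_of_continuousOn
    (hG.continuousOn_derivWithin (uniqueDiffOn_Icc huv) le_rfl)
  have hd0 : 0 ≤ d := (norm_nonneg _).trans (hd u (left_mem_Icc.2 huv.le))
  refine ⟨d, hd0, fun x hx y hy => ?_⟩
  have h1 := (convex_Icc u v).norm_image_sub_le_of_norm_derivWithin_le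
    (hG.differentiableOn one_ne_zero) hd hy hx
  rw [Real.norm_eq_abs, Real.norm_eq_abs] at h1
  have h2 := abs_sub_abs_le_abs_sub (derivWithin g (Icc u v) x) (derivWithin g (Icc u v) y)
  have h3 := hg' y hy
  have h4 := Real.add_one_le_exp (d * |x - y|)
  have h5 : 0 ≤ d * |x - y| := by positivity
  nlinarith

lemma IsPiecewiseC2Expanding.exists_expandingBranches {T : ℝ → ℝ}
    (hT : IsPiecewiseC2Expanding T) : ∃ (lam Lam d : ℝ) (N : ℕ) (P : Fin N → Set ℝ) (T' : ℝ → ℝ),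
      ExpandingBranches T T' P lam Lam d ∧ ∀ i, IsOpen (P i) := by
  obtain ⟨lam, Lam, hlam, -, hmaps, N, a, -, ha0, haN, ha, hg⟩ := hT
  choose! g hgC hTg hgd using hg
  choose! d hd0 hd using fun i (hi : i < N) =>
    (hgC i hi).exists_abs_derivWithin_le_exp_mul (ha i hi) hlam fun x hx => (hgd i hi x hx).1
  have hmono : StrictMonoOn a (Iic N) := strictMonoOn_of_lt_succ ordConnected_Iic
    fun i _ _ hi => ha i (Nat.lt_of_succ_le hi)
  have hsub : ∀ i < N, Ioo (a i) (a (i + 1)) ⊆ Ioo 0 1 := fun i hi => by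
    refine Ioo_subset_Ioo ?_ ?_
    · rw [← ha0]
      exact hmono.monotoneOn (mem_Iic.2 N.zero_le) hi.le i.zero_le
    · rw [← haN]
      exact hmono.monotoneOn hi (mem_Iic.2 le_rfl) hi
  have hTe : ∀ i < N, ∀ x ∈ Ioo (a i) (a (i + 1)),
      HasDerivAt T (derivWithin (g i) (Icc (a i) (a (i + 1))) x) x := fun i hi x hx => by
    have h1 : T =ᶠ[𝓝 x] g i := (hTg i hi).eventuallyEq_of_mem (Ico_mem_nhds hx.1 hx.2)
    have h2 := ((hgC i hi).differentiableOn two_ne_zero x (Ioo_subset_Icc_self hx)).hasDerivWithinAt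
    exact (h2.hasDerivAt (Icc_mem_nhds hx.1 hx.2)).congr_of_eventuallyEq h1
  have hdT : ∀ i < N, ∀ x ∈ Ioo (a i) (a (i + 1)),
      deriv T x = derivWithin (g i) (Icc (a i) (a (i + 1))) x := fun i hi x hx =>
    (hTe i hi x hx).deriv
  refine ⟨lam, Lam, ∑ i ∈ Finset.range N, d i, N, fun i => Ioo (a i) (a (i + 1)), deriv T,
    { ordConnected := fun i => ordConnected_Ioo
      subset := fun i => hsub i i.2
      volume_pos := fun i => by simpa using ha i i.2
      disjoint := ?_
      cover := ?_
      mapsTo := ?_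
      hasDeriv := fun i x hx => by
        rw [hdT i i.2 x hx]
        exact (hTe i i.2 x hx).hasDerivWithinAt
      le_deriv := fun i x hx => by
        rw [hdT i i.2 x hx]
        exact (hgd i i.2 x (Ioo_subset_Icc_self hx)).1
      deriv_le := fun i x hx => by
        rw [hdT i i.2 x hx]
        exact (hgd i i.2 x (Ioo_subset_Icc_self hx)).2
      distortion := fun i x hx y hy => by
        rw [hdT i i.2 x hx, hdT i i.2 y hy]
        refine (hd i i.2 x (Ioo_subset_Icc_self hx) y (Ioo_subset_Icc_self hy)).trans ?_
        gcongr
        exact Finset.single_le_sum (f := d) (fun j hj => hd0 j (Finset.mem_range.1 hj))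
          (Finset.mem_range.2 i.2)
      one_lt := hlam
      distortion_nonneg := Finset.sum_nonneg fun j hj => hd0 j (Finset.mem_range.1 hj) },
    fun i => isOpen_Ioo⟩
  · have hdisj : ∀ i j : Fin N, i < j → Disjoint (Ioo (a i) (a (i + 1))) (Ioo (a j) (a (j + 1))) :=
      fun i j hij => Set.disjoint_left.2 fun x hxi hxj => by
        have := hmono.monotoneOn (mem_Iic.2 (Nat.succ_le_of_lt i.2)) (mem_Iic.2 j.2.le)
          (Nat.succ_le_of_lt hij)
        linarith [hxi.2, hxj.1]
    intro i j hij
    rcases hij.lt_or_gt with hij | hij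
    exacts [hdisj i j hij, (hdisj j i hij).symm]
  · refine measure_mono_null (t := a '' Iic N) ?_ (((finite_Iic N).image a).measure_zero volume)
    rintro x ⟨hx, hxP⟩
    by_contra hxa
    have hlt : ∀ i ≤ N, a i < x := by
      intro i
      induction i with
      | zero => exact fun _ => ha0 ▸ hx.1
      | succ i ih =>
        intro hi
        refine lt_of_le_of_ne (not_lt.1 fun hlt => hxP ?_) fun h => hxa ⟨i + 1, hi, h⟩
        exact mem_iUnion.2 ⟨⟨i, hi⟩, ih (by lia), hlt⟩
    have := hlt N le_rfl
    rw [haN] at this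
    exact lt_asymm this hx.2
  · intro i x hx
    have hnhds : ∀ᶠ y in 𝓝 x, y ∈ Icc (0 : ℝ) 1 :=
      mem_of_superset (isOpen_Ioo.mem_nhds hx) ((hsub i i.2).trans Ioo_subset_Icc_self)
    have hx01 := hmaps (Ioo_subset_Icc_self (hsub i i.2 hx))
    have hne : ¬ IsLocalExtr T x := fun hext => by
      have h1 := (hgd i i.2 x (Ioo_subset_Icc_self hx)).1
      rw [← hdT i i.2 x hx, hext.deriv_eq_zero, abs_zero] at h1
      linarith
    refine ⟨lt_of_le_of_ne hx01.1 fun h0 => hne (Or.inl ?_),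
      lt_of_le_of_ne hx01.2 fun h1 => hne (Or.inr ?_)⟩
    · filter_upwards [hnhds] with y hy
      exact h0 ▸ (hmaps hy).1
    · filter_upwards [hnhds] with y hy
      exact h1 ▸ (hmaps hy).2

lemma measureReal_le_of_withDensity {μ : Measure ℝ} [IsFiniteMeasure μ] {h : ℝ → ℝ} {c : ℝ}
    (hc : 0 < c)
    (hdens : μ = (volume.restrict (Icc 0 1)).withDensity (fun x => ENNReal.ofReal (h x)))
    (hbound : ∀ x ∈ Icc (0:ℝ) 1, c⁻¹ ≤ h x ∧ h x ≤ c) {A : Set ℝ} (hA : MeasurableSet A)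
    (hA1 : A ⊆ Ioo 0 1) : volume.real A ≤ c * μ.real A ∧ μ.real A ≤ c * volume.real A := by
  have hA2 : A ⊆ Icc 0 1 := hA1.trans Ioo_subset_Icc_self
  have hfin : volume A ≠ ⊤ := measure_ne_top_of_subset (s := Ioo (0 : ℝ) 1) hA1 (by simp)
  have hμ : μ A = ∫⁻ x in A, ENNReal.ofReal (h x) := by
    rw [hdens, withDensity_apply _ hA, Measure.restrict_restrict hA,
      inter_eq_self_of_subset_left hA2]
  have h1 : ENNReal.ofReal c⁻¹ * volume A ≤ μ A := by
    rw [hμ, ← setLIntegral_const]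
    exact setLIntegral_mono' hA fun x hx => ENNReal.ofReal_le_ofReal (hbound x (hA2 hx)).1
  have h2 : μ A ≤ ENNReal.ofReal c * volume A := by
    rw [hμ, ← setLIntegral_const]
    exact setLIntegral_mono' hA fun x hx => ENNReal.ofReal_le_ofReal (hbound x (hA2 hx)).2
  have h3 := ENNReal.toReal_mono (measure_ne_top _ _) h1
  have h4 := ENNReal.toReal_mono (ENNReal.mul_ne_top ENNReal.ofReal_ne_top hfin) h2
  rw [ENNReal.toReal_mul, ENNReal.toReal_ofReal (by positivity)] at h3 h4
  exact ⟨by rwa [← inv_mul_le_iff₀ hc], h4⟩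

lemma tendsto_inv_mul_sqrt_log : Tendsto
    (fun n : ℕ => (((n : ℝ) + 1) * √(Real.log (n + 2)))⁻¹) atTop (𝓝 0) := by
  refine tendsto_inv_atTop_zero.comp (Tendsto.atTop_mul_atTop₀ ?_ ?_)
  · exact tendsto_atTop_add_const_right _ _ tendsto_natCast_atTop_atTop
  · exact Real.tendsto_sqrt_atTop.comp (Real.tendsto_log_atTop.comp
      (tendsto_atTop_add_const_right _ _ tendsto_natCast_atTop_atTop))

lemma ExpandingBranches.map_mem_fastReturns {ι : Type} {T T' : ℝ → ℝ} {P : ι → Set ℝ}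
    {lam Lam d : ℝ} (hP : ExpandingBranches T T' P lam Lam d) {i : ι} (hi : IsOpen (P i)) {x : ℝ}
    (hx : x ∈ P i) (hxT : x ∈ fastReturns T) : T x ∈ fastReturns T := by
  obtain ⟨L, hL⟩ := hxT
  have hLam : 0 < Lam := by linarith [hP.one_lt, hP.le_deriv i x hx, hP.deriv_le i x hx]
  refine ⟨⌈Lam * L⌉₊, ?_⟩
  obtain ⟨ε, hε, hball⟩ := Metric.isOpen_iff.1 hi x hx
  have hlim : ∀ᶠ n : ℕ in atTop, L * (((n : ℝ) + 1) * √(Real.log (n + 2)))⁻¹ < ε := by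
    have := tendsto_inv_mul_sqrt_log.const_mul (L : ℝ)
    rw [mul_zero] at this
    exact this.eventually (gt_mem_nhds hε)
  refine (hL.and_eventually hlim).mono fun n ⟨hn, hnε⟩ => ?_
  have hmem : T^[n] x ∈ P i := hball (by rw [Metric.mem_ball, Real.dist_eq]; linarith)
  rw [← Function.iterate_succ_apply, Function.iterate_succ_apply']
  calc |T (T^[n] x) - T x| ≤ Lam * |T^[n] x - x| := (hP.abs_slope hmem hx).2
    _ < Lam * (L * (((n : ℝ) + 1) * √(Real.log (n + 2)))⁻¹) := by gcongr
    _ = Lam * L * (((n : ℝ) + 1) * √(Real.log (n + 2)))⁻¹ := by ring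
    _ ≤ _ := by gcongr; exact Nat.le_ceil _

lemma fastReturns_subset_Rio {T : ℝ → ℝ} {θ κ : ℝ} (hθ : θ < 1 / 2) (hκ : 0 < κ) {r : ℕ → ℝ}
    (hrate : ∀ n : ℕ, 2 ≤ n → κ / (n * Real.log n ^ θ) ≤ r n) : fastReturns T ⊆ Rio T r := by
  rintro x ⟨L, hL⟩
  have hlim : ∀ᶠ n : ℕ in atTop, (L : ℝ) ≤ κ * Real.log n ^ (1 / 2 - θ) :=
    (((tendsto_rpow_atTop (by linarith : 0 < 1 / 2 - θ)).comp
      (Real.tendsto_log_atTop.comp tendsto_natCast_atTop_atTop)).const_mul_atTop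
        hκ).eventually_ge_atTop _
  refine (hL.and_eventually (hlim.and (eventually_ge_atTop 2))).mono fun n ⟨hn, hLn, hn2⟩ => ?_
  rw [Metric.mem_ball, Real.dist_eq]
  refine hn.trans_le (le_trans ?_ (hrate n hn2))
  have hn2' : (2 : ℝ) ≤ n := by exact_mod_cast hn2
  have hlog : 0 < Real.log n := Real.log_pos (by linarith)
  have hlog' : Real.log n ≤ Real.log (n + 2) := Real.log_le_log (by linarith) (by linarith)
  have hlogθ : 0 < Real.log n ^ θ := Real.rpow_pos_of_pos hlog _
  have hsq : 0 < √(Real.log (n + 2)) := Real.sqrt_pos.2 (hlog.trans_le hlog')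
  rw [← div_eq_mul_inv, div_le_div_iff₀ (by positivity) (by positivity)]
  calc (L : ℝ) * (n * Real.log n ^ θ)
      ≤ κ * Real.log n ^ (1 / 2 - θ) * (n * Real.log n ^ θ) := by gcongr
    _ = κ * (n * (Real.log n ^ (1 / 2 - θ) * Real.log n ^ θ)) := by ring
    _ = κ * (n * √(Real.log n)) := by
        rw [← Real.rpow_add hlog, sub_add_cancel, ← Real.sqrt_eq_rpow]
    _ ≤ _ := by gcongr; linarith

end PiecewiseExpanding

theorem stmt0 (T : ℝ → ℝ) (hT : IsPiecewiseC2Expanding T) (hLI : LargeImageProperty T)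
    (μ : Measure ℝ) [IsProbabilityMeasure μ] (hErg : Ergodic T μ)
    (h : ℝ → ℝ) (c : ℝ) (hc : 1 ≤ c)
    (hdens : μ = (volume.restrict (Set.Icc 0 1)).withDensity (fun x => ENNReal.ofReal (h x)))
    (hbound : ∀ x ∈ Set.Icc (0:ℝ) 1, c⁻¹ ≤ h x ∧ h x ≤ c)
    (θ : ℝ) (hθ : θ < 1 / 2) (κ : ℝ) (hκ : 0 < κ)
    (r : ℕ → ℝ) (hr : ∀ n, 0 ≤ r n)
    (hrate : ∀ n : ℕ, 2 ≤ n → κ / (n * Real.log n ^ θ) ≤ r n) :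
    μ (Rio T r) = 1 := by
  obtain ⟨lam, Lam, d, N, P, T', hP, hPo⟩ := hT.exists_expandingBranches
  obtain ⟨k, hk⟩ := pow_unbounded_of_one_lt 2 hP.one_lt
  have hk' : 2 < lam ^ (k + 1) := hk.trans (pow_lt_pow_right₀ hP.one_lt k.lt_succ_self)
  have hTb : HasExpandingBranches T lam Lam d := ⟨Fin N, inferInstance, P, T', hP⟩
  obtain ⟨Lam', d', hTk⟩ := hTb.iterate hErg.measurable k
  obtain ⟨τ, hτ, hpos⟩ := hTk.exists_measure_pos hk'
    (hErg.toMeasurePreserving.iterate (k + 1)) hc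
    fun A hA hA1 => measureReal_le_of_withDensity (by linarith) hdens hbound hA hA1
  have hpos' : 0 < μ (fastReturns T) := hpos.trans_le (measure_mono
    (setOf_frequently_closeReturns_subset_fastReturns k.succ_pos hτ))
  have hae : ∀ᵐ x ∂μ, ∃ i, x ∈ P i := by
    have h1 : μ ≪ volume.restrict (Set.Icc 0 1) := hdens ▸ withDensity_absolutelyContinuous _ _
    refine h1.ae_le ?_
    change ∀ᵐ x ∂volume.restrict (Set.Icc 0 1), ∃ i, x ∈ P i
    rw [← restrict_Ioo_eq_restrict_Icc, ae_restrict_iff' measurableSet_Ioo]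
    filter_upwards [measure_eq_zero_iff_ae_notMem.1 hP.cover] with x hx hx1
    by_contra hxP
    exact hx ⟨hx1, by simpa using hxP⟩
  have hle : fastReturns T ≤ᵐ[μ] T ⁻¹' fastReturns T := by
    filter_upwards [hae] with x ⟨i, hi⟩ hx
    exact hP.map_mem_fastReturns (hPo i) hi hx
  refine le_antisymm prob_le_one ?_
  rcases hErg.ae_empty_or_univ_of_ae_le_preimage
    (measurableSet_fastReturns hErg.measurable).nullMeasurableSet hle with h0 | h1
  · rw [measure_congr h0, measure_empty] at hpos'
    exact absurd hpos' (lt_irrefl _)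
  · calc 1 = μ (fastReturns T) := by rw [measure_congr h1, measure_univ]
      _ ≤ μ (Rio T r) := measure_mono (fastReturns_subset_Rio hθ hκ hrate)
end

section
/- Let (X,T,μ) with X = [0,1] be a measure-preserving system whose correlations for L¹ against BV are summable, i.e. decay as a function p with ∑_n p(n) < ∞. If ∑_{n=1}^∞ ∫ μ(B(x,r_n)) dμ(x) < ∞, then μ(R_io(r_n)) = 0. -/
open MeasureTheory

/-- The BV norm of `g` on `[0,1]`: total variation plus sup norm. -/
noncomputable def BVNorm (g : ℝ → ℝ) : ℝ :=
  (eVariationOn g (Set.Icc 0 1)).toReal + sSup ((fun x => |g x|) '' Set.Icc 0 1)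

/-- The system `(X, T, μ)` on `X = [0,1]` has decay of correlations `p` for `L¹`
against `BV`. -/
def DecayL1BV (T : ℝ → ℝ) (μ : Measure ℝ) (p : ℕ → ℝ) : Prop :=
  ∀ (n : ℕ) (f g : ℝ → ℝ), Integrable f μ → BoundedVariationOn g (Set.Icc 0 1) →
    |(∫ x, f (T^[n] x) * g x ∂μ) - (∫ x, f x ∂μ) * ∫ x, g x ∂μ| ≤
      (∫ x, |f x| ∂μ) * BVNorm g * p n

theorem eVariationOn_sub_le {α E : Type*} [LinearOrder α] [SeminormedAddCommGroup E]
    (f g : α → E) (s : Set α) :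
    eVariationOn (f - g) s ≤ eVariationOn f s + eVariationOn g s := by
  refine iSup_le fun u => ?_
  calc ∑ i ∈ Finset.range u.1, edist ((f - g) (u.2.1 (i + 1))) ((f - g) (u.2.1 i))
      ≤ ∑ i ∈ Finset.range u.1, (edist (f (u.2.1 (i + 1))) (f (u.2.1 i)) +
          edist (g (u.2.1 (i + 1))) (g (u.2.1 i))) := by
        refine Finset.sum_le_sum fun i _ => ?_
        simpa only [Pi.sub_apply, sub_eq_add_neg, edist_neg_neg] using
          edist_add_add_le (f (u.2.1 (i + 1))) (-g (u.2.1 (i + 1))) (f (u.2.1 i)) (-g (u.2.1 i))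
    _ ≤ eVariationOn f s + eVariationOn g s := by
        rw [Finset.sum_add_distrib]
        exact add_le_add (eVariationOn.sum_le u.2.2.1 u.2.2.2)
          (eVariationOn.sum_le u.2.2.1 u.2.2.2)

theorem eVariationOn_indicator_Ici_le (a : ℝ) :
    eVariationOn ((Set.Ici a).indicator (1 : ℝ → ℝ)) (Set.Icc 0 1) ≤ 1 := by
  have hmono : Monotone ((Set.Ici a).indicator (1 : ℝ → ℝ)) := by
    intro x y hxy
    simp only [Set.indicator_apply, Set.mem_Ici, Pi.one_apply]
    split_ifs <;> linarith
  have h := (hmono.monotoneOn (Set.Icc 0 1)).eVariationOn_eq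
    (Set.left_mem_Icc.2 zero_le_one) (Set.right_mem_Icc.2 zero_le_one)
  rw [Set.inter_self] at h
  rw [h, ← ENNReal.ofReal_one]
  refine ENNReal.ofReal_le_ofReal ?_
  simp only [Set.indicator_apply, Set.mem_Ici, Pi.one_apply]
  split_ifs <;> norm_num

theorem eVariationOn_indicator_Ico_le (a b : ℝ) :
    eVariationOn ((Set.Ico a b).indicator (1 : ℝ → ℝ)) (Set.Icc 0 1) ≤ 2 := by
  rcases le_or_gt a b with hab | hab
  · have h : (Set.Ico a b).indicator (1 : ℝ → ℝ) =
        (Set.Ici a).indicator 1 - (Set.Ici b).indicator 1 := by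
      ext x
      simp only [Set.indicator_apply, Set.mem_Ico, Set.mem_Ici, Pi.one_apply, Pi.sub_apply]
      split_ifs <;> grind
    rw [h, ← one_add_one_eq_two]
    exact (eVariationOn_sub_le _ _ _).trans
      (add_le_add (eVariationOn_indicator_Ici_le a) (eVariationOn_indicator_Ici_le b))
  · rw [Set.Ico_eq_empty_of_le hab.le, Set.indicator_empty, eVariationOn.constant_on]
    · exact zero_le
    · rintro _ ⟨x, -, rfl⟩ _ ⟨y, -, rfl⟩
      rfl

theorem BVNorm_indicator_Ico_le (a b : ℝ) :
    BVNorm ((Set.Ico a b).indicator 1) ≤ 3 := by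
  have h₁ : (eVariationOn ((Set.Ico a b).indicator (1 : ℝ → ℝ)) (Set.Icc 0 1)).toReal ≤ 2 :=
    ENNReal.toReal_le_of_le_ofReal (by norm_num) (by simpa using eVariationOn_indicator_Ico_le a b)
  have h₂ : sSup ((fun x => |(Set.Ico a b).indicator (1 : ℝ → ℝ) x|) '' Set.Icc 0 1) ≤ 1 := by
    refine csSup_le ((Set.nonempty_Icc.2 zero_le_one).image _) ?_
    rintro _ ⟨x, -, rfl⟩
    simp only [Set.indicator_apply, Pi.one_apply]
    split_ifs <;> norm_num
  unfold BVNorm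
  linarith

theorem DecayL1BV.measure_inter_preimage_le {T : ℝ → ℝ} {μ : Measure ℝ} [IsProbabilityMeasure μ]
    {p : ℕ → ℝ} (hdecay : DecayL1BV T μ p) (hT : Measurable T) (n : ℕ) (a b : ℝ) {A : Set ℝ}
    (hA : MeasurableSet A) :
    μ (Set.Ico a b ∩ T^[n] ⁻¹' A) ≤
      μ (Set.Ico a b) * μ A + 3 * ENNReal.ofReal |p n| * μ A := by
  have hV := ne_top_of_le_ne_top ENNReal.ofNat_ne_top (eVariationOn_indicator_Ico_le a b)
  have hTn : MeasurableSet (T^[n] ⁻¹' A) := hT.iterate n hA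
  have h := hdecay n (A.indicator 1) ((Set.Ico a b).indicator 1)
    ((integrable_const (1 : ℝ)).indicator hA) hV
  have e₁ : (fun x => A.indicator (1 : ℝ → ℝ) (T^[n] x) * (Set.Ico a b).indicator 1 x) =
      (Set.Ico a b ∩ T^[n] ⁻¹' A).indicator 1 := by
    ext x
    by_cases h₁ : x ∈ Set.Ico a b <;> by_cases h₂ : T^[n] x ∈ A <;>
      simp [-Set.mem_Ico, h₁, h₂]
  have e₂ : (fun x => |A.indicator (1 : ℝ → ℝ) x|) = A.indicator 1 := by
    ext x
    by_cases h : x ∈ A <;> simp [h]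
  rw [e₁, e₂, integral_indicator_one (measurableSet_Ico.inter hTn), integral_indicator_one hA,
    integral_indicator_one measurableSet_Ico] at h
  have hB0 : 0 ≤ BVNorm ((Set.Ico a b).indicator 1) := by
    refine add_nonneg ENNReal.toReal_nonneg (Real.sSup_nonneg ?_)
    rintro _ ⟨x, -, rfl⟩
    exact abs_nonneg _
  have hbound : μ.real A * BVNorm ((Set.Ico a b).indicator 1) * p n ≤ μ.real A * 3 * |p n| := by
    have := BVNorm_indicator_Ico_le a b
    have := measureReal_nonneg (μ := μ) (s := A)
    calc μ.real A * BVNorm ((Set.Ico a b).indicator 1) * p n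
        ≤ μ.real A * BVNorm ((Set.Ico a b).indicator 1) * |p n| := by
          gcongr
          exact le_abs_self _
      _ ≤ _ := by gcongr
  have hreal : μ.real (Set.Ico a b ∩ T^[n] ⁻¹' A) ≤
      μ.real (Set.Ico a b) * μ.real A + 3 * |p n| * μ.real A := by
    linarith [(abs_le.1 h).2]
  rw [← ofReal_measureReal (μ := μ) (s := Set.Ico a b ∩ _), ← ofReal_measureReal (μ := μ) (s := A),
    ← ofReal_measureReal (μ := μ) (s := Set.Ico a b)]
  refine (ENNReal.ofReal_le_ofReal hreal).trans_eq ?_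
  rw [ENNReal.ofReal_add (by positivity) (by positivity), ENNReal.ofReal_mul (by positivity),
    ENNReal.ofReal_mul (by positivity), ENNReal.ofReal_mul (by positivity)]
  simp

theorem floor_div_preimage_singleton {ρ : ℝ} (hρ : 0 < ρ) (i : ℤ) :
    (fun x : ℝ => ⌊x / ρ⌋) ⁻¹' {i} = Set.Ico (i * ρ) ((i + 1) * ρ) := by
  ext x
  simp only [Set.mem_preimage, Set.mem_singleton_iff, Int.floor_eq_iff, Set.mem_Ico, le_div_iff₀ hρ,
    div_lt_iff₀ hρ]

theorem measurable_floor_div (ρ : ℝ) : Measurable (fun x : ℝ => ⌊x / ρ⌋) :=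
  Int.measurable_floor.comp (measurable_id.div_const ρ)

/-- The squared masses of a grid of mesh `ρ` are controlled by the average mass of `ρ`-balls. -/
theorem tsum_measure_floor_sq_le (μ : Measure ℝ) {ρ : ℝ} (hρ : 0 < ρ) :
    ∑' i : ℤ, μ ((fun x : ℝ => ⌊x / ρ⌋) ⁻¹' {i}) * μ ((fun x : ℝ => ⌊x / ρ⌋) ⁻¹' {i}) ≤
      ∫⁻ x, μ (Metric.ball x ρ) ∂μ := by
  have hq := measurable_floor_div ρ
  set q : ℝ → ℤ := fun x => ⌊x / ρ⌋ with hqdef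
  calc ∑' i : ℤ, μ (q ⁻¹' {i}) * μ (q ⁻¹' {i})
      = ∑' i : ℤ, μ (q ⁻¹' {i}) * μ.map q {i} := by
        simp only [Measure.map_apply hq (measurableSet_singleton _)]
    _ = ∫⁻ x, μ (q ⁻¹' {q x}) ∂μ := by
        rw [← lintegral_countable', lintegral_map (Measurable.of_discrete) hq]
    _ ≤ ∫⁻ x, μ (Metric.ball x ρ) ∂μ := by
        refine lintegral_mono fun x => measure_mono fun y hy => ?_
        have hx : x ∈ q ⁻¹' {q x} := rfl
        rw [hqdef, floor_div_preimage_singleton hρ, Set.mem_Ico] at hx hy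
        rw [Metric.mem_ball, Real.dist_eq, abs_lt]
        constructor <;> linarith [hx.1, hx.2, hy.1, hy.2]

theorem tsum_measure_preimage_singleton_eq_one (μ : Measure ℝ) [IsProbabilityMeasure μ]
    {q : ℝ → ℤ} (hq : Measurable q) : ∑' i, μ (q ⁻¹' {i}) = 1 := by
  have := Measure.isProbabilityMeasure_map (μ := μ) hq.aemeasurable
  simp only [← Measure.map_apply hq (measurableSet_singleton _)]
  simpa using (lintegral_countable' (μ := μ.map q) 1).symm

theorem ENNReal.mul_le_mul_self_add_mul_self (a b : ENNReal) : a * b ≤ a * a + b * b := by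
  rcases le_total a b with h | h
  · exact (mul_le_mul_left h b).trans le_add_self
  · exact (mul_le_mul_right h a).trans le_self_add

theorem DecayL1BV.measure_return_le {T : ℝ → ℝ} {μ : Measure ℝ} [IsProbabilityMeasure μ]
    {p : ℕ → ℝ} (hdecay : DecayL1BV T μ p) (hT : Measurable T) (n : ℕ) (ρ : ℝ) :
    μ {x | T^[n] x ∈ Metric.ball x ρ} ≤
      6 * ∫⁻ x, μ (Metric.ball x ρ) ∂μ + 9 * ENNReal.ofReal |p n| := by
  rcases le_or_gt ρ 0 with hρ | hρ
  · simp [Metric.ball_eq_empty.2 hρ]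
  have hq := measurable_floor_div ρ
  have hgrid := floor_div_preimage_singleton hρ
  have hS := tsum_measure_floor_sq_le μ hρ
  set q : ℝ → ℤ := fun x => ⌊x / ρ⌋ with hqdef
  set m : ℤ → ENNReal := fun i => μ (q ⁻¹' {i}) with hm
  set S := ∫⁻ x, μ (Metric.ball x ρ) ∂μ
  have hpiece (i j : ℤ) : μ (q ⁻¹' {i} ∩ T^[n] ⁻¹' (q ⁻¹' {j})) ≤
      m i * m i + m j * m j + 3 * ENNReal.ofReal |p n| * m j := by
    have h := hdecay.measure_inter_preimage_le hT n (i * ρ) ((i + 1) * ρ)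
      (hq (measurableSet_singleton j))
    rw [← hgrid] at h
    exact h.trans (add_le_add_left (ENNReal.mul_le_mul_self_add_mul_self _ _) _)
  have hdiag (d : ℤ) : μ (⋃ i : ℤ, q ⁻¹' {i} ∩ T^[n] ⁻¹' (q ⁻¹' {i + d})) ≤
      2 * S + 3 * ENNReal.ofReal |p n| := by
    have hshift (f : ℤ → ENNReal) : ∑' i, f (i + d) = ∑' i, f i :=
      (Equiv.addRight d).tsum_eq f
    calc μ (⋃ i : ℤ, q ⁻¹' {i} ∩ T^[n] ⁻¹' (q ⁻¹' {i + d}))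
        ≤ ∑' i : ℤ, μ (q ⁻¹' {i} ∩ T^[n] ⁻¹' (q ⁻¹' {i + d})) := measure_iUnion_le _
      _ ≤ ∑' i : ℤ, (m i * m i + m (i + d) * m (i + d) + 3 * ENNReal.ofReal |p n| * m (i + d)) :=
          ENNReal.tsum_le_tsum fun i => hpiece i (i + d)
      _ = (∑' i, m i * m i) + (∑' i, m i * m i) + 3 * ENNReal.ofReal |p n| := by
          rw [ENNReal.tsum_add, ENNReal.tsum_add, ENNReal.tsum_mul_left,
            hshift fun i => m i * m i, hshift m, tsum_measure_preimage_singleton_eq_one μ hq,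
            mul_one]
      _ ≤ 2 * S + 3 * ENNReal.ofReal |p n| := by
          rw [two_mul]
          gcongr
  have hcover : {x | T^[n] x ∈ Metric.ball x ρ} ⊆
      ⋃ d ∈ ({-1, 0, 1} : Finset ℤ), ⋃ i : ℤ, q ⁻¹' {i} ∩ T^[n] ⁻¹' (q ⁻¹' {i + d}) := by
    intro x hx
    rw [Set.mem_ofPred_eq, Metric.mem_ball, Real.dist_eq, abs_lt] at hx
    have hd : |T^[n] x / ρ - x / ρ| < 1 := by
      rw [← sub_div, abs_div, abs_of_pos hρ, div_lt_one hρ, abs_lt]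
      exact hx
    rw [abs_lt] at hd
    have h₁ : q (T^[n] x) < q x + 2 := Int.floor_lt.2 <| by
      push_cast
      linarith [Int.lt_floor_add_one (x / ρ)]
    have h₂ : q x < q (T^[n] x) + 2 := Int.floor_lt.2 <| by
      push_cast
      linarith [Int.lt_floor_add_one (T^[n] x / ρ)]
    refine Set.mem_biUnion (x := q (T^[n] x) - q x) ?_ (Set.mem_iUnion.2 ⟨q x, rfl, ?_⟩)
    · simp only [Finset.coe_insert, Finset.coe_singleton, Set.mem_insert_iff,
        Set.mem_singleton_iff]
      omega
    · simp
  calc μ {x | T^[n] x ∈ Metric.ball x ρ}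
      ≤ ∑ d ∈ ({-1, 0, 1} : Finset ℤ),
          μ (⋃ i : ℤ, q ⁻¹' {i} ∩ T^[n] ⁻¹' (q ⁻¹' {i + d})) :=
        (measure_mono hcover).trans (measure_biUnion_finset_le _ _)
    _ ≤ ∑ d ∈ ({-1, 0, 1} : Finset ℤ), (2 * S + 3 * ENNReal.ofReal |p n|) :=
        Finset.sum_le_sum fun d _ => hdiag d
    _ = 6 * S + 9 * ENNReal.ofReal |p n| := by
        rw [Finset.sum_const, show ({-1, 0, 1} : Finset ℤ).card = 3 from rfl, nsmul_eq_mul]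
        push_cast
        ring

theorem stmt1 (T : ℝ → ℝ) (hmaps : Set.MapsTo T (Set.Icc 0 1) (Set.Icc 0 1))
    (μ : Measure ℝ) [IsProbabilityMeasure μ] (hsupp : μ (Set.Icc 0 1) = 1)
    (hpres : MeasurePreserving T μ μ)
    (p : ℕ → ℝ) (hsum : Summable p) (hdecay : DecayL1BV T μ p)
    (r : ℕ → ℝ) (hr : ∀ n, 0 ≤ r n)
    (hconv : ∑' n : ℕ, ∫⁻ x, μ (Metric.ball x (r n)) ∂μ ≠ ⊤) :
    μ (Rio T r) = 0 := by
  refine measure_setOfPred_frequently_eq_zero (ne_top_of_le_ne_top ?_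
    (ENNReal.tsum_le_tsum fun n => hdecay.measure_return_le hpres.measurable n (r n)))
  rw [ENNReal.tsum_add, ENNReal.tsum_mul_left, ENNReal.tsum_mul_left]
  exact ENNReal.add_ne_top.2 ⟨ENNReal.mul_ne_top ENNReal.ofNat_ne_top hconv,
    ENNReal.mul_ne_top ENNReal.ofNat_ne_top hsum.abs.tsum_ofReal_ne_top⟩
end

section
/- Let X = 𝕋^d = ℝ^d/ℤ^d with the standard flat metric, let A be a d×d integer matrix none of whose eigenvalues is a root of unity, let T(x) = Ax mod 1, and let μ be the Haar (Lebesgue) probability measure on 𝕋^d. If (r_n) is a sequence of nonnegative reals with ∑_{n=1}^∞ r_n^d < ∞, then μ(R_io(r_n)) = 0. -/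
open MeasureTheory

/-- The map `x ↦ A x (mod 1)` on the `d`-dimensional torus `ℝ^d/ℤ^d`, induced by an
integer matrix `A`. -/
noncomputable def torusLinMap {d : ℕ} (A : Matrix (Fin d) (Fin d) ℤ) :
    (Fin d → AddCircle (1 : ℝ)) → (Fin d → AddCircle (1 : ℝ)) :=
  fun x i => ∑ j, A i j • x j

theorem torusLinMap_one {d : ℕ} (x : Fin d → AddCircle (1 : ℝ)) :
    torusLinMap 1 x = x := by
  ext i
  simp [torusLinMap, Matrix.one_apply, ite_smul]

theorem torusLinMap_sub {d : ℕ} (A B : Matrix (Fin d) (Fin d) ℤ)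
    (x : Fin d → AddCircle (1 : ℝ)) :
    torusLinMap (A - B) x = torusLinMap A x - torusLinMap B x := by
  ext i
  simp [torusLinMap, sub_smul, Finset.sum_sub_distrib]

theorem torusLinMap_mul {d : ℕ} (A B : Matrix (Fin d) (Fin d) ℤ)
    (x : Fin d → AddCircle (1 : ℝ)) :
    torusLinMap (A * B) x = torusLinMap A (torusLinMap B x) := by
  ext i
  simp only [torusLinMap, Matrix.mul_apply, Finset.sum_smul, Finset.smul_sum, mul_smul]
  exact Finset.sum_comm

theorem torusLinMap_iterate {d : ℕ} (A : Matrix (Fin d) (Fin d) ℤ) (n : ℕ)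
    (x : Fin d → AddCircle (1 : ℝ)) :
    (torusLinMap A)^[n] x = torusLinMap (A ^ n) x := by
  induction n generalizing x with
  | zero => simp [torusLinMap_one]
  | succ n ih => rw [Function.iterate_succ_apply, ih, pow_succ, torusLinMap_mul]

theorem torusLinMap_surjective {d : ℕ} {B : Matrix (Fin d) (Fin d) ℤ} (hB : B.det ≠ 0) :
    Function.Surjective (torusLinMap B) := by
  intro y
  have hdiv : ∀ i, ∃ w : AddCircle (1 : ℝ), B.det • w = y i := by
    intro i
    obtain ⟨t, ht⟩ := QuotientAddGroup.mk_surjective (y i)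
    refine ⟨((t / B.det : ℝ) : AddCircle (1 : ℝ)), ?_⟩
    rw [← AddCircle.coe_zsmul, ← ht, zsmul_eq_mul, mul_div_cancel₀ _ (by exact_mod_cast hB)]
  choose w hw using hdiv
  refine ⟨torusLinMap B.adjugate w, ?_⟩
  rw [← torusLinMap_mul, Matrix.mul_adjugate]
  ext i
  simp [torusLinMap, Matrix.one_apply, hw]

theorem measurePreserving_torusLinMap {d : ℕ} {B : Matrix (Fin d) (Fin d) ℤ}
    (hB : B.det ≠ 0) : MeasurePreserving (torusLinMap B) := by
  let f : (Fin d → AddCircle (1 : ℝ)) →+ (Fin d → AddCircle (1 : ℝ)) :=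
    { toFun := torusLinMap B
      map_zero' := by ext i; simp [torusLinMap]
      map_add' := fun x y => by ext i; simp [torusLinMap, Finset.sum_add_distrib] }
  have hf : Continuous f := by
    change Continuous (torusLinMap B)
    unfold torusLinMap
    fun_prop
  exact f.measurePreserving hf (torusLinMap_surjective hB) rfl

theorem det_pow_sub_one_ne_zero {d : ℕ} {A : Matrix (Fin d) (Fin d) ℤ}
    (hA : ∀ z : ℂ, (Matrix.charpoly (A.map (Int.cast : ℤ → ℂ))).IsRoot z →
      ∀ k : ℕ, k ≠ 0 → z ^ k ≠ 1) {n : ℕ} (hn : n ≠ 0) : (A ^ n - 1).det ≠ 0 := by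
  intro h
  set C : Matrix (Fin d) (Fin d) ℂ := A.map (Int.cast : ℤ → ℂ) with hC
  have hdet : (C ^ n - 1).det = 0 := by
    have := congrArg (Int.castRingHom ℂ) h
    rw [RingHom.map_det, map_sub, map_pow, map_one, map_zero] at this
    exact this
  have hmem : (1 : ℂ) ∈ spectrum ℂ (C ^ n) := by
    rw [spectrum.mem_iff, map_one, Matrix.isUnit_iff_isUnit_det, ← neg_sub, Matrix.det_neg, hdet]
    simp
  rw [spectrum.map_pow_of_pos C (Nat.pos_of_ne_zero hn)] at hmem
  obtain ⟨z, hz, hzn⟩ := hmem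
  exact hA z (Matrix.mem_spectrum_iff_isRoot_charpoly.mp hz) n hn hzn

theorem volume_torus_ball_zero_le {d : ℕ} {r : ℝ} (hr : 0 ≤ r) :
    volume (Metric.ball (0 : Fin d → AddCircle (1 : ℝ)) r) ≤ ENNReal.ofReal (2 ^ d * r ^ d) := by
  calc volume (Metric.ball (0 : Fin d → AddCircle (1 : ℝ)) r)
      ≤ volume (Metric.closedBall (0 : Fin d → AddCircle (1 : ℝ)) r) :=
        measure_mono Metric.ball_subset_closedBall
    _ = ENNReal.ofReal (min 1 (2 * r)) ^ d := by
        rw [closedBall_pi _ hr, volume_pi_pi]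
        simp [AddCircle.volume_closedBall]
    _ ≤ ENNReal.ofReal (2 * r) ^ d := by gcongr; exact min_le_right _ _
    _ = ENNReal.ofReal (2 ^ d * r ^ d) := by
        rw [← ENNReal.ofReal_pow (by positivity), mul_pow]

theorem volume_iterate_mem_ball_le {d : ℕ} {A : Matrix (Fin d) (Fin d) ℤ} {n : ℕ}
    (hA : (A ^ n - 1).det ≠ 0) {r : ℝ} (hr : 0 ≤ r) :
    volume {x | (torusLinMap A)^[n] x ∈ Metric.ball x r} ≤ ENNReal.ofReal (2 ^ d * r ^ d) := by
  have hset : {x | (torusLinMap A)^[n] x ∈ Metric.ball x r} =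
      torusLinMap (A ^ n - 1) ⁻¹' Metric.ball 0 r := by
    ext x
    simp [torusLinMap_iterate, torusLinMap_sub, torusLinMap_one, dist_eq_norm]
  rw [hset, (measurePreserving_torusLinMap hA).measure_preimage
    Metric.isOpen_ball.measurableSet.nullMeasurableSet]
  exact volume_torus_ball_zero_le hr

theorem stmt2 (d : ℕ) (hd : 0 < d) (A : Matrix (Fin d) (Fin d) ℤ)
    (hA : ∀ z : ℂ, (Matrix.charpoly (A.map (Int.cast : ℤ → ℂ))).IsRoot z →
      ∀ k : ℕ, k ≠ 0 → z ^ k ≠ 1)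
    (r : ℕ → ℝ) (hr : ∀ n, 0 ≤ r n)
    (hconv : Summable fun n => r n ^ d) :
    volume (Rio (torusLinMap A) r) = 0 := by
  let s : ℕ → Set (Fin d → AddCircle (1 : ℝ)) :=
    fun n => {x | (torusLinMap A)^[n + 1] x ∈ Metric.ball x (r (n + 1))}
  have hsum : ∑' n, volume (s n) ≠ ⊤ := by
    have hs : Summable fun n => 2 ^ d * r (n + 1) ^ d :=
      ((summable_nat_add_iff 1).mpr hconv).mul_left _
    exact ne_top_of_le_ne_top hs.tsum_ofReal_ne_top <| ENNReal.tsum_le_tsum fun n =>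
      volume_iterate_mem_ball_le (det_pow_sub_one_ne_zero hA n.succ_ne_zero) (hr _)
  refine measure_mono_null (fun x hx => ?_) (measure_setOfPred_frequently_eq_zero hsum)
  have hx' : ∃ᶠ n in Filter.atTop, (torusLinMap A)^[n] x ∈ Metric.ball x (r n) := hx
  rw [← Filter.map_add_atTop_eq_nat 1] at hx'
  exact hx'
end

section
/- Let (X,d) be a metric space of finite diameter and finite upper box dimension α > 0, and let T : X → X be a measurable map preserving a Borel probability measure μ. Then for every β > α and for μ-almost every x ∈ X, lim_{m→∞} m^{1/β} · inf_{1 ≤ k ≤ m} d(x, T^k(x)) = 0. -/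
open MeasureTheory

/-- The minimal number of balls of radius `r` needed to cover the metric space `X`
(`⊤` if no finite cover exists). -/
noncomputable def coverNumber (X : Type*) [PseudoMetricSpace X] (r : ℝ) : ℕ∞ :=
  sInf ((fun s : Finset X => (s.card : ℕ∞)) ''
    {s : Finset X | ∀ x : X, ∃ c ∈ s, dist x c ≤ r})

/-- If a finite family of `r`-balls covers `X`, the points that do not return `2r`-close to
themselves within `M` steps have measure at most (number of balls) / `M`. -/
theorem measure_not_return_le {X : Type*} [MetricSpace X] [MeasurableSpace X] [BorelSpace X]
    {T : X → X} {μ : Measure X} [IsProbabilityMeasure μ] (hT : MeasurePreserving T μ μ)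
    {s : Finset X} {r : ℝ} (hs : ∀ x : X, ∃ c ∈ s, dist x c ≤ r) (M : ℕ) :
    μ {x | ∀ k ∈ Set.Icc 1 M, 2 * r < dist x (T^[k] x)} ≤ (s.card : ENNReal) * (M : ENNReal)⁻¹ := by
  let E : X → Set X := fun c =>
    Metric.closedBall c r \ ⋃ k ∈ Set.Icc 1 M, T^[k] ⁻¹' Metric.closedBall c r
  have hEmeas (c : X) : MeasurableSet (E c) :=
    Metric.isClosed_closedBall.measurableSet.diff <|
      MeasurableSet.biUnion (Set.to_countable _) fun k _ =>
        (hT.measurable.iterate k) Metric.isClosed_closedBall.measurableSet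
  have hE (c : X) : μ (E c) ≤ (M : ENNReal)⁻¹ := by
    rw [ENNReal.le_inv_iff_mul_le, mul_comm]
    by_contra! h
    obtain ⟨x, hx, k, hk, hkx⟩ := hT.exists_mem_iterate_mem_of_measure_univ_lt_mul_measure
      (hEmeas c).nullMeasurableSet (n := M) (by simpa using h)
    exact hx.2 (Set.mem_biUnion (Set.mem_Icc.2 ⟨hk.1, hk.2.le⟩) hkx.1)
  calc μ {x | ∀ k ∈ Set.Icc 1 M, 2 * r < dist x (T^[k] x)}
      ≤ μ (⋃ c ∈ s, E c) := by
        refine measure_mono fun x hx => ?_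
        obtain ⟨c, hc, hxc⟩ := hs x
        refine Set.mem_biUnion hc ⟨hxc, fun h => ?_⟩
        simp only [Set.mem_iUnion, Set.mem_preimage, Metric.mem_closedBall] at h
        obtain ⟨k, hk, hkc⟩ := h
        have := hx k hk
        have := dist_triangle_right x (T^[k] x) c
        linarith
    _ ≤ ∑ c ∈ s, μ (E c) := measure_biUnion_finset_le _ _
    _ ≤ ∑ _c ∈ s, (M : ENNReal)⁻¹ := Finset.sum_le_sum fun c _ => hE c
    _ = _ := by simp

theorem exists_cover_card_eq {X : Type*} [PseudoMetricSpace X] {r : ℝ}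
    (h : ∃ s : Finset X, ∀ x : X, ∃ c ∈ s, dist x c ≤ r) :
    ∃ s : Finset X, (∀ x : X, ∃ c ∈ s, dist x c ≤ r) ∧ s.card = (coverNumber X r).toNat := by
  obtain ⟨s, hs, hcard⟩ := csInf_mem (Set.Nonempty.image
    (fun s : Finset X => (s.card : ℕ∞)) (s := {s | ∀ x : X, ∃ c ∈ s, dist x c ≤ r}) h)
  refine ⟨s, hs, ?_⟩
  rw [coverNumber, ← hcard]
  simp

theorem coverNumber_eq_top {X : Type*} [PseudoMetricSpace X] {r : ℝ}
    (h : ¬ ∃ s : Finset X, ∀ x : X, ∃ c ∈ s, dist x c ≤ r) : coverNumber X r = ⊤ := by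
  have : {s : Finset X | ∀ x : X, ∃ c ∈ s, dist x c ≤ r} = ∅ :=
    Set.eq_empty_iff_forall_notMem.2 fun s hs => h ⟨s, hs⟩
  simp [coverNumber, this]

/-- Spaces of nonzero upper box dimension (in the real-valued, junk-valued sense) are totally
bounded. -/
theorem exists_cover_of_limsup_ne_zero {X : Type*} [PseudoMetricSpace X]
    (h : Filter.limsup
        (fun r : ℝ => Real.log ((coverNumber X r).toNat : ℝ) / (- Real.log r))
        (nhdsWithin 0 (Set.Ioi 0)) ≠ 0) {r : ℝ} (hr : 0 < r) :
    ∃ s : Finset X, ∀ x : X, ∃ c ∈ s, dist x c ≤ r := by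
  by_contra hc
  refine h ?_
  refine (Filter.limsup_congr ?_).trans
    (Filter.limsup_const (f := nhdsWithin (0 : ℝ) (Set.Ioi 0)) (0 : ℝ))
  filter_upwards [Ioo_mem_nhdsGT hr] with q hq
  rw [coverNumber_eq_top]
  · simp
  · rintro ⟨s, hs⟩
    exact hc ⟨s, fun x => (hs x).imp fun c hc => ⟨hc.1, hc.2.trans hq.2.le⟩⟩

theorem eventually_coverNumber_le {X : Type*} [PseudoMetricSpace X] {α β : ℝ} (hα : 0 < α)
    (hbox : Filter.limsup
        (fun r : ℝ => Real.log ((coverNumber X r).toNat : ℝ) / (- Real.log r))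
        (nhdsWithin 0 (Set.Ioi 0)) = α) (hβ : α < β) :
    ∀ᶠ r in nhdsWithin 0 (Set.Ioi 0), ((coverNumber X r).toNat : ℝ) ≤ r ^ (-β) := by
  rw [Filter.limsup_eq] at hbox
  have hne : {a | ∀ᶠ r : ℝ in nhdsWithin 0 (Set.Ioi 0),
      Real.log ((coverNumber X r).toNat : ℝ) / (- Real.log r) ≤ a}.Nonempty := by
    by_contra h
    rw [Set.not_nonempty_iff_eq_empty] at h
    rw [h, Real.sInf_empty] at hbox
    exact hα.ne hbox
  obtain ⟨b, hb, hbβ⟩ := exists_lt_of_csInf_lt hne (hbox.trans_lt hβ)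
  filter_upwards [hb, Ioo_mem_nhdsGT one_pos] with r hr hr1
  have hlog : 0 < - Real.log r := neg_pos.2 (Real.log_neg hr1.1 hr1.2)
  rcases Nat.eq_zero_or_pos (coverNumber X r).toNat with h0 | h0
  · rw [h0]
    simpa using Real.rpow_nonneg hr1.1.le _
  · have h0' : (0 : ℝ) < (coverNumber X r).toNat := by exact_mod_cast h0
    rw [Real.rpow_def_of_pos hr1.1, ← Real.log_le_iff_le_exp h0']
    rw [div_le_iff₀ hlog] at hr
    nlinarith

/-- Borel–Cantelli along dyadic times: almost every point returns `2 · 2 ^ (-n/γ)`-close to itself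
within `2 ^ n` steps, for all large `n`. -/
theorem ae_eventually_dyadic_return {X : Type*} [MetricSpace X] [MeasurableSpace X] [BorelSpace X]
    {α : ℝ} (hα : 0 < α)
    (hbox : Filter.limsup
        (fun r : ℝ => Real.log ((coverNumber X r).toNat : ℝ) / (- Real.log r))
        (nhdsWithin 0 (Set.Ioi 0)) = α)
    {T : X → X} {μ : Measure X} [IsProbabilityMeasure μ] (hT : MeasurePreserving T μ μ)
    {γ : ℝ} (hγ : α < γ) :
    ∀ᵐ x ∂μ, ∀ᶠ n : ℕ in Filter.atTop,
      ∃ k ∈ Set.Icc 1 (2 ^ n), dist x (T^[k] x) ≤ 2 * ((2 : ℝ) ^ (-(1 / γ))) ^ n := by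
  obtain ⟨b, hαb, hbγ⟩ := exists_between hγ
  have hγ0 : 0 < γ := hα.trans hγ
  set ρ : ℝ := (2 : ℝ) ^ (-(1 / γ)) with hρ
  have hρ0 : 0 < ρ := by positivity
  have hρ1 : ρ < 1 := Real.rpow_lt_one_of_one_lt_of_neg one_lt_two (by
    rw [neg_lt_zero]; positivity)
  have hlim : Filter.Tendsto (fun n : ℕ => ρ ^ n) Filter.atTop (nhdsWithin 0 (Set.Ioi 0)) :=
    tendsto_nhdsWithin_iff.2 ⟨tendsto_pow_atTop_nhds_zero_of_lt_one hρ0.le hρ1,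
      Filter.Eventually.of_forall fun n => pow_pos hρ0 n⟩
  obtain ⟨n₀, hn₀⟩ := Filter.eventually_atTop.1
    (hlim.eventually (eventually_coverNumber_le hα hbox hαb))
  set q : ℝ := ρ ^ (-b) / 2 with hq
  have hq0 : 0 < q := by positivity
  have hq1 : q < 1 := by
    rw [hq, div_lt_one two_pos, hρ, ← Real.rpow_mul two_pos.le]
    conv_rhs => rw [← Real.rpow_one 2]
    refine Real.rpow_lt_rpow_of_exponent_lt one_lt_two ?_
    rw [neg_mul_neg, one_div_mul_eq_div, div_lt_one hγ0]
    exact hbγ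
  let A : ℕ → Set X := fun n => {x | ∀ k ∈ Set.Icc 1 (2 ^ n), 2 * ρ ^ n < dist x (T^[k] x)}
  have hA (n : ℕ) (hn : n₀ ≤ n) : μ (A n) ≤ ENNReal.ofReal (q ^ n) := by
    obtain ⟨s, hs, hcard⟩ := exists_cover_card_eq
      (exists_cover_of_limsup_ne_zero (hbox.trans_ne hα.ne') (pow_pos hρ0 n))
    refine (measure_not_return_le hT hs (2 ^ n)).trans ?_
    have h := hn₀ n hn
    rw [← hcard] at h
    have hpow : (q ^ n : ℝ) = (ρ ^ n) ^ (-b) * (((2 ^ n : ℕ) : ℝ))⁻¹ := by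
      rw [hq, div_pow, ← Real.rpow_natCast ρ n, ← Real.rpow_mul hρ0.le, mul_comm (n : ℝ),
        Real.rpow_mul hρ0.le, Real.rpow_natCast, div_eq_mul_inv]
      push_cast
      rfl
    rw [hpow, ENNReal.ofReal_mul (by positivity), ENNReal.ofReal_inv_of_pos (by positivity),
      ENNReal.ofReal_natCast]
    gcongr
    rw [← ENNReal.ofReal_natCast]
    exact ENNReal.ofReal_le_ofReal h
  have hsum : ∑' n, μ (A (n + n₀)) ≠ ⊤ := by
    refine ne_top_of_le_ne_top ?_
      (ENNReal.tsum_le_tsum fun n => hA (n + n₀) (Nat.le_add_left _ _))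
    rw [← ENNReal.ofReal_tsum_of_nonneg (fun n => by positivity)
      ((summable_nat_add_iff n₀).2 (summable_geometric_of_lt_one hq0.le hq1))]
    exact ENNReal.ofReal_ne_top
  filter_upwards [ae_eventually_notMem hsum] with x hx
  rw [← Filter.map_add_atTop_eq_nat n₀, Filter.eventually_map]
  filter_upwards [hx] with n hn
  simpa [A, and_assoc] using hn

theorem stmt4 {X : Type*} [MetricSpace X] [MeasurableSpace X] [BorelSpace X]
    (hdiam : EMetric.diam (Set.univ : Set X) ≠ ⊤)
    (α : ℝ) (hα : 0 < α)
    (hbox : Filter.limsup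
        (fun r : ℝ => Real.log ((coverNumber X r).toNat : ℝ) / (- Real.log r))
        (nhdsWithin 0 (Set.Ioi 0)) = α)
    (T : X → X) (hTmeas : Measurable T)
    (μ : Measure X) [IsProbabilityMeasure μ] (hpres : MeasurePreserving T μ μ)
    (β : ℝ) (hβ : α < β) :
    ∀ᵐ x ∂μ, Filter.Tendsto
      (fun m : ℕ => (m : ℝ) ^ (1 / β) * sInf ((fun k => dist x (T^[k] x)) '' Set.Icc 1 m))
      Filter.atTop (nhds 0) := by
  obtain ⟨γ, hαγ, hγβ⟩ := exists_between hβ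
  have hγ0 : 0 < γ := hα.trans hαγ
  have hβ0 : 0 < β := hα.trans hβ
  filter_upwards [ae_eventually_dyadic_return hα hbox hpres hαγ] with x hx
  set ρ : ℝ := (2 : ℝ) ^ (-(1 / γ)) with hρ
  set σ : ℝ := (2 : ℝ) ^ (1 / β) with hσ
  have hρ0 : 0 < ρ := by positivity
  have hσ0 : 0 < σ := by positivity
  have hσρ : σ * ρ < 1 := by
    rw [hσ, hρ, ← Real.rpow_add two_pos]
    refine Real.rpow_lt_one_of_one_lt_of_neg one_lt_two ?_
    have := one_div_lt_one_div_of_lt hγ0 hγβ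
    linarith
  have hnonneg (m : ℕ) : 0 ≤ sInf ((fun k => dist x (T^[k] x)) '' Set.Icc 1 m) :=
    Real.sInf_nonneg (by rintro _ ⟨k, -, rfl⟩; exact dist_nonneg)
  have hlog : Filter.Tendsto (Nat.log 2) Filter.atTop Filter.atTop :=
    Filter.tendsto_atTop.2 fun n => by
      filter_upwards [Filter.eventually_ge_atTop (2 ^ n)] with m hm
      exact Nat.le_log_of_pow_le one_lt_two hm
  have hlim : Filter.Tendsto (fun m : ℕ => 2 * σ * (σ * ρ) ^ Nat.log 2 m) Filter.atTop
      (nhds 0) := by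
    simpa using ((tendsto_pow_atTop_nhds_zero_of_lt_one (by positivity) hσρ).comp hlog).const_mul
      (2 * σ)
  refine squeeze_zero' (Filter.Eventually.of_forall fun m =>
    mul_nonneg (by positivity) (hnonneg m)) ?_ hlim
  filter_upwards [hlog.eventually hx, Filter.eventually_ge_atTop 1] with m hm hm1
  obtain ⟨k, hk, hkd⟩ := hm
  have hinf : sInf ((fun k => dist x (T^[k] x)) '' Set.Icc 1 m) ≤ 2 * ρ ^ Nat.log 2 m :=
    (csInf_le ⟨0, by rintro _ ⟨k, -, rfl⟩; exact dist_nonneg⟩ (Set.mem_image_of_mem _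
      (Set.mem_Icc.2 ⟨hk.1, hk.2.trans (Nat.pow_log_le_self 2 (by omega))⟩))).trans hkd
  have hpow : (m : ℝ) ^ (1 / β) ≤ σ ^ (Nat.log 2 m + 1) := by
    rw [hσ, ← Real.rpow_natCast, ← Real.rpow_mul two_pos.le, mul_comm (1 / β),
      Real.rpow_mul two_pos.le, Real.rpow_natCast]
    refine Real.rpow_le_rpow (by positivity) ?_ (by positivity)
    exact_mod_cast (Nat.lt_pow_succ_log_self one_lt_two m).le
  calc (m : ℝ) ^ (1 / β) * sInf ((fun k => dist x (T^[k] x)) '' Set.Icc 1 m)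
      ≤ σ ^ (Nat.log 2 m + 1) * (2 * ρ ^ Nat.log 2 m) :=
        mul_le_mul hpow hinf (hnonneg m) (by positivity)
    _ = 2 * σ * (σ * ρ) ^ Nat.log 2 m := by rw [mul_pow]; ring
end

section
/- Let X = [0,1], T(x) = 2x mod 1, and let μ denote Lebesgue measure. If (r_m) is a sequence of nonnegative reals with lim_{m→∞} m·r_m = 0, then μ(R_ea(r_m)) = 0. -/
open MeasureTheory

/-- The doubling map `x ↦ 2x (mod 1)` on `[0,1]`. -/
noncomputable def doubling : ℝ → ℝ := fun x => Int.fract (2 * x)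

/-- The set of eventually always returning points: `x` such that for all sufficiently
large `m`, the orbit segment `{T^k(x) : 1 ≤ k ≤ m}` meets `B(x, r_m)`. -/
def Rea {X : Type*} [PseudoMetricSpace X] (T : X → X) (r : ℕ → ℝ) : Set X :=
  {x | ∃ m₀ : ℕ, ∀ m, m₀ ≤ m → ∃ k, 1 ≤ k ∧ k ≤ m ∧ T^[k] x ∈ Metric.ball x (r m)}

theorem doubling_iterate (k : ℕ) (x : ℝ) :
    doubling^[k + 1] x = Int.fract (2 ^ (k + 1) * x) := by
  induction k with
  | zero => simp [doubling]
  | succ k ih =>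
    rw [Function.iterate_succ_apply', ih, doubling, Int.fract_eq_fract]
    refine ⟨-2 * ⌊(2 : ℝ) ^ (k + 1) * x⌋, ?_⟩
    rw [Int.fract]
    push_cast
    ring

/-- The points of `[0,1]` that return within distance `ρ` at time `k` have measure at most `6ρ`. -/
theorem volume_doubling_return_le {k : ℕ} (hk : 1 ≤ k) {ρ : ℝ} (hρ : 0 ≤ ρ) :
    volume {x ∈ Set.Icc (0 : ℝ) 1 | doubling^[k] x ∈ Metric.ball x ρ} ≤ ENNReal.ofReal (6 * ρ) := by
  obtain ⟨k, rfl⟩ := Nat.exists_eq_add_of_le' hk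
  have h2 : (2 : ℝ) ≤ 2 ^ (k + 1) := le_self_pow₀ one_le_two k.succ_ne_zero
  have hpos : (0 : ℝ) < 2 ^ (k + 1) - 1 := by linarith
  have hsub : {x ∈ Set.Icc (0 : ℝ) 1 | doubling^[k + 1] x ∈ Metric.ball x ρ} ⊆
      ⋃ n ∈ Finset.range (2 ^ (k + 1) + 1),
        Metric.ball ((n : ℝ) / (2 ^ (k + 1) - 1)) (ρ / (2 ^ (k + 1) - 1)) := by
    rintro x ⟨⟨hx0, hx1⟩, hx⟩
    rw [doubling_iterate, Metric.mem_ball, Real.dist_eq, Int.fract] at hx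
    have hnonneg : (0 : ℝ) ≤ 2 ^ (k + 1) * x := by positivity
    have hfloor : ((⌊(2 : ℝ) ^ (k + 1) * x⌋₊ : ℕ) : ℝ) = ⌊(2 : ℝ) ^ (k + 1) * x⌋ :=
      natCast_floor_eq_intCast_floor hnonneg
    simp only [Set.mem_iUnion]
    refine ⟨⌊(2 : ℝ) ^ (k + 1) * x⌋₊, ?_, ?_⟩
    · rw [Finset.mem_range, Nat.lt_succ_iff]
      apply Nat.floor_le_of_le
      push_cast
      nlinarith
    · rw [Metric.mem_ball, Real.dist_eq, hfloor, lt_div_iff₀ hpos, ← abs_of_pos hpos, ← abs_mul,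
        abs_of_pos hpos, sub_mul, div_mul_cancel₀ _ hpos.ne']
      refine lt_of_eq_of_lt (congrArg abs ?_) hx
      ring
  calc
    _ ≤ ∑ n ∈ Finset.range (2 ^ (k + 1) + 1),
        volume (Metric.ball ((n : ℝ) / (2 ^ (k + 1) - 1)) (ρ / (2 ^ (k + 1) - 1))) :=
      (measure_mono hsub).trans (measure_biUnion_finset_le _ _)
    _ = ENNReal.ofReal ((2 ^ (k + 1) + 1) * (2 * (ρ / (2 ^ (k + 1) - 1)))) := by
      simp only [Real.volume_ball, Finset.sum_const, Finset.card_range]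
      rw [← ENNReal.ofReal_nsmul, nsmul_eq_mul]
      push_cast
      rfl
    _ ≤ ENNReal.ofReal (6 * ρ) := by
      apply ENNReal.ofReal_le_ofReal
      rw [← mul_div_assoc, ← mul_div_assoc, div_le_iff₀ hpos]
      nlinarith

/-- The points of `[0,1]` that return within distance `ρ` up to time `m` have measure at most
`6mρ`. -/
theorem volume_doubling_exists_return_le (m : ℕ) {ρ : ℝ} (hρ : 0 ≤ ρ) :
    volume {x ∈ Set.Icc (0 : ℝ) 1 | ∃ k, 1 ≤ k ∧ k ≤ m ∧ doubling^[k] x ∈ Metric.ball x ρ} ≤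
      ENNReal.ofReal (6 * (m * ρ)) := by
  have hsub : {x ∈ Set.Icc (0 : ℝ) 1 | ∃ k, 1 ≤ k ∧ k ≤ m ∧ doubling^[k] x ∈ Metric.ball x ρ} ⊆
      ⋃ k ∈ Finset.Icc 1 m, {x ∈ Set.Icc (0 : ℝ) 1 | doubling^[k] x ∈ Metric.ball x ρ} := by
    rintro x ⟨hx, k, hk1, hkm, hk⟩
    exact Set.mem_biUnion (Finset.mem_Icc.2 ⟨hk1, hkm⟩) ⟨hx, hk⟩
  calc
    _ ≤ ∑ k ∈ Finset.Icc 1 m,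
        volume {x ∈ Set.Icc (0 : ℝ) 1 | doubling^[k] x ∈ Metric.ball x ρ} :=
      (measure_mono hsub).trans (measure_biUnion_finset_le _ _)
    _ ≤ ∑ _k ∈ Finset.Icc 1 m, ENNReal.ofReal (6 * ρ) :=
      Finset.sum_le_sum fun k hk => volume_doubling_return_le (Finset.mem_Icc.1 hk).1 hρ
    _ = ENNReal.ofReal (6 * (m * ρ)) := by
      rw [Finset.sum_const, Nat.card_Icc, Nat.add_sub_cancel, ← ENNReal.ofReal_nsmul, nsmul_eq_mul,
        mul_left_comm]

theorem stmt5 (r : ℕ → ℝ) (hr : ∀ m, 0 ≤ r m)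
    (hlim : Filter.Tendsto (fun m : ℕ => (m : ℝ) * r m) Filter.atTop (nhds 0)) :
    (volume.restrict (Set.Icc (0:ℝ) 1)) (Rea doubling r) = 0 := by
  rw [Measure.restrict_apply' measurableSet_Icc]
  have hsub : Rea doubling r ∩ Set.Icc 0 1 ⊆ ⋃ m₀ : ℕ, {x ∈ Set.Icc (0 : ℝ) 1 | ∀ m, m₀ ≤ m →
      ∃ k, 1 ≤ k ∧ k ≤ m ∧ doubling^[k] x ∈ Metric.ball x (r m)} := by
    rintro x ⟨⟨m₀, hm₀⟩, hx⟩
    exact Set.mem_iUnion.2 ⟨m₀, hx, hm₀⟩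
  refine measure_mono_null hsub (measure_iUnion_null fun m₀ => ?_)
  have hbound : Filter.Tendsto (fun m : ℕ => ENNReal.ofReal (6 * (m * r m))) Filter.atTop
      (nhds 0) := by
    simpa using ENNReal.tendsto_ofReal (hlim.const_mul 6)
  refine le_antisymm (ge_of_tendsto hbound ?_) zero_le
  filter_upwards [Filter.eventually_ge_atTop m₀] with m hm
  refine le_trans (measure_mono ?_) (volume_doubling_exists_return_le m (hr m))
  exact fun x hx => ⟨hx.1, hx.2 m hm⟩
end

section
/- Let X = [0,1], T(x) = 2x mod 1, and let μ denote Lebesgue measure. Suppose h : ℕ → ℝ is a function with h(n) → ∞ as n → ∞, and set r_m = (log m) · h(m)/m. Then μ(R_ea(r_m)) = 1. -/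
open MeasureTheory

/-- Lebesgue measure on the half-open unit interval. -/
noncomputable abbrev unitLebesgue : Measure ℝ := volume.restrict (Set.Ico (0 : ℝ) 1)

instance : IsProbabilityMeasure unitLebesgue := ⟨by simp [unitLebesgue]⟩

lemma measurable_doubling : Measurable doubling :=
  measurable_fract.comp (measurable_const_mul 2)

lemma doubling_mem_Ico (x : ℝ) : doubling x ∈ Set.Ico (0 : ℝ) 1 :=
  ⟨Int.fract_nonneg _, Int.fract_lt_one _⟩

lemma iterate_doubling_mem_Ico {x : ℝ} (hx : x ∈ Set.Ico (0 : ℝ) 1) (n : ℕ) :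
    doubling^[n] x ∈ Set.Ico (0 : ℝ) 1 := by
  cases n with
  | zero => exact hx
  | succ n => rw [Function.iterate_succ_apply']; exact doubling_mem_Ico _

/-- The two inverse branches of the doubling map. -/
noncomputable def branch (b : ℕ) (y : ℝ) : ℝ := 2⁻¹ * (y + b)

lemma measurable_branch (b : ℕ) : Measurable (branch b) := by
  unfold branch; fun_prop

lemma doubling_branch (b : ℕ) {y : ℝ} (hy : y ∈ Set.Ico (0 : ℝ) 1) :
    doubling (branch b y) = y := by
  unfold doubling branch
  rw [show 2 * (2⁻¹ * (y + (b : ℝ))) = y + b by ring, Int.fract_add_natCast,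
    Int.fract_eq_self.2 hy]

lemma branch_mem_Ico {b : ℕ} (hb : b < 2) {y : ℝ} (hy : y ∈ Set.Ico (0 : ℝ) 1) :
    branch b y ∈ Set.Ico (0 : ℝ) 1 := by
  have : (b : ℝ) ≤ 1 := by exact_mod_cast Nat.le_of_lt_succ hb
  have h0 : (0 : ℝ) ≤ b := by positivity
  unfold branch
  constructor <;> linarith [hy.1, hy.2]

lemma unitLebesgue_preimage_branch (b : ℕ) {E : Set ℝ} (hE : MeasurableSet E) :
    unitLebesgue (branch b ⁻¹' E) = 2 * volume (E ∩ Set.Ico ((b : ℝ) / 2) ((b + 1) / 2)) := by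
  have h1 : branch b ⁻¹' E ∩ Set.Ico 0 1
      = (fun y => y + (b : ℝ)) ⁻¹'
        ((fun y => 2⁻¹ * y) ⁻¹' (E ∩ Set.Ico ((b : ℝ) / 2) ((b + 1) / 2))) := by
    ext y
    simp only [branch, Set.mem_inter_iff, Set.mem_preimage, Set.mem_Ico]
    refine and_congr_right fun _ => ⟨fun h => ⟨?_, ?_⟩, fun h => ⟨?_, ?_⟩⟩ <;> linarith [h.1, h.2]
  rw [Measure.restrict_apply (measurable_branch b hE), h1, measure_preimage_add_right,
    Real.volume_preimage_mul_left (by norm_num)]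
  norm_num

lemma unitLebesgue_real_eq_branch {E : Set ℝ} (hE : MeasurableSet E) :
    unitLebesgue.real E =
      (unitLebesgue.real (branch 0 ⁻¹' E) + unitLebesgue.real (branch 1 ⁻¹' E)) / 2 := by
  have h1 : unitLebesgue E = volume (E ∩ Set.Ico (((0 : ℕ) : ℝ) / 2) (((0 : ℕ) + 1) / 2))
      + volume (E ∩ Set.Ico (((1 : ℕ) : ℝ) / 2) (((1 : ℕ) + 1) / 2)) := by
    rw [Measure.restrict_apply hE, ← measure_union _ (hE.inter measurableSet_Ico),
      ← Set.inter_union_distrib_left]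
    · norm_num [Set.Ico_union_Ico_eq_Ico]
    · refine Set.disjoint_left.2 fun x hx hx' => ?_
      have := hx.2.2
      have := hx'.2.1
      norm_num at *
      linarith
  have h2 : 2 * unitLebesgue E
      = unitLebesgue (branch 0 ⁻¹' E) + unitLebesgue (branch 1 ⁻¹' E) := by
    rw [unitLebesgue_preimage_branch 0 hE, unitLebesgue_preimage_branch 1 hE, h1, mul_add]
  have h3 := congrArg ENNReal.toReal h2
  rw [ENNReal.toReal_mul, ENNReal.toReal_add (measure_ne_top _ _) (measure_ne_top _ _)] at h3
  rw [ENNReal.toReal_ofNat] at h3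
  simp only [Measure.real]
  linarith

/-- `D ∩ [0,1)` is a union of dyadic intervals of level `n`. -/
def DyadicDetermined (n : ℕ) (D : Set ℝ) : Prop :=
  ∀ x ∈ Set.Ico (0 : ℝ) 1, ∀ y ∈ Set.Ico (0 : ℝ) 1,
    ⌊(2 : ℝ) ^ n * x⌋ = ⌊(2 : ℝ) ^ n * y⌋ → x ∈ D → y ∈ D

lemma floor_two_pow_eq_of_le {m n : ℕ} (hmn : m ≤ n) {x y : ℝ}
    (h : ⌊(2 : ℝ) ^ n * x⌋ = ⌊(2 : ℝ) ^ n * y⌋) : ⌊(2 : ℝ) ^ m * x⌋ = ⌊(2 : ℝ) ^ m * y⌋ := by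
  obtain ⟨d, rfl⟩ := Nat.exists_eq_add_of_le hmn
  have key : ∀ z : ℝ, ⌊(2 : ℝ) ^ m * z⌋ = ⌊(2 : ℝ) ^ (m + d) * z⌋ / ((2 ^ d : ℕ) : ℤ) := by
    intro z
    rw [← Int.floor_div_natCast]
    congr 1
    push_cast
    field_simp
    ring
  rw [key x, key y, h]

lemma floor_two_pow_doubling_eq {n : ℕ} {x y : ℝ}
    (h : ⌊(2 : ℝ) ^ (n + 1) * x⌋ = ⌊(2 : ℝ) ^ (n + 1) * y⌋) :
    ⌊(2 : ℝ) ^ n * doubling x⌋ = ⌊(2 : ℝ) ^ n * doubling y⌋ := by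
  have h1 : ⌊(2 : ℝ) * x⌋ = ⌊(2 : ℝ) * y⌋ := by
    simpa using floor_two_pow_eq_of_le (m := 1) (by omega) h
  have key : ∀ z : ℝ,
      ⌊(2 : ℝ) ^ n * doubling z⌋ = ⌊(2 : ℝ) ^ (n + 1) * z⌋ - 2 ^ n * ⌊(2 : ℝ) * z⌋ := by
    intro z
    rw [← Int.floor_sub_intCast]
    congr 1
    unfold doubling Int.fract
    push_cast
    ring
  rw [key, key, h, h1]

namespace DyadicDetermined

lemma mono {m n : ℕ} (hmn : m ≤ n) {D : Set ℝ} (hD : DyadicDetermined m D) :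
    DyadicDetermined n D :=
  fun x hx y hy h => hD x hx y hy (floor_two_pow_eq_of_le hmn h)

lemma compl {n : ℕ} {D : Set ℝ} (hD : DyadicDetermined n D) : DyadicDetermined n Dᶜ :=
  fun x hx y hy h hxD hyD => hxD (hD y hy x hx h.symm hyD)

lemma preimage_iterate {n : ℕ} {D : Set ℝ} (hD : DyadicDetermined n D) (i : ℕ) :
    DyadicDetermined (n + i) (doubling^[i] ⁻¹' D) := by
  induction i with
  | zero => exact hD
  | succ i ih =>
    intro x _ y _ h hxD
    exact ih _ (doubling_mem_Ico x) _ (doubling_mem_Ico y) (floor_two_pow_doubling_eq h) hxD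

lemma preimage_branch {n b : ℕ} (hb : b < 2) {D : Set ℝ} (hD : DyadicDetermined (n + 1) D) :
    DyadicDetermined n (branch b ⁻¹' D) := by
  intro x hx y hy h hxD
  refine hD _ (branch_mem_Ico hb hx) _ (branch_mem_Ico hb hy) ?_ hxD
  have key : ∀ z : ℝ, ⌊(2 : ℝ) ^ (n + 1) * branch b z⌋ = ⌊(2 : ℝ) ^ n * z⌋ + (2 ^ n * b : ℕ) := by
    intro z
    rw [← Int.floor_add_natCast]
    congr 1
    unfold branch
    push_cast
    ring
  rw [key, key, h]

/-- Independence of the first `n` binary digits and the remaining ones. -/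
lemma measureReal_inter_preimage_iterate {n : ℕ} {D B : Set ℝ} (hD : DyadicDetermined n D)
    (hDm : MeasurableSet D) (hB : MeasurableSet B) :
    unitLebesgue.real (D ∩ doubling^[n] ⁻¹' B) = unitLebesgue.real D * unitLebesgue.real B := by
  induction n generalizing D with
  | zero =>
    by_cases h : ∃ x ∈ Set.Ico (0 : ℝ) 1, x ∈ D
    · obtain ⟨x, hx, hxD⟩ := h
      have hsub : ∀ y ∈ Set.Ico (0 : ℝ) 1, y ∈ D := by
        intro y hy
        refine hD x hx y hy ?_ hxD
        rw [pow_zero, one_mul, one_mul, Int.floor_eq_zero_iff.2 hx, Int.floor_eq_zero_iff.2 hy]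
      have hD1 : D =ᵐ[unitLebesgue] Set.univ := by
        filter_upwards [ae_restrict_mem measurableSet_Ico] with y hy
        exact propext ⟨fun _ => trivial, fun _ => hsub y hy⟩
      rw [measureReal_congr hD1, measureReal_congr (hD1.inter (Filter.EventuallyEq.refl _ (doubling^[0] ⁻¹' B)))]
      simp
    · push Not at h
      have hD0 : D =ᵐ[unitLebesgue] (∅ : Set ℝ) := by
        filter_upwards [ae_restrict_mem measurableSet_Ico] with y hy
        exact propext ⟨fun hyD => h y hy hyD, fun hy' => hy'.elim⟩
      rw [measureReal_congr hD0, measureReal_congr (hD0.inter (Filter.EventuallyEq.refl _ (doubling^[0] ⁻¹' B)))]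
      simp
  | succ n ih =>
    have hstep : ∀ b < 2, unitLebesgue.real (branch b ⁻¹' (D ∩ doubling^[n + 1] ⁻¹' B))
        = unitLebesgue.real (branch b ⁻¹' D) * unitLebesgue.real B := by
      intro b hb
      rw [← ih (hD.preimage_branch hb) (measurable_branch b hDm)]
      refine measureReal_congr ?_
      filter_upwards [ae_restrict_mem measurableSet_Ico] with y hy
      refine propext (and_congr_right fun _ => ?_)
      change doubling^[n + 1] (branch b y) ∈ B ↔ doubling^[n] y ∈ B
      rw [Function.iterate_succ_apply, doubling_branch b hy]
    rw [unitLebesgue_real_eq_branch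
        (hDm.inter (measurable_doubling.iterate (n + 1) hB)),
      unitLebesgue_real_eq_branch hDm, hstep 0 (by omega), hstep 1 (by omega)]
    ring

end DyadicDetermined

/-- The points whose orbit avoids `A` at all times `i < s`. -/
def avoiding (A : Set ℝ) (s : ℕ) : Set ℝ := {x | ∀ i < s, doubling^[i] x ∉ A}

lemma avoiding_eq_iInter (A : Set ℝ) (s : ℕ) :
    avoiding A s = ⋂ i ∈ Finset.range s, (doubling^[i] ⁻¹' A)ᶜ := by
  ext x; simp [avoiding]

lemma avoiding_succ (A : Set ℝ) (s : ℕ) :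
    avoiding A (s + 1) = doubling ⁻¹' avoiding A s \ A := by
  ext x
  simp only [avoiding, Set.mem_ofPred_eq, Set.mem_sdiff, Set.mem_preimage]
  constructor
  · exact fun h => ⟨fun i hi => h (i + 1) (by omega), h 0 (by omega)⟩
  · rintro ⟨h, h0⟩ i hi
    cases i with
    | zero => exact h0
    | succ i => exact h i (by omega)

lemma avoiding_anti (A : Set ℝ) {s t : ℕ} (hst : s ≤ t) : avoiding A t ⊆ avoiding A s :=
  fun _ hx i hi => hx i (hi.trans_le hst)

lemma measurableSet_avoiding {A : Set ℝ} (hA : MeasurableSet A) (s : ℕ) :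
    MeasurableSet (avoiding A s) := by
  rw [avoiding_eq_iInter]
  exact Finset.measurableSet_biInter _ fun i _ => (measurable_doubling.iterate i hA).compl

lemma DyadicDetermined.avoiding {l : ℕ} {A : Set ℝ} (hA : DyadicDetermined l A) (s : ℕ) :
    DyadicDetermined (s + l) (avoiding A s) := by
  intro x hx y hy h hxA i hi
  exact ((hA.preimage_iterate i).mono (by omega : l + i ≤ s + l)).compl x hx y hy h (hxA i hi)

lemma measureReal_preimage_doubling {B : Set ℝ} (hB : MeasurableSet B) :
    unitLebesgue.real (doubling ⁻¹' B) = unitLebesgue.real B := by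
  have h : DyadicDetermined 1 Set.univ := fun _ _ _ _ _ _ => trivial
  simpa using h.measureReal_inter_preimage_iterate MeasurableSet.univ hB

/-- Kac-type bound for the return time to `A`. -/
lemma mul_measureReal_not_return_add_le_one {A : Set ℝ} (hA : MeasurableSet A) (s : ℕ) :
    s * unitLebesgue.real (doubling ⁻¹' avoiding A s ∩ A) + unitLebesgue.real (avoiding A s)
      ≤ 1 := by
  induction s with
  | zero =>
    rw [Nat.cast_zero, zero_mul, zero_add]
    exact measureReal_le_one
  | succ s ih =>
    have h1 := measureReal_inter_add_sdiff (μ := unitLebesgue) (s := doubling ⁻¹' avoiding A s) hA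
    rw [← avoiding_succ, measureReal_preimage_doubling (measurableSet_avoiding hA s)] at h1
    have h2 : unitLebesgue.real (doubling ⁻¹' avoiding A (s + 1) ∩ A)
        ≤ unitLebesgue.real (doubling ⁻¹' avoiding A s ∩ A) :=
      measureReal_mono (Set.inter_subset_inter_left _
        (Set.preimage_mono (avoiding_anti A (Nat.le_succ s))))
    have h3 := mul_le_mul_of_nonneg_left h2 (by positivity : (0 : ℝ) ≤ s + 1)
    push_cast
    linarith

/-- The dyadic interval of level `l` with index `a`. -/
def dyadicInterval (l : ℕ) (a : ℤ) : Set ℝ := {x | ⌊(2 : ℝ) ^ l * x⌋ = a}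

lemma measurableSet_dyadicInterval (l : ℕ) (a : ℤ) : MeasurableSet (dyadicInterval l a) :=
  (Int.measurable_floor.comp (measurable_const_mul ((2 : ℝ) ^ l))) (measurableSet_singleton a)

lemma dyadicDetermined_dyadicInterval (l : ℕ) (a : ℤ) :
    DyadicDetermined l (dyadicInterval l a) :=
  fun _ _ _ _ h hx => h.symm.trans hx

lemma dyadicInterval_eq_Ico (l : ℕ) (a : ℤ) :
    dyadicInterval l a = Set.Ico ((a : ℝ) / 2 ^ l) ((a + 1) / 2 ^ l) := by
  ext x
  have h2 : (0 : ℝ) < 2 ^ l := by positivity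
  simp only [dyadicInterval, Set.mem_ofPred_eq, Set.mem_Ico, Int.floor_eq_iff, div_le_iff₀ h2,
    lt_div_iff₀ h2, mul_comm x]

lemma measureReal_dyadicInterval_le (l : ℕ) (a : ℤ) :
    unitLebesgue.real (dyadicInterval l a) ≤ (1 / 2) ^ l := by
  have h : unitLebesgue (dyadicInterval l a) ≤ volume (dyadicInterval l a) :=
    Measure.restrict_apply_le _ _
  rw [dyadicInterval_eq_Ico, Real.volume_Ico] at h
  have h' := ENNReal.toReal_mono ENNReal.ofReal_ne_top h
  rw [ENNReal.toReal_ofReal (by rw [← sub_div]; norm_num)] at h'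
  rw [dyadicInterval_eq_Ico]
  refine h'.trans (le_of_eq ?_)
  rw [← sub_div]
  simp

lemma measureReal_dyadicInterval {l : ℕ} {a : ℕ} (ha : a < 2 ^ l) :
    unitLebesgue.real (dyadicInterval l a) = (1 / 2) ^ l := by
  have h2 : (0 : ℝ) < 2 ^ l := by positivity
  have ha' : (a : ℝ) + 1 ≤ 2 ^ l := by exact_mod_cast ha
  have hsub : dyadicInterval l a ⊆ Set.Ico 0 1 := by
    rw [dyadicInterval_eq_Ico]
    refine Set.Ico_subset_Ico (by push_cast; positivity) ?_
    rw [div_le_one h2]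
    exact_mod_cast ha'
  rw [Measure.real, Measure.restrict_eq_self _ hsub, dyadicInterval_eq_Ico, Real.volume_Ico,
    ENNReal.toReal_ofReal (by rw [← sub_div]; norm_num), ← sub_div]
  simp

lemma exists_dyadicInterval_superset {i l : ℕ} (hil : i ≤ l) (a : ℤ) :
    ∃ c : ℤ, dyadicInterval l a ⊆ dyadicInterval i c := by
  rcases Set.eq_empty_or_nonempty (dyadicInterval l a) with h | ⟨x, hx⟩
  · exact ⟨0, by simp [h]⟩
  · exact ⟨⌊(2 : ℝ) ^ i * x⌋, fun y hy => floor_two_pow_eq_of_le hil (hy.trans hx.symm)⟩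

/-- Comparison of hitting and return times via the last visit before time `l`. -/
lemma measureReal_mul_measureReal_avoiding_le {l : ℕ} (hl : 1 ≤ l) (a : ℤ) (s : ℕ) :
    unitLebesgue.real (dyadicInterval l a) * unitLebesgue.real (avoiding (dyadicInterval l a) s)
      ≤ 2 * unitLebesgue.real
          (doubling ⁻¹' avoiding (dyadicInterval l a) s ∩ dyadicInterval l a) := by
  set A := dyadicInterval l a with hAdef
  have hA : MeasurableSet A := measurableSet_dyadicInterval l a
  have hs := measurableSet_avoiding hA s
  set R := doubling ⁻¹' avoiding A s ∩ A with hR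
  have hRm : MeasurableSet R := (measurable_doubling hs).inter hA
  choose! c hc using fun (i : ℕ) (hil : i ≤ l) => exists_dyadicInterval_superset hil a
  rw [← (dyadicDetermined_dyadicInterval l a).measureReal_inter_preimage_iterate hA hs]
  have hcover : A ∩ doubling^[l] ⁻¹' avoiding A s
      ⊆ ⋃ i ∈ Finset.range l, (dyadicInterval i (c i) ∩ doubling^[i] ⁻¹' R) := by
    rintro x ⟨hxA, hxs⟩
    classical
    set j := Nat.findGreatest (fun i => doubling^[i] x ∈ A) (l - 1) with hj
    have hjl : j ≤ l - 1 := Nat.findGreatest_le _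
    have hjA : doubling^[j] x ∈ A :=
      Nat.findGreatest_spec (P := fun i => doubling^[i] x ∈ A) (Nat.zero_le (l - 1)) hxA
    refine Set.mem_biUnion (x := j) (by simp; omega) ⟨hc j (by omega) hxA, ?_, hjA⟩
    intro i _
    rw [← Function.iterate_succ_apply, ← Function.iterate_add_apply]
    rcases Nat.lt_or_ge (i + 1 + j) l with hlt | hge
    · exact Nat.findGreatest_is_greatest (P := fun i => doubling^[i] x ∈ A)
        (by omega : j < i + 1 + j) (by omega)
    · have := hxs (i + 1 + j - l) (by omega)
      rwa [← Function.iterate_add_apply, Nat.sub_add_cancel hge] at this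
  calc unitLebesgue.real (A ∩ doubling^[l] ⁻¹' avoiding A s)
      ≤ ∑ i ∈ Finset.range l, unitLebesgue.real (dyadicInterval i (c i) ∩ doubling^[i] ⁻¹' R) :=
        (measureReal_mono hcover (measure_ne_top _ _)).trans (measureReal_biUnion_finset_le _ _)
    _ ≤ ∑ i ∈ Finset.range l, (1 / 2) ^ i * unitLebesgue.real R := by
        refine Finset.sum_le_sum fun i _ => ?_
        rw [(dyadicDetermined_dyadicInterval i (c i)).measureReal_inter_preimage_iterate
          (measurableSet_dyadicInterval _ _) hRm]
        exact mul_le_mul_of_nonneg_right (measureReal_dyadicInterval_le _ _) measureReal_nonneg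
    _ ≤ 2 * unitLebesgue.real R := by
        rw [← Finset.sum_mul]
        refine mul_le_mul_of_nonneg_right ?_ measureReal_nonneg
        exact sum_geometric_two_le l

lemma measureReal_avoiding_le_half {l a : ℕ} (hl : 1 ≤ l) (ha : a < 2 ^ l) :
    unitLebesgue.real (avoiding (dyadicInterval l a) (4 * 2 ^ l)) ≤ 1 / 2 := by
  have h1 := measureReal_mul_measureReal_avoiding_le hl a (4 * 2 ^ l)
  have h2 := mul_measureReal_not_return_add_le_one (measurableSet_dyadicInterval l a) (4 * 2 ^ l)
  rw [measureReal_dyadicInterval ha] at h1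
  set e := unitLebesgue.real (avoiding (dyadicInterval l a) (4 * 2 ^ l))
  have he : 0 ≤ e := measureReal_nonneg
  have h3 : (2 : ℝ) ^ l * (1 / 2) ^ l = 1 := by rw [← mul_pow]; norm_num
  have h4 := mul_le_mul_of_nonneg_left h1 (by positivity : (0 : ℝ) ≤ 4 * 2 ^ l)
  push_cast at h2
  have h5 : 4 * (2 : ℝ) ^ l * ((1 / 2) ^ l * e) = 4 * e := by linear_combination 4 * e * h3
  linarith

lemma measureReal_avoiding_le_pow {l a : ℕ} (hl : 1 ≤ l) (ha : a < 2 ^ l) (q : ℕ) :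
    unitLebesgue.real (avoiding (dyadicInterval l a) (q * (4 * 2 ^ l + l))) ≤ (1 / 2) ^ q := by
  have hA := measurableSet_dyadicInterval l a
  induction q with
  | zero => exact measureReal_le_one.trans_eq (pow_zero _).symm
  | succ q ih =>
    have hsub : avoiding (dyadicInterval l a) ((q + 1) * (4 * 2 ^ l + l))
        ⊆ avoiding (dyadicInterval l a) (4 * 2 ^ l) ∩ doubling^[4 * 2 ^ l + l] ⁻¹'
          avoiding (dyadicInterval l a) (q * (4 * 2 ^ l + l)) := by
      intro x hx
      rw [add_mul, one_mul] at hx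
      refine ⟨avoiding_anti _ (by omega) hx, fun i hi => ?_⟩
      rw [← Function.iterate_add_apply]
      exact hx _ (by omega)
    refine (measureReal_mono hsub).trans ?_
    rw [((dyadicDetermined_dyadicInterval l a).avoiding _).measureReal_inter_preimage_iterate
      (measurableSet_avoiding hA _) (measurableSet_avoiding hA _), pow_succ']
    exact mul_le_mul (measureReal_avoiding_le_half hl ha) ih measureReal_nonneg (by norm_num)

/-- The points whose orbit does not return to their own dyadic interval of level `l`
up to time `s`. -/
def notReturning (l s : ℕ) : Set ℝ :=
  {x | ∀ k, 1 ≤ k → k ≤ s → ⌊(2 : ℝ) ^ l * doubling^[k] x⌋ ≠ ⌊(2 : ℝ) ^ l * x⌋}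

lemma measureReal_notReturning_le {l : ℕ} (hl : 1 ≤ l) (q : ℕ) :
    unitLebesgue.real (notReturning l (l + q * (4 * 2 ^ l + l))) ≤ (1 / 2) ^ q := by
  have hcover : unitLebesgue.real (notReturning l (l + q * (4 * 2 ^ l + l)))
      ≤ unitLebesgue.real (⋃ a ∈ Finset.range (2 ^ l), (dyadicInterval l a ∩ doubling^[l] ⁻¹'
          avoiding (dyadicInterval l a) (q * (4 * 2 ^ l + l)))) := by
    refine ENNReal.toReal_mono (measure_ne_top _ _) (measure_mono_ae ?_)
    filter_upwards [ae_restrict_mem measurableSet_Ico] with x hx hxN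
    have h2 : (0 : ℝ) < 2 ^ l := by positivity
    have hnn : 0 ≤ ⌊(2 : ℝ) ^ l * x⌋ := Int.floor_nonneg.2 (mul_nonneg h2.le hx.1)
    have hcast : ((⌊(2 : ℝ) ^ l * x⌋.toNat : ℕ) : ℤ) = ⌊(2 : ℝ) ^ l * x⌋ := Int.toNat_of_nonneg hnn
    have hlt : ⌊(2 : ℝ) ^ l * x⌋ < 2 ^ l := by
      rw [Int.floor_lt]
      push_cast
      nlinarith [hx.2]
    refine Set.mem_biUnion (x := ⌊(2 : ℝ) ^ l * x⌋.toNat) ?_ ?_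
    · simp only [Finset.coe_range, Set.mem_Iio]
      zify
      rwa [hcast]
    · rw [hcast]
      refine ⟨rfl, fun i hi => ?_⟩
      rw [← Function.iterate_add_apply]
      exact hxN _ (by omega) (by omega)
  refine (hcover.trans (measureReal_biUnion_finset_le _ _)).trans ?_
  calc _ ≤ ∑ a ∈ Finset.range (2 ^ l), ((1 / 2 : ℝ) ^ l * (1 / 2) ^ q) := by
        refine Finset.sum_le_sum fun a ha => ?_
        have hA := measurableSet_dyadicInterval l a
        rw [(dyadicDetermined_dyadicInterval l a).measureReal_inter_preimage_iterate hA
          (measurableSet_avoiding hA _)]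
        exact mul_le_mul (measureReal_dyadicInterval_le _ _)
          (measureReal_avoiding_le_pow hl (Finset.mem_range.1 ha) q) measureReal_nonneg
          (by positivity)
    _ = (1 / 2) ^ q := by
        rw [Finset.sum_const, Finset.card_range, nsmul_eq_mul, ← mul_assoc]
        push_cast
        rw [← mul_pow]
        norm_num

lemma ae_eventually_return :
    ∀ᵐ x ∂unitLebesgue, ∃ l₀, ∀ l ≥ l₀,
      ∃ k, 1 ≤ k ∧ k ≤ 6 * l * 2 ^ l ∧ |doubling^[k] x - x| < (1 / 2) ^ l := by
  have hsum : ∑' l, unitLebesgue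
      (notReturning (l + 1) ((l + 1) + (l + 1) * (4 * 2 ^ (l + 1) + (l + 1)))) ≠ ⊤ := by
    have hs : Summable fun l : ℕ => (1 / 2 : ℝ) ^ (l + 1) :=
      (summable_nat_add_iff 1).2 summable_geometric_two
    refine ne_top_of_le_ne_top hs.tsum_ofReal_ne_top (ENNReal.tsum_le_tsum fun l => ?_)
    rw [← ofReal_measureReal]
    exact ENNReal.ofReal_le_ofReal (measureReal_notReturning_le (by omega) _)
  filter_upwards [ae_eventually_notMem hsum] with x hx
  obtain ⟨l₀, hl₀⟩ := Filter.eventually_atTop.1 hx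
  refine ⟨l₀ + 1, fun l hl => ?_⟩
  obtain ⟨l, rfl⟩ : ∃ j, l = j + 1 := ⟨l - 1, by omega⟩
  have := hl₀ l (by omega)
  simp only [notReturning, Set.mem_ofPred_eq, not_forall, not_not] at this
  obtain ⟨k, hk1, hk2, hk⟩ := this
  refine ⟨k, hk1, hk2.trans ?_, ?_⟩
  · have : l + 1 < 2 ^ (l + 1) := Nat.lt_two_pow_self
    nlinarith
  · have h := Int.abs_sub_lt_one_of_floor_eq_floor hk
    have h2 : (0 : ℝ) < 2 ^ (l + 1) := by positivity
    rw [← mul_sub, abs_mul, abs_of_pos h2] at h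
    rw [one_div, inv_pow, ← one_div, lt_div_iff₀ h2]
    linarith

/-- Every large `m` is comparable to `l * 2 ^ l` for some `l ≥ l₀`. -/
lemma exists_level (l₀ : ℕ) : ∃ m₀ : ℕ, ∀ m ≥ m₀, ∃ l ≥ l₀, 6 * l * 2 ^ l ≤ m ∧
    (1 / 2 : ℝ) ^ l ≤ Real.log m * 48 / m := by
  refine ⟨6 * (l₀ + 1) * 2 ^ (l₀ + 1), fun m hm => ?_⟩
  set l := Nat.findGreatest (fun l => 6 * l * 2 ^ l ≤ m) m with hl
  have hl₀m : l₀ + 1 ≤ m := by nlinarith [Nat.one_le_two_pow (n := l₀ + 1)]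
  have hl₀ : l₀ + 1 ≤ l := Nat.le_findGreatest hl₀m hm
  have h1 : 6 * l * 2 ^ l ≤ m :=
    Nat.findGreatest_spec (P := fun l => 6 * l * 2 ^ l ≤ m) hl₀m hm
  have h2 : m < 6 * (l + 1) * 2 ^ (l + 1) := by
    by_contra! hcon
    have : l + 1 ≤ m := by nlinarith [Nat.one_le_two_pow (n := l + 1)]
    exact Nat.findGreatest_is_greatest (P := fun l => 6 * l * 2 ^ l ≤ m) (Nat.lt_succ_self l) this
      hcon
  refine ⟨l, by omega, h1, ?_⟩
  have hmpos : (0 : ℝ) < m := by exact_mod_cast (by omega : 0 < m)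
  have h2l : (0 : ℝ) < 2 ^ l := by positivity
  have hl1 : (1 : ℝ) ≤ l := by exact_mod_cast (by omega : 1 ≤ l)
  have hlog : l * Real.log 2 ≤ Real.log m := by
    rw [← Real.log_pow]
    refine Real.log_le_log h2l ?_
    have : 2 ^ l ≤ m := by nlinarith [Nat.one_le_two_pow (n := l)]
    exact_mod_cast this
  have h2' : (m : ℝ) < 6 * (l + 1) * 2 ^ (l + 1) := by exact_mod_cast h2
  rw [one_div, inv_pow, ← one_div, div_le_div_iff₀ h2l hmpos]
  rw [pow_succ] at h2'
  have h3 : (l : ℝ) / 2 ≤ Real.log m := by nlinarith [Real.log_two_gt_d9]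
  have h4 : 12 * ((l : ℝ) + 1) ≤ Real.log m * 48 := by linarith
  nlinarith [mul_le_mul_of_nonneg_right h4 h2l.le]

theorem stmt6 (h : ℕ → ℝ) (hh : Filter.Tendsto h Filter.atTop Filter.atTop)
    (r : ℕ → ℝ) (hr : ∀ m : ℕ, r m = Real.log m * h m / m) :
    (volume.restrict (Set.Icc (0:ℝ) 1)) (Rea doubling r) = 1 := by
  rw [← restrict_Ico_eq_restrict_Icc, ← measure_univ (μ := unitLebesgue)]
  refine measure_congr ?_
  filter_upwards [ae_eventually_return] with x hx
  refine propext ⟨fun _ => trivial, fun _ => ?_⟩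
  obtain ⟨l₀, hl₀⟩ := hx
  obtain ⟨m₁, hm₁⟩ := exists_level l₀
  obtain ⟨m₂, hm₂⟩ := Filter.eventually_atTop.1 (hh.eventually_ge_atTop 48)
  refine ⟨max m₁ m₂, fun m hm => ?_⟩
  obtain ⟨l, hl, hlm, hle⟩ := hm₁ m (le_trans (le_max_left _ _) hm)
  obtain ⟨k, hk1, hk2, hk⟩ := hl₀ l hl
  refine ⟨k, hk1, hk2.trans hlm, ?_⟩
  rw [Metric.mem_ball, Real.dist_eq, hr]
  refine hk.trans_le (hle.trans ?_)
  have := hm₂ m (le_trans (le_max_right _ _) hm)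
  have hlog : 0 ≤ Real.log m := Real.log_natCast_nonneg m
  gcongr
end
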